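/- arXiv:0901.1652 — 2 statements merged into one kernel-verified Lean document; each statement's English description precedes it below -/
import Mathlib

section
/- Basic supersymmetric Ward identity: for every β > 0, ε > 0, L ≥ 2, every m ∈ ℝ, and every pair of distinct sites x, y ∈ Λ, one has ⟨B_{xy}^m (1 − m G_{xy})⟩ₜₛ = 1, where G_{xy}(t,s) = (e^{t_x+t_y}/B_{xy}) [(δ_x − δ_y); D_{β,ε}(t)^{-1} (δ_x − δ_y)]. -/
open scoped BigOperators Classical
open MeasureTheory

noncomputable section

/-- The 3-dimensional discrete torus of side `L`. -/
abbrev Torus (L : ℕ) := Fin 3 → ZMod L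

/-- The unit vector in direction `i`. -/
def unitVec (L : ℕ) (i : Fin 3) : Torus L := fun j => if j = i then 1 else 0

/-- Nearest-neighbor relation on the torus. -/
def NN {L : ℕ} (x y : Torus L) : Prop :=
  x ≠ y ∧ ∃ i : Fin 3, y = x + unitVec L i ∨ y = x - unitVec L i

/-- Periodic (Euclidean) distance on the torus. -/
def torusDist {L : ℕ} (x y : Torus L) : ℝ :=
  Real.sqrt (∑ i : Fin 3, (min ((x i - y i).val) (L - (x i - y i).val) : ℝ) ^ 2)

variable {L : ℕ}

/-- Sum of a (symmetric) function over unordered nearest-neighbor pairs. -/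
def nnSum [NeZero L] (f : Torus L → Torus L → ℝ) : ℝ :=
  (1 / 2) * ∑ x : Torus L, ∑ y : Torus L, if NN x y then f x y else 0

/-- The matrix of the operator `D_{β,ε}(t)`, the symmetric operator on `ℝ^Λ` with
quadratic form `β ∑_{NN (ij)} e^{t_i+t_j}(v_i-v_j)² + ε ∑_k e^{t_k} v_k²`. -/
def Dmat [NeZero L] (β ε : ℝ) (t : Torus L → ℝ) : Matrix (Torus L) (Torus L) ℝ :=
  Matrix.of fun j k =>
    if j = k then
      β * (∑ i : Torus L, if NN i j then Real.exp (t i + t j) else 0) + ε * Real.exp (t j)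
    else if NN j k then -(β * Real.exp (t j + t k)) else 0

/-- The free energy (effective action) `F_{β,ε}(t)`. -/
def freeEnergy [NeZero L] (β ε : ℝ) (t : Torus L → ℝ) : ℝ :=
  β * nnSum (fun i j => Real.cosh (t i - t j) - 1)
    - (1 / 2) * Real.log (Dmat β ε t).det
    + ∑ k : Torus L, (t k - ε + ε * Real.cosh (t k))

/-- The expectation `⟨f⟩ = ∫ f(t) e^{-F_{β,ε}(t)} ∏ dt_k/√(2π)`. -/
def expect [NeZero L] (β ε : ℝ) (f : (Torus L → ℝ) → ℝ) : ℝ :=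
  ∫ t : Torus L → ℝ,
    f t * Real.exp (-(freeEnergy β ε t)) *
      ((Real.sqrt (2 * Real.pi))⁻¹) ^ (Fintype.card (Torus L))

/-- `B_{xy} = cosh(t_x - t_y) + (1/2)(s_x - s_y)² e^{t_x+t_y}`. -/
def Bq {L : ℕ} (t s : Torus L → ℝ) (x y : Torus L) : ℝ :=
  Real.cosh (t x - t y) + (1 / 2) * (s x - s y) ^ 2 * Real.exp (t x + t y)

/-- `z^b_k = cosh t_k + (1/2) s_k² e^{t_k}`. -/
def zb {L : ℕ} (t s : Torus L → ℝ) (k : Torus L) : ℝ :=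
  Real.cosh (t k) + (1 / 2) * (s k) ^ 2 * Real.exp (t k)

/-- The `(t,s)`-expectation of the `H^{2|2}` model after integrating out the
Grassmann fields. -/
def tsExpect [NeZero L] (β ε : ℝ) (g : (Torus L → ℝ) → (Torus L → ℝ) → ℝ) : ℝ :=
  ∫ p : (Torus L → ℝ) × (Torus L → ℝ),
    g p.1 p.2 * (Dmat β ε p.1).det *
      Real.exp (-(β * nnSum (fun i j => Bq p.1 p.2 i j - 1))
        - ε * ∑ k : Torus L, (zb p.1 p.2 k - 1)) *
      (∏ k : Torus L, Real.exp (-(p.1 k))) * ((2 * Real.pi)⁻¹) ^ (Fintype.card (Torus L))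

/-- The coordinate unit vector `δ_x`. -/
def delta {L : ℕ} (x : Torus L) : Torus L → ℝ := fun j => if j = x then 1 else 0

/-- `[u ; G v] = ∑_{a,b} u_a G_{ab} v_b`. -/
def qform [NeZero L] (G : Matrix (Torus L) (Torus L) ℝ) (u v : Torus L → ℝ) : ℝ :=
  ∑ a : Torus L, ∑ b : Torus L, u a * G a b * v b

/-- The Green's function
`G_{xy}(t,s) = (e^{t_x+t_y}/B_{xy}) [(δ_x - δ_y); D_{β,ε}(t)⁻¹ (δ_x - δ_y)]`. -/
def Gfun [NeZero L] (β ε : ℝ) (t s : Torus L → ℝ) (x y : Torus L) : ℝ :=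
  Real.exp (t x + t y) / Bq t s x y *
    qform (Dmat β ε t)⁻¹ (delta x - delta y) (delta x - delta y)


section swi_part_A
open MeasureTheory

/-- The one-dimensional (inverse Gaussian) integral. -/
lemma swi_oneD (c : ℝ) (hc : 0 < c) :
    ∫⁻ x in Set.Ioi (0:ℝ), ENNReal.ofReal (Real.exp (-(x + c ^ 2 / x) / 2) / √x)
      = ENNReal.ofReal (√(2 * Real.pi) * Real.exp (-c)) := by
  set r : ℝ → ℝ := fun v => √(v ^ 2 + 4 * c) with hr
  set u : ℝ → ℝ := fun v => (v + r v) / 2 with hu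
  have hrpos : ∀ v, 0 < r v := fun v => Real.sqrt_pos.2 (by positivity)
  have hrsq : ∀ v, r v ^ 2 = v ^ 2 + 4 * c := fun v => Real.sq_sqrt (by positivity)
  have hrabs : ∀ v, |v| < r v := by
    intro v
    apply Real.lt_sqrt_of_sq_lt
    rw [sq_abs]; linarith
  have hupos : ∀ v, 0 < u v := by
    intro v
    have := neg_abs_le v
    have := hrabs v
    simp only [hu]; linarith
  have huq : ∀ v, u v - c / u v = v := by
    intro v
    have h1 := (hupos v).ne'
    have h2 : u v ^ 2 - c = v * u v := by
      have := hrsq v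
      simp only [hu]; nlinarith
    field_simp
    linarith
  have hud : ∀ v, HasDerivAt u (u v / r v) v := by
    intro v
    have h1 : HasDerivAt (fun v : ℝ => v ^ 2 + 4 * c) (2 * v) v := by
      simpa using ((hasDerivAt_id v).pow 2).add_const (4 * c)
    have h2 : HasDerivAt r (2 * v / (2 * √(v ^ 2 + 4 * c))) v :=
      h1.sqrt (by positivity)
    have h3 := ((hasDerivAt_id v).add h2).div_const 2
    refine h3.congr_deriv ?_
    have := (hrpos v).ne'
    change (1 + 2 * v / (2 * r v)) / 2 = u v / r v
    simp only [hu]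
    field_simp
    try ring
  have hfd : ∀ v, HasDerivAt (fun v => u v ^ 2) (2 * u v * (u v / r v)) v := by
    intro v
    refine ((hud v).fun_pow 2).congr_deriv ?_
    simp
  have hinj : Function.Injective (fun v => u v ^ 2) := by
    intro a b hab
    have : u a = u b := by
      have := congrArg Real.sqrt hab
      simpa [Real.sqrt_sq (hupos a).le, Real.sqrt_sq (hupos b).le] using this
    rw [← huq a, ← huq b, this]
  have himg : (fun v => u v ^ 2) '' Set.univ = Set.Ioi 0 := by
    ext z
    constructor
    · rintro ⟨v, -, rfl⟩
      have := hupos v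
      exact Set.mem_Ioi.2 (by positivity)
    · intro hz
      have hz : 0 < z := hz
      refine ⟨√z - c / √z, trivial, ?_⟩
      have hs : 0 < √z := Real.sqrt_pos.2 hz
      have h1 : r (√z - c / √z) = √z + c / √z := by
        simp only [hr]
        rw [Real.sqrt_eq_iff_mul_self_eq (by positivity) (by positivity)]
        field_simp
        ring
      have h2 : u (√z - c / √z) = √z := by
        simp only [hu, h1]; ring
      simp only [h2]
      exact Real.sq_sqrt hz.le
  rw [← himg, lintegral_image_eq_lintegral_abs_deriv_mul MeasurableSet.univ
    (fun v _ => (hfd v).hasDerivWithinAt) hinj.injOn]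
  rw [Measure.restrict_univ]
  have key : ∀ v, ENNReal.ofReal |2 * u v * (u v / r v)| *
      ENNReal.ofReal (Real.exp (-(u v ^ 2 + c ^ 2 / u v ^ 2) / 2) / √(u v ^ 2))
      = ENNReal.ofReal (Real.exp (-c) * Real.exp (-(1/2) * v ^ 2) * (1 + v / r v)) := by
    intro v
    have h1 := hupos v
    have h2 := hrpos v
    rw [← ENNReal.ofReal_mul (abs_nonneg _), abs_of_pos (by positivity), Real.sqrt_sq h1.le]
    congr 1
    have h3 : u v ^ 2 + c ^ 2 / u v ^ 2 = v ^ 2 + 2 * c := by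
      have h4 : v ^ 2 = (u v - c / u v) ^ 2 := by rw [huq v]
      rw [h4]
      field_simp
      ring
    have h5 : 1 + v / r v = 2 * u v / r v := by
      simp only [hu]
      field_simp
      ring
    rw [h3, h5, ← Real.exp_add]
    have : -(v ^ 2 + 2 * c) / 2 = -c + -(1/2) * v ^ 2 := by ring
    rw [this]
    field_simp
  simp_rw [key]
  set g : ℝ → ENNReal := fun v =>
    ENNReal.ofReal (Real.exp (-c) * Real.exp (-(1/2) * v ^ 2) * (1 + v / r v)) with hg
  have hgm : Measurable g := by
    simp only [hg, hr]; fun_prop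
  have hneg : ∫⁻ v, g (-v) = ∫⁻ v, g v :=
    (Measure.measurePreserving_neg (volume : Measure ℝ)).lintegral_comp hgm
  have hnn : ∀ v, 0 ≤ 1 + v / r v := by
    intro v
    have h1 := hrabs v
    have h2 := neg_abs_le v
    have h3 := hrpos v
    have : -1 ≤ v / r v := by rw [le_div_iff₀ h3]; linarith
    linarith
  have hsum : ∀ v, g v + g (-v) = 2 * ENNReal.ofReal (Real.exp (-c) * Real.exp (-(1/2) * v ^ 2)) := by
    intro v
    simp only [hg]
    rw [← ENNReal.ofReal_add (by have := hnn v; positivity) (by have := hnn (-v); positivity)]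
    rw [show (2:ENNReal) = ENNReal.ofReal 2 by simp, ← ENNReal.ofReal_mul (by norm_num)]
    congr 1
    have : r (-v) = r v := by simp [hr]
    rw [this]
    ring_nf
  have h2 : 2 * ∫⁻ v, g v = 2 * ENNReal.ofReal (√(2 * Real.pi) * Real.exp (-c)) := by
    calc 2 * ∫⁻ v, g v = ∫⁻ v, (g v + g (-v)) := by
          rw [lintegral_add_left hgm, hneg, two_mul]
      _ = 2 * ∫⁻ v : ℝ, ENNReal.ofReal (Real.exp (-c) * Real.exp (-(1/2) * v ^ 2)) := by
          simp_rw [hsum]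
          rw [lintegral_const_mul _ (by fun_prop)]
      _ = _ := by
          congr 1
          rw [← ofReal_integral_eq_lintegral_ofReal
            ((integrable_exp_neg_mul_sq (by norm_num)).const_mul _)
            (Filter.Eventually.of_forall fun v => by positivity)]
          rw [integral_const_mul, integral_gaussian]
          congr 1
          rw [mul_comm]
          congr 2
          ring
  exact (ENNReal.mul_right_inj (by norm_num) (by norm_num)).1 h2

end swi_part_A

section swi_part_B
open MeasureTheory Matrix

set_option linter.unusedSectionVars false
set_option linter.unusedSimpArgs false

section
variable {V : Type} [Fintype V] [DecidableEq V]

/-- The Schrödinger-type matrix `diag h - W`. -/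
def swiH (W : Matrix V V ℝ) (h : V → ℝ) : Matrix V V ℝ := Matrix.diagonal h - W

/-- The change of variables `t ↦ h`. -/
noncomputable def swiF (W : Matrix V V ℝ) (η t : V → ℝ) : V → ℝ := fun i =>
  ∑ j, W i j * Real.exp (t j - t i) + η i * Real.exp (-t i)

lemma swiH_mulVec (W : Matrix V V ℝ) (h v : V → ℝ) (i : V) :
    (swiH W h *ᵥ v) i = h i * v i - ∑ j, W i j * v j := by
  rw [swiH, Matrix.sub_mulVec, Pi.sub_apply, Matrix.mulVec_diagonal]
  rfl

lemma swiH_F_mulVec_exp (W : Matrix V V ℝ) (η t : V → ℝ) :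
    swiH W (swiF W η t) *ᵥ (fun i => Real.exp (t i)) = η := by
  funext i
  rw [swiH_mulVec, swiF, add_mul, Finset.sum_mul, mul_assoc, ← Real.exp_add]
  have : ∀ j, W i j * Real.exp (t j - t i) * Real.exp (t i) = W i j * Real.exp (t j) := by
    intro j
    rw [mul_assoc, ← Real.exp_add]; congr 2; ring
  simp [this]

lemma swiH_quad (W : Matrix V V ℝ) (hW : ∀ i j, W i j = W j i) (η t v : V → ℝ) :
    v ⬝ᵥ (swiH W (swiF W η t) *ᵥ v) =
      (1/2) * ∑ i, ∑ j, W i j * Real.exp (t i + t j) *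
        (Real.exp (-t i) * v i - Real.exp (-t j) * v j) ^ 2
      + ∑ i, η i * Real.exp (-t i) * v i ^ 2 := by
  have e1 : ∀ i j, W i j * Real.exp (t i + t j) *
        (Real.exp (-t i) * v i - Real.exp (-t j) * v j) ^ 2 =
      W i j * Real.exp (t j - t i) * v i ^ 2 + W j i * Real.exp (t i - t j) * v j ^ 2
       - 2 * (v i * (W i j * v j)) := by
    intro i j
    rw [← hW i j]
    have a1 : Real.exp (t i + t j) = Real.exp (t i) * Real.exp (t j) := Real.exp_add _ _
    rw [a1, sub_eq_add_neg (t j), sub_eq_add_neg (t i), Real.exp_add, Real.exp_add,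
      Real.exp_neg, Real.exp_neg]
    have := Real.exp_pos (t i)
    have := Real.exp_pos (t j)
    field_simp
    ring
  simp_rw [e1, Finset.sum_sub_distrib, Finset.sum_add_distrib]
  rw [Finset.sum_comm (f := fun i j => W j i * Real.exp (t i - t j) * v j ^ 2)]
  simp only [dotProduct, swiH_mulVec, swiF, mul_sub, Finset.sum_sub_distrib, add_mul, mul_add,
    Finset.sum_add_distrib, Finset.mul_sum, Finset.sum_mul]
  have e2 : ∀ i j, v i * (W i j * Real.exp (t j - t i) * v i)
      = W i j * Real.exp (t j - t i) * v i ^ 2 := by intros; ring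
  have e3 : ∀ i, v i * (η i * Real.exp (-t i) * v i) = η i * Real.exp (-t i) * v i ^ 2 := by
    intros; ring
  simp only [e2, e3, ← Finset.mul_sum]
  ring

lemma swiH_isHermitian (W : Matrix V V ℝ) (hW : ∀ i j, W i j = W j i) (h : V → ℝ) :
    (swiH W h).IsHermitian := by
  apply Matrix.IsHermitian.sub
  · exact Matrix.isHermitian_diagonal _
  · ext i j; simp [hW i j]

lemma swiH_F_posDef (W : Matrix V V ℝ) (hW : ∀ i j, W i j = W j i) (hW0 : ∀ i j, 0 ≤ W i j)
    (η t : V → ℝ) (hη : ∀ i, 0 < η i) : (swiH W (swiF W η t)).PosDef := by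
  refine Matrix.PosDef.of_dotProduct_mulVec_pos (swiH_isHermitian W hW _) ?_
  intro v hv
  rw [star_trivial, swiH_quad W hW]
  obtain ⟨k, hk⟩ := Function.ne_iff.1 hv
  have h1 : 0 ≤ (1/2) * ∑ i, ∑ j, W i j * Real.exp (t i + t j) *
        (Real.exp (-t i) * v i - Real.exp (-t j) * v j) ^ 2 := by
    refine mul_nonneg (by norm_num) (Finset.sum_nonneg fun i _ => Finset.sum_nonneg fun j _ => ?_)
    have := hW0 i j
    positivity
  have h2 : 0 < ∑ i, η i * Real.exp (-t i) * v i ^ 2 := by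
    refine Finset.sum_pos' (fun i _ => ?_) ⟨k, Finset.mem_univ _, ?_⟩
    · have := hη i; positivity
    · have := hη k
      have : v k ≠ 0 := by simpa using hk
      positivity
  linarith

/-- M-matrix property. -/
lemma swiH_inv_nonneg (W : Matrix V V ℝ) (hW0 : ∀ i j, 0 ≤ W i j)
    (h : V → ℝ) (hH : (swiH W h).PosDef) (η : V → ℝ) (hη : ∀ i, 0 ≤ η i) (i : V) :
    0 ≤ ((swiH W h)⁻¹ *ᵥ η) i := by
  set ψ := (swiH W h)⁻¹ *ᵥ η with hψ
  have hdet : IsUnit (swiH W h).det := hH.det_pos.ne'.isUnit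
  have hHψ : swiH W h *ᵥ ψ = η := by
    rw [hψ, Matrix.mulVec_mulVec, Matrix.mul_nonsing_inv _ hdet, Matrix.one_mulVec]
  set n : V → ℝ := fun i => max (-ψ i) 0 with hn
  have hle : n ⬝ᵥ (swiH W h *ᵥ n) ≤ - (n ⬝ᵥ η) := by
    rw [← hHψ]
    simp only [dotProduct, swiH_mulVec, ← Finset.sum_neg_distrib]
    refine Finset.sum_le_sum fun i _ => ?_
    have hn0 : 0 ≤ n i := le_max_right _ _
    have h1 : n i * n i = - (n i * ψ i) := by
      simp only [hn]
      rcases le_total (-ψ i) 0 with h | h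
      · simp [max_eq_right h]
      · simp [max_eq_left h]
    have h2 : -∑ j, W i j * n j ≤ ∑ j, W i j * ψ j := by
      rw [← Finset.sum_neg_distrib]
      refine Finset.sum_le_sum fun j _ => ?_
      have : - n j ≤ ψ j := by
        have := le_max_left (-ψ j) 0
        simp only [hn]; linarith
      nlinarith [hW0 i j]
    have h3 := mul_le_mul_of_nonneg_left h2 hn0
    linear_combination h3 + h i * h1
  have h0 : 0 ≤ n ⬝ᵥ η := Finset.sum_nonneg fun i _ => mul_nonneg (le_max_right _ _) (hη i)
  have hnz : n = 0 := by
    by_contra hne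
    have := hH.dotProduct_mulVec_pos hne
    rw [star_trivial] at this
    linarith
  have h4 : n i = 0 := by rw [hnz]; rfl
  have h5 := le_max_left (-ψ i) 0
  change -ψ i ≤ n i at h5
  linarith

lemma swiH_inv_pos (W : Matrix V V ℝ) (hW0 : ∀ i j, 0 ≤ W i j)
    (h : V → ℝ) (hH : (swiH W h).PosDef) (η : V → ℝ) (hη : ∀ i, 0 < η i) (i : V) :
    0 < ((swiH W h)⁻¹ *ᵥ η) i := by
  have hnn := swiH_inv_nonneg W hW0 h hH η (fun i => (hη i).le)
  refine lt_of_le_of_ne (hnn i) fun h0 => ?_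
  have hdet : IsUnit (swiH W h).det := hH.det_pos.ne'.isUnit
  have hHψ : swiH W h *ᵥ ((swiH W h)⁻¹ *ᵥ η) = η := by
    rw [Matrix.mulVec_mulVec, Matrix.mul_nonsing_inv _ hdet, Matrix.one_mulVec]
  have h1 := congrFun hHψ i
  rw [swiH_mulVec, ← h0] at h1
  have h2 : 0 ≤ ∑ j, W i j * ((swiH W h)⁻¹ *ᵥ η) j :=
    Finset.sum_nonneg fun j _ => mul_nonneg (hW0 i j) (hnn j)
  have := hη i
  linarith

lemma swiF_inv (W : Matrix V V ℝ) (hW : ∀ i j, W i j = W j i) (hW0 : ∀ i j, 0 ≤ W i j)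
    (η t : V → ℝ) (hη : ∀ i, 0 < η i) :
    (swiH W (swiF W η t))⁻¹ *ᵥ η = fun i => Real.exp (t i) := by
  have hdet : IsUnit (swiH W (swiF W η t)).det := (swiH_F_posDef W hW hW0 η t hη).det_pos.ne'.isUnit
  conv_lhs => rw [← swiH_F_mulVec_exp W η t]
  rw [swiH_F_mulVec_exp W η t]
  conv_lhs => rw [← swiH_F_mulVec_exp W η t]
  rw [Matrix.mulVec_mulVec]
  rw [swiH_F_mulVec_exp W η t, Matrix.nonsing_inv_mul _ hdet, Matrix.one_mulVec]

lemma swiF_injective (W : Matrix V V ℝ) (hW : ∀ i j, W i j = W j i) (hW0 : ∀ i j, 0 ≤ W i j)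
    (η : V → ℝ) (hη : ∀ i, 0 < η i) : Function.Injective (swiF W η) := by
  intro a b hab
  have h1 := swiF_inv W hW hW0 η a hη
  rw [hab, swiF_inv W hW hW0 η b hη] at h1
  funext i
  exact (Real.exp_injective (congrFun h1 i)).symm

lemma swiF_range (W : Matrix V V ℝ) (hW : ∀ i j, W i j = W j i) (hW0 : ∀ i j, 0 ≤ W i j)
    (η : V → ℝ) (hη : ∀ i, 0 < η i) :
    swiF W η '' Set.univ = {h | (swiH W h).PosDef} := by
  ext h
  constructor
  · rintro ⟨t, -, rfl⟩
    exact swiH_F_posDef W hW hW0 η t hη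
  · intro hH
    have hH : (swiH W h).PosDef := hH
    have hpos := swiH_inv_pos W hW0 h hH η hη
    have hdet : IsUnit (swiH W h).det := hH.det_pos.ne'.isUnit
    have hHψ : swiH W h *ᵥ ((swiH W h)⁻¹ *ᵥ η) = η := by
      rw [Matrix.mulVec_mulVec, Matrix.mul_nonsing_inv _ hdet, Matrix.one_mulVec]
    set ψ := (swiH W h)⁻¹ *ᵥ η with hψ
    refine ⟨fun i => Real.log (ψ i), trivial, ?_⟩
    funext i
    have h1 := congrFun hHψ i
    rw [swiH_mulVec] at h1
    have h2 : ∀ j, Real.exp (Real.log (ψ j) - Real.log (ψ i)) = ψ j / ψ i := fun j => by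
      rw [Real.exp_sub, Real.exp_log (hpos j), Real.exp_log (hpos i)]
    simp only [swiF, h2, Real.exp_neg, Real.exp_log (hpos i)]
    have h3 := (hpos i).ne'
    have h4 : ∑ j, W i j * (ψ j / ψ i) = (∑ j, W i j * ψ j) / ψ i := by
      rw [Finset.sum_div]; simp [mul_div_assoc]
    rw [h4, ← h1]
    field_simp
    ring

lemma swiF_continuous (W : Matrix V V ℝ) (η : V → ℝ) : Continuous (swiF W η) := by
  unfold swiF; fun_prop

lemma swiH_measurableSet (W : Matrix V V ℝ) (hW : ∀ i j, W i j = W j i) (hW0 : ∀ i j, 0 ≤ W i j) :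
    MeasurableSet {h : V → ℝ | (swiH W h).PosDef} := by
  rw [← swiF_range W hW hW0 (fun _ => 1) (fun _ => one_pos)]
  exact MeasurableSet.univ.image_of_continuousOn_injOn (swiF_continuous _ _).continuousOn
    (swiF_injective W hW hW0 _ (fun _ => one_pos)).injOn

/-- Jacobian matrix. -/
noncomputable def swiJ (W : Matrix V V ℝ) (η t : V → ℝ) : Matrix V V ℝ :=
  - (Matrix.diagonal (fun i => Real.exp (-t i)) * swiH W (swiF W η t) *
      Matrix.diagonal (fun i => Real.exp (t i)))

lemma swiJ_abs_det (W : Matrix V V ℝ) (hW : ∀ i j, W i j = W j i) (hW0 : ∀ i j, 0 ≤ W i j)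
    (η t : V → ℝ) (hη : ∀ i, 0 < η i) :
    |(swiJ W η t).det| = (swiH W (swiF W η t)).det := by
  have hp := (swiH_F_posDef W hW hW0 η t hη).det_pos
  rw [swiJ, Matrix.det_neg, Matrix.det_mul, Matrix.det_mul, Matrix.det_diagonal,
    Matrix.det_diagonal, abs_mul, abs_pow, abs_neg, abs_one, one_pow, one_mul]
  have : (∏ i, Real.exp (-t i)) * (swiH W (swiF W η t)).det * ∏ i, Real.exp (t i)
      = (swiH W (swiF W η t)).det := by
    rw [mul_right_comm, ← Finset.prod_mul_distrib]
    simp [← Real.exp_add]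
  rw [this, abs_of_pos hp]

lemma swiF_hasFDerivAt (W : Matrix V V ℝ) (η t : V → ℝ) :
    HasFDerivAt (swiF W η) (LinearMap.toContinuousLinearMap (Matrix.toLin' (swiJ W η t))) t := by
  rw [hasFDerivAt_pi']
  intro i
  have hp : ∀ j, HasFDerivAt (fun t : V → ℝ => t j) (ContinuousLinearMap.proj (R := ℝ) j) t :=
    fun j => (ContinuousLinearMap.proj (R := ℝ) (φ := fun _ : V => ℝ) j).hasFDerivAt
  have h1 : ∀ j, HasFDerivAt (fun t : V → ℝ => W i j * Real.exp (t j - t i)) _ t :=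
    fun j => (((hp j).sub (hp i)).exp).const_mul (W i j)
  have h2 := (HasFDerivAt.fun_sum (u := Finset.univ) fun j _ => h1 j).add
    (((hp i).neg.exp).const_mul (η i))
  refine h2.congr_fderiv ?_
  ext v
  simp [swiJ, Matrix.neg_mulVec, ← Matrix.mulVec_mulVec, Matrix.mulVec_diagonal, swiH_mulVec, swiF]
  have e : ∀ j, W i j * (Real.exp (t j - t i) * (v j - v i)) =
      Real.exp (-t i) * (W i j * (Real.exp (t j) * v j)) - W i j * Real.exp (t j - t i) * v i := by
    intro j
    rw [show t j - t i = -t i + t j by ring, Real.exp_add]; ring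
  simp_rw [e, Finset.sum_sub_distrib, ← Finset.mul_sum, ← Finset.sum_mul]
  have e2 : Real.exp (-t i) * Real.exp (t i) = 1 := by rw [← Real.exp_add]; simp
  linear_combination (-(∑ j, W i j * Real.exp (t j - t i)) * v i - η i * Real.exp (-t i) * v i) * e2 * (-1)

end

end swi_part_B

section swi_part_C
open MeasureTheory Matrix

set_option linter.unusedSectionVars false
set_option linter.unusedSimpArgs false

section
variable {V : Type} [Fintype V] [DecidableEq V]

/-- The integrand of the Letac–Wesołowski type identity. -/
noncomputable def swiG (W : Matrix V V ℝ) (η h : V → ℝ) : ENNReal :=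
  ENNReal.ofReal (Real.exp (-(∑ i, h i + η ⬝ᵥ ((swiH W h)⁻¹ *ᵥ η)) / 2) / √(swiH W h).det)

lemma swiH_continuous (W : Matrix V V ℝ) : Continuous (swiH W) := by
  unfold swiH; fun_prop

lemma swiG_measurable (W : Matrix V V ℝ) (η : V → ℝ) : Measurable (swiG W η) := by
  have h1 : Measurable fun h => (swiH W h).det := (swiH_continuous W).matrix_det.measurable
  have h2 : ∀ i j, Measurable fun h => (swiH W h)⁻¹ i j := by
    intro i j
    simp only [Matrix.inv_def, Ring.inverse_eq_inv', Matrix.smul_apply, smul_eq_mul]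
    refine h1.inv.mul ?_
    exact ((swiH_continuous W).matrix_adjugate.matrix_elem i j).measurable
  have h3 : Measurable fun h => η ⬝ᵥ ((swiH W h)⁻¹ *ᵥ η) := by
    simp only [dotProduct, Matrix.mulVec]
    refine Finset.measurable_sum _ fun i _ => Measurable.const_mul ?_ _
    exact Finset.measurable_sum _ fun j _ => (h2 i j).mul_const _
  have h4 : Measurable fun h : V → ℝ => ∑ i, h i := by fun_prop
  exact ((((h4.add h3).neg.div_const 2).exp).div h1.sqrt).ennreal_ofReal

variable (V) in
/-- The identity, as a property of the index type. -/
def swiP : Prop := ∀ W : Matrix V V ℝ, (∀ i j, W i j = W j i) → (∀ i j, 0 ≤ W i j) →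
  ∀ η : V → ℝ, (∀ i, 0 < η i) →
  ∫⁻ h in {h | (swiH W h).PosDef}, swiG W η h
    = ENNReal.ofReal (√(2 * Real.pi) ^ (Fintype.card V) *
        Real.exp (-(1/2) * ∑ i, ∑ j, W i j - ∑ i, η i))

lemma swiP_empty [IsEmpty V] : swiP V := by
  intro W _ _ η _
  have : {h : V → ℝ | (swiH W h).PosDef} = Set.univ := by
    ext h
    simp only [Set.mem_ofPred_eq, Set.mem_univ, iff_true]
    exact ⟨by ext i; exact isEmptyElim i, fun x hx => (hx (by ext i; exact isEmptyElim i)).elim⟩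
  rw [this, Measure.restrict_univ, volume_pi]
  simp [swiG]

lemma swiP_equiv {V' : Type} [Fintype V'] [DecidableEq V'] (e : V ≃ V') (hP : swiP V) :
    swiP V' := by
  intro W hW hW0 η hη
  have h1 := hP (W.submatrix e e) (fun i j => hW _ _) (fun i j => hW0 _ _) (η ∘ e) (fun i => hη _)
  have hmp := volume_measurePreserving_piCongrLeft (fun _ : V' => ℝ) e
  have hΦ : ∀ h : V → ℝ, MeasurableEquiv.piCongrLeft (fun _ : V' => ℝ) e h = h ∘ e.symm := by
    intro h
    funext j
    obtain ⟨i, rfl⟩ := e.surjective j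
    rw [MeasurableEquiv.coe_piCongrLeft, Equiv.piCongrLeft_apply_apply]
    simp
  have hHe : ∀ h : V → ℝ, swiH W (h ∘ e.symm) = (swiH (W.submatrix e e) h).submatrix e.symm e.symm := by
    intro h
    ext i j
    simp [swiH, Matrix.diagonal_apply]
  rw [← hmp.setLIntegral_comp_preimage_emb (MeasurableEquiv.measurableEmbedding _)]
  have hset : (MeasurableEquiv.piCongrLeft (fun _ : V' => ℝ) e) ⁻¹' {h | (swiH W h).PosDef}
      = {h | (swiH (W.submatrix e e) h).PosDef} := by
    ext h
    simp only [Set.mem_preimage, Set.mem_ofPred_eq, hΦ, hHe]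
    constructor
    · intro hp
      simpa using hp.submatrix e.injective
    · intro hp
      exact hp.submatrix e.symm.injective
  have hG : ∀ h, swiG W η (MeasurableEquiv.piCongrLeft (fun _ : V' => ℝ) e h)
      = swiG (W.submatrix e e) (η ∘ e) h := by
    intro h
    rw [hΦ, swiG, swiG, hHe, Matrix.det_submatrix_equiv_self, Matrix.inv_submatrix_equiv]
    have a1 : ∑ i, (h ∘ e.symm) i = ∑ i, h i := Equiv.sum_comp e.symm h
    have a2 : η ⬝ᵥ ((swiH (W.submatrix e e) h)⁻¹.submatrix e.symm e.symm *ᵥ η)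
       = (η ∘ e) ⬝ᵥ ((swiH (W.submatrix e e) h)⁻¹ *ᵥ (η ∘ e)) := by
      rw [Matrix.submatrix_mulVec_equiv]
      simp only [Equiv.symm_symm]
      simp only [dotProduct]
      rw [← Equiv.sum_comp e]
      refine Finset.sum_congr rfl fun i _ => ?_
      simp
    rw [a1, a2]
  simp_rw [hset, hG]
  rw [h1, Fintype.card_congr e]
  congr 3
  congr 1
  · congr 1
    rw [← Equiv.sum_comp e]
    refine Finset.sum_congr rfl fun i _ => ?_
    rw [← Equiv.sum_comp e]
    rfl
  · exact Equiv.sum_comp e η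



lemma swiH_block (W : Matrix (V ⊕ Unit) (V ⊕ Unit) ℝ) (hW : ∀ i j, W i j = W j i)
    (h : V → ℝ) (z : ℝ) :
    swiH W (Sum.elim h (fun _ => z)) =
      Matrix.fromBlocks (swiH (W.submatrix Sum.inl Sum.inl) h)
        (Matrix.of fun i _ => - W (Sum.inl i) (Sum.inr ()))
        (Matrix.of fun i _ => - W (Sum.inl i) (Sum.inr ()))ᴴ
        (Matrix.of fun _ _ => z - W (Sum.inr ()) (Sum.inr ())) := by
  ext i j
  rcases i with i | i <;> rcases j with j | j
  · simp [swiH, Matrix.diagonal_apply]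
  · simp [swiH, Matrix.diagonal_apply]
  · simp [swiH, Matrix.diagonal_apply, hW (Sum.inl j)]
  · simp [swiH, Matrix.diagonal_apply]

lemma swiH_block_facts (W : Matrix (V ⊕ Unit) (V ⊕ Unit) ℝ) (hW : ∀ i j, W i j = W j i)
    (h : V → ℝ) (y : ℝ) (w : V → ℝ) (hw : w = fun i => W (Sum.inl i) (Sum.inr ()))
    (A : Matrix V V ℝ) (hA : A = swiH (W.submatrix Sum.inl Sum.inl) h) (hp : A.PosDef)
    (H : Matrix (V ⊕ Unit) (V ⊕ Unit) ℝ)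
    (hH : H = swiH W (Sum.elim h (fun _ => y + (W (Sum.inr ()) (Sum.inr ()) + w ⬝ᵥ (A⁻¹ *ᵥ w))))) :
    (H.PosDef ↔ 0 < y) ∧ H.det = A.det * y ∧
      (0 < y → ∀ η : V ⊕ Unit → ℝ, η ⬝ᵥ (H⁻¹ *ᵥ η) =
        (η ∘ Sum.inl) ⬝ᵥ (A⁻¹ *ᵥ (η ∘ Sum.inl)) +
          (η (Sum.inr ()) + w ⬝ᵥ (A⁻¹ *ᵥ (η ∘ Sum.inl))) ^ 2 / y) := by
  have hdetA := hp.det_pos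
  have hAu : IsUnit A.det := hdetA.ne'.isUnit
  let _ : Invertible A := Matrix.invertibleOfIsUnitDet A hAu
  set B : Matrix V Unit ℝ := Matrix.of fun i _ => - W (Sum.inl i) (Sum.inr ()) with hB
  set D : Matrix Unit Unit ℝ := Matrix.of fun _ _ => y + w ⬝ᵥ (A⁻¹ *ᵥ w) with hD
  have hHb : H = Matrix.fromBlocks A B Bᴴ D := by
    rw [hH, swiH_block W hW, ← hA]
    congr 1
    ext i j
    simp [hD]; ring
  have hS : D - Bᴴ * A⁻¹ * B = Matrix.of fun _ _ => y := by
    ext i j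
    have : (Bᴴ * A⁻¹ * B) i j = w ⬝ᵥ (A⁻¹ *ᵥ w) := by
      simp only [Matrix.mul_apply, hB, Matrix.conjTranspose_apply, Matrix.of_apply, star_trivial,
        dotProduct, Matrix.mulVec, hw, Finset.mul_sum, Finset.sum_mul]
      rw [Finset.sum_comm]
      refine Finset.sum_congr rfl fun _ _ => Finset.sum_congr rfl fun _ _ => by ring
    rw [Matrix.sub_apply, this]
    simp [hD]
  have hdet : H.det = A.det * y := by
    rw [hHb, Matrix.det_fromBlocks₁₁, Matrix.invOf_eq_nonsing_inv, hS]
    simp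
  have hpd : H.PosDef ↔ 0 < y := by
    have hps : H.PosSemidef ↔ 0 ≤ y := by
      rw [hHb, Matrix.PosDef.fromBlocks₁₁ B D hp, hS]
      have : (Matrix.of fun _ _ => y : Matrix Unit Unit ℝ) = Matrix.diagonal (fun _ => y) := by
        ext i j; simp
      rw [this, Matrix.posSemidef_diagonal_iff]
      simp
    constructor
    · intro hH'
      have := hH'.det_pos
      rw [hdet] at this
      exact (mul_pos_iff_of_pos_left hdetA).1 this
    · intro hy
      rw [(hps.2 hy.le).posDef_iff_det_ne_zero, hdet]
      positivity
  refine ⟨hpd, hdet, fun hy η => ?_⟩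
  have hHu : IsUnit H.det := by rw [hdet]; exact (mul_pos hdetA hy).ne'.isUnit
  set η' := η ∘ Sum.inl with hη'
  set c := η (Sum.inr ()) + w ⬝ᵥ (A⁻¹ *ᵥ η') with hc
  set ψ : V ⊕ Unit → ℝ := Sum.elim (A⁻¹ *ᵥ (η' + (c / y) • w)) (fun _ => c / y) with hψ
  have hHψ : H *ᵥ ψ = η := by
    rw [hHb, hψ, Matrix.fromBlocks_mulVec]
    funext i
    rcases i with i | i
    · simp only [Sum.elim_inl, Pi.add_apply, Sum.elim_comp_inl, Sum.elim_comp_inr]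
      rw [Matrix.mulVec_mulVec, Matrix.mul_nonsing_inv _ hAu, Matrix.one_mulVec]
      simp [hη', Matrix.mulVec, dotProduct, hB, hw]
      ring
    · simp only [Sum.elim_inr, Pi.add_apply, Sum.elim_comp_inl, Sum.elim_comp_inr]
      have e1 : (Bᴴ *ᵥ (A⁻¹ *ᵥ (η' + (c / y) • w))) i = - (w ⬝ᵥ (A⁻¹ *ᵥ (η' + (c / y) • w))) := by
        simp [Matrix.mulVec, dotProduct, hB, hw, Matrix.conjTranspose_apply]
      have e2 : (D *ᵥ fun _ => c / y) i = (y + w ⬝ᵥ (A⁻¹ *ᵥ w)) * (c / y) := by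
        simp [Matrix.mulVec, dotProduct, hD]
      rw [e1, e2, Matrix.mulVec_add, Matrix.mulVec_smul, dotProduct_add, dotProduct_smul, smul_eq_mul]
      have e3 : y * (c / y) = c := by field_simp
      have : η (Sum.inr i) = c - w ⬝ᵥ (A⁻¹ *ᵥ η') := by rw [hc]; ring
      rw [this]
      linear_combination e3
  have hinv : H⁻¹ *ᵥ η = ψ := by
    rw [← hHψ, Matrix.mulVec_mulVec, Matrix.nonsing_inv_mul _ hHu, Matrix.one_mulVec]
  have hsymm : η' ⬝ᵥ (A⁻¹ *ᵥ w) = w ⬝ᵥ (A⁻¹ *ᵥ η') := by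
    have hAh : A⁻¹ᵀ = A⁻¹ := by
      have := hp.isHermitian.inv
      rwa [Matrix.IsHermitian, Matrix.conjTranspose_eq_transpose_of_trivial] at this
    rw [Matrix.dotProduct_mulVec, ← Matrix.mulVec_transpose, hAh, dotProduct_comm]
  rw [hinv]
  have e4 : η ⬝ᵥ ψ = η' ⬝ᵥ (A⁻¹ *ᵥ (η' + (c / y) • w)) + η (Sum.inr ()) * (c / y) := by
    simp [dotProduct, hψ, hη']
  rw [e4, Matrix.mulVec_add, Matrix.mulVec_smul, dotProduct_add, dotProduct_smul, smul_eq_mul, hsymm]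
  have : η (Sum.inr ()) = c - w ⬝ᵥ (A⁻¹ *ᵥ η') := by rw [hc]; ring
  rw [this]
  ring

lemma swiP_succ (hP : swiP V) : swiP (V ⊕ Unit) := by
  intro W hW hW0 η hη
  set W' : Matrix V V ℝ := W.submatrix Sum.inl Sum.inl with hW'
  set w : V → ℝ := fun i => W (Sum.inl i) (Sum.inr ()) with hw
  set a := W (Sum.inr ()) (Sum.inr ()) with ha
  set η' : V → ℝ := η ∘ Sum.inl with hη'
  set b := η (Sum.inr ()) with hb
  have hS := swiH_measurableSet W hW hW0
  have hS' := swiH_measurableSet W' (fun i j => hW _ _) (fun i j => hW0 _ _)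
  set F : (V ⊕ Unit → ℝ) → ENNReal := Set.indicator {h | (swiH W h).PosDef} (swiG W η) with hF
  have hFm : Measurable F := (swiG_measurable W η).indicator hS
  rw [← lintegral_indicator hS]
  change ∫⁻ h, F h = _
  have hm1 : ∫⁻ h, F h = ∫⁻ p : (V → ℝ) × (Unit → ℝ), F (Sum.elim p.1 p.2) := by
    rw [← (volume_measurePreserving_sumPiEquivProdPi_symm
      (fun _ : V ⊕ Unit => ℝ)).lintegral_comp hFm]
    refine lintegral_congr fun p => ?_
    rfl
  have hm2 : ∀ h : V → ℝ, ∫⁻ u : Unit → ℝ, F (Sum.elim h u) = ∫⁻ z : ℝ, F (Sum.elim h (fun _ => z)) := by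
    intro h
    rw [← (volume_preserving_funUnique Unit ℝ).symm.lintegral_comp
      (f := fun u : Unit → ℝ => F (Sum.elim h u))]
    · rfl
    · refine hFm.comp ?_
      refine measurable_pi_iff.2 ?_
      rintro (i | i)
      · exact measurable_const
      · exact measurable_pi_apply i
  rw [hm1, Measure.volume_eq_prod, lintegral_prod]
  swap
  · refine (hFm.comp ?_).aemeasurable
    refine measurable_pi_iff.2 ?_
    rintro (i | i)
    · exact (measurable_pi_apply i).comp measurable_fst
    · exact (measurable_pi_apply i).comp measurable_snd
  simp_rw [hm2]
  have hin : ∀ h : V → ℝ, ∫⁻ z : ℝ, F (Sum.elim h (fun _ => z)) =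
      ENNReal.ofReal (√(2 * Real.pi) * Real.exp (-(a / 2) - b)) *
      Set.indicator {h | (swiH W' h).PosDef} (swiG W' (η' + w)) h := by
    intro h
    by_cases hp : (swiH W' h).PosDef
    · rw [Set.indicator_of_mem (by exact hp)]
      set A := swiH W' h with hA
      set q := w ⬝ᵥ (A⁻¹ *ᵥ w) with hq
      have hAh : A⁻¹ᵀ = A⁻¹ := by
        have := hp.isHermitian.inv
        rwa [Matrix.IsHermitian, Matrix.conjTranspose_eq_transpose_of_trivial] at this
      have hsymm : η' ⬝ᵥ (A⁻¹ *ᵥ w) = w ⬝ᵥ (A⁻¹ *ᵥ η') := by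
        rw [Matrix.dotProduct_mulVec, ← Matrix.mulVec_transpose, hAh, dotProduct_comm]
      set c := b + w ⬝ᵥ (A⁻¹ *ᵥ η') with hc
      have hcpos : 0 < c := by
        have h1 : 0 ≤ w ⬝ᵥ (A⁻¹ *ᵥ η') := by
          refine Finset.sum_nonneg fun i _ => mul_nonneg (hW0 _ _) ?_
          exact swiH_inv_nonneg W' (fun i j => hW0 _ _) h hp η' (fun i => (hη _).le) i
        have := hη (Sum.inr ())
        change 0 < b at this
        linarith
      rw [← lintegral_add_right_eq_self _ (a + q)]
      have hpt : ∀ y : ℝ, F (Sum.elim h (fun _ => y + (a + q))) =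
          ENNReal.ofReal (Real.exp (-(∑ i, h i + (a + q) + η' ⬝ᵥ (A⁻¹ *ᵥ η')) / 2) / √A.det) *
          Set.indicator (Set.Ioi 0) (fun x => ENNReal.ofReal (Real.exp (-(x + c ^ 2 / x) / 2) / √x)) y := by
        intro y
        obtain ⟨h1, h2, h3⟩ := swiH_block_facts W hW h y w hw A hA hp _ rfl
        by_cases hy : 0 < y
        · rw [hF, Set.indicator_of_mem (by exact h1.2 hy), Set.indicator_of_mem (by exact hy), swiG,
            h2, h3 hy η, ← ENNReal.ofReal_mul (by positivity)]
          congr 1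
          rw [Real.sqrt_mul hp.det_pos.le, div_mul_div_comm, ← Real.exp_add]
          congr 2
          simp only [Fintype.sum_sum_type, Sum.elim_inl, Sum.elim_inr, Finset.univ_unique,
            Finset.sum_singleton]
          ring
        · rw [hF, Set.indicator_of_notMem (by exact fun h => hy (h1.1 h)),
            Set.indicator_of_notMem (by exact hy), mul_zero]
      simp_rw [hpt]
      rw [lintegral_const_mul', lintegral_indicator measurableSet_Ioi, swi_oneD c hcpos]
      · rw [swiG, ← hA, ← ENNReal.ofReal_mul (by positivity), ← ENNReal.ofReal_mul (by positivity)]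
        congr 1
        have e1 : (η' + w) ⬝ᵥ (A⁻¹ *ᵥ (η' + w)) = η' ⬝ᵥ (A⁻¹ *ᵥ η') + 2 * (w ⬝ᵥ (A⁻¹ *ᵥ η')) + q := by
          rw [Matrix.mulVec_add, dotProduct_add, add_dotProduct, add_dotProduct, hsymm]
          ring
        rw [e1]
        have e2 : Real.exp (-(∑ i, h i + (a + q) + η' ⬝ᵥ (A⁻¹ *ᵥ η')) / 2) * Real.exp (-c) =
            Real.exp (-(a / 2) - b) * Real.exp (-(∑ i, h i + (η' ⬝ᵥ (A⁻¹ *ᵥ η') + 2 * (w ⬝ᵥ (A⁻¹ *ᵥ η')) + q)) / 2) := by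
          rw [← Real.exp_add, ← Real.exp_add]
          congr 1
          rw [hc]; ring
        linear_combination (√(2 * Real.pi) / √A.det) * e2
      · exact ENNReal.ofReal_ne_top
    · rw [Set.indicator_of_notMem (by exact hp), mul_zero]
      have : ∀ z : ℝ, F (Sum.elim h (fun _ => z)) = 0 := by
        intro z
        rw [hF]
        apply Set.indicator_of_notMem
        intro hz
        apply hp
        have hz : (swiH W (Sum.elim h (fun _ => z))).PosDef := hz
        have h4 := hz.submatrix (e := Sum.inl) Sum.inl_injective
        rw [swiH_block W hW] at h4
        exact h4
      simp [this]
  simp_rw [hin]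
  rw [lintegral_const_mul' _ _ ENNReal.ofReal_ne_top, lintegral_indicator hS',
    hP W' (fun i j => hW _ _) (fun i j => hW0 _ _) (η' + w)
      (fun i => add_pos_of_pos_of_nonneg (hη _) (hW0 _ _)),
    ← ENNReal.ofReal_mul (by positivity)]
  congr 1
  have e3 : ∀ A B C D : ℝ, A * B * (C * D) = (C * A) * (B * D) := by intros; ring
  rw [e3, ← pow_succ, ← Real.exp_add]
  congr 2
  · simp
  · simp only [Fintype.sum_sum_type, Finset.univ_unique, Finset.sum_singleton, Pi.add_apply,
      Finset.sum_add_distrib]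
    have e4 : ∑ j, W (Sum.inr default) (Sum.inl j) = ∑ j, w j :=
      Finset.sum_congr rfl fun j _ => hW _ _
    have e5 : ∑ j, W (Sum.inl j) (Sum.inr default) = ∑ j, w j := rfl
    have e6 : W (Sum.inr default) (Sum.inr default) = a := rfl
    have e7 : η (Sum.inr default) = b := rfl
    rw [e4, e5, e6, e7]
    simp only [hW', hη', Matrix.submatrix_apply, Function.comp_apply]
    ring

end

theorem swiP_all (V : Type) [Fintype V] [DecidableEq V] : swiP V := by
  have : ∀ n : ℕ, swiP (Fin n) := by
    intro n
    induction n with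
    | zero => exact swiP_empty
    | succ n ih =>
      refine swiP_equiv (V := Fin n ⊕ Unit) ?_ (swiP_succ ih)
      exact Fintype.equivOfCardEq (by simp)
  exact swiP_equiv (Fintype.equivFin V).symm (this _)

end swi_part_C

section swi_part_D
open MeasureTheory Matrix

set_option linter.unusedSectionVars false
set_option linter.unusedSimpArgs false

section
variable {V : Type} [Fintype V] [DecidableEq V]

/-- The matrix `D(t)` for general couplings. -/
noncomputable def swiD (W : Matrix V V ℝ) (η t : V → ℝ) : Matrix V V ℝ :=
  Matrix.diagonal (fun i => Real.exp (t i)) * swiH W (swiF W η t) *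
    Matrix.diagonal (fun i => Real.exp (t i))

/-- The action in the `t` variables. -/
noncomputable def swiS0 (W : Matrix V V ℝ) (η t : V → ℝ) : ℝ :=
  (1/2) * ∑ i, ∑ j, W i j * (Real.cosh (t i - t j) - 1) + ∑ i, η i * (Real.cosh (t i) - 1)

/-- The action in the `(t,s)` variables. -/
noncomputable def swiS (W : Matrix V V ℝ) (η t s : V → ℝ) : ℝ :=
  (1/2) * ∑ i, ∑ j, W i j *
      (Real.cosh (t i - t j) + (1/2) * (s i - s j) ^ 2 * Real.exp (t i + t j) - 1)
    + ∑ i, η i * (Real.cosh (t i) + (1/2) * s i ^ 2 * Real.exp (t i) - 1)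

lemma swiD_det (W : Matrix V V ℝ) (η t : V → ℝ) :
    (swiD W η t).det = (swiH W (swiF W η t)).det * (∏ i, Real.exp (t i)) ^ 2 := by
  rw [swiD, Matrix.det_mul, Matrix.det_mul, Matrix.det_diagonal]; ring

lemma swiD_quad (W : Matrix V V ℝ) (hW : ∀ i j, W i j = W j i) (η t s : V → ℝ) :
    s ⬝ᵥ (swiD W η t *ᵥ s) =
      (1/2) * ∑ i, ∑ j, W i j * Real.exp (t i + t j) * (s i - s j) ^ 2
      + ∑ i, η i * Real.exp (t i) * s i ^ 2 := by
  have h1 := swiH_quad W hW η t (fun i => Real.exp (t i) * s i)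
  have e : ∀ i, Real.exp (-t i) * (Real.exp (t i) * s i) = s i := by
    intro i
    rw [← mul_assoc, ← Real.exp_add]; simp
  have e2 : ∀ i, η i * Real.exp (-t i) * (Real.exp (t i) * s i) ^ 2
      = η i * Real.exp (t i) * s i ^ 2 := by
    intro i
    calc _ = η i * (Real.exp (-t i) * (Real.exp (t i) * s i)) * (Real.exp (t i) * s i) := by ring
      _ = _ := by rw [e]; ring
  simp only [e, e2] at h1
  rw [← h1]
  have e3 : Matrix.diagonal (fun i => Real.exp (t i)) *ᵥ s = fun i => Real.exp (t i) * s i := by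
    funext i; simp [Matrix.mulVec_diagonal]
  rw [swiD, ← Matrix.mulVec_mulVec, ← Matrix.mulVec_mulVec, e3]
  simp only [dotProduct, Matrix.mulVec_diagonal]
  refine Finset.sum_congr rfl fun i _ => by ring

lemma swiD_posDef (W : Matrix V V ℝ) (hW : ∀ i j, W i j = W j i) (hW0 : ∀ i j, 0 ≤ W i j)
    (η t : V → ℝ) (hη : ∀ i, 0 < η i) : (swiD W η t).PosDef := by
  have hp := swiH_F_posDef W hW hW0 η t hη
  have h1 : (swiD W η t).PosSemidef := by
    have := hp.posSemidef.conjTranspose_mul_mul_same (Matrix.diagonal (fun i => Real.exp (t i)))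
    simpa [swiD] using this
  rw [h1.posDef_iff_det_ne_zero, swiD_det]
  have := hp.det_pos
  have : 0 < ∏ i, Real.exp (t i) := Finset.prod_pos fun i _ => Real.exp_pos _
  positivity

lemma swiS_eq (W : Matrix V V ℝ) (hW : ∀ i j, W i j = W j i) (η t s : V → ℝ) :
    swiS W η t s = swiS0 W η t + (s ⬝ᵥ (swiD W η t *ᵥ s)) / 2 := by
  rw [swiD_quad W hW, swiS, swiS0]
  have e1 : ∀ i j, W i j *
      (Real.cosh (t i - t j) + (1/2) * (s i - s j) ^ 2 * Real.exp (t i + t j) - 1)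
      = W i j * (Real.cosh (t i - t j) - 1) + (1/2) * (W i j * Real.exp (t i + t j) * (s i - s j) ^ 2) := by
    intros; ring
  have e2 : ∀ i, η i * (Real.cosh (t i) + (1/2) * s i ^ 2 * Real.exp (t i) - 1)
      = η i * (Real.cosh (t i) - 1) + (1/2) * (η i * Real.exp (t i) * s i ^ 2) := by
    intros; ring
  simp_rw [e1, e2, Finset.sum_add_distrib, ← Finset.mul_sum]
  ring

lemma swiF_energy (W : Matrix V V ℝ) (hW : ∀ i j, W i j = W j i) (η t : V → ℝ) :
    (∑ i, swiF W η t i + η ⬝ᵥ (fun i => Real.exp (t i))) / 2 =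
      swiS0 W η t + ((1/2) * ∑ i, ∑ j, W i j + ∑ i, η i) := by
  have e1 : ∀ i j, W i j * (Real.cosh (t i - t j) - 1) =
      (1/2) * (W i j * Real.exp (t j - t i)) + (1/2) * (W j i * Real.exp (t i - t j)) - W i j := by
    intro i j
    rw [Real.cosh_eq, neg_sub, ← hW i j]; ring
  have e2 : ∀ i, η i * (Real.cosh (t i) - 1) =
      (1/2) * (η i * Real.exp (-t i)) + (1/2) * (η i * Real.exp (t i)) - η i := by
    intro i
    rw [Real.cosh_eq]; ring
  rw [swiS0]
  simp_rw [e1, e2, Finset.sum_sub_distrib, Finset.sum_add_distrib, ← Finset.mul_sum]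
  rw [Finset.sum_comm (f := fun i j => W j i * Real.exp (t i - t j))]
  simp only [swiF, Finset.sum_add_distrib, dotProduct]
  ring

lemma swi_t_integral (W : Matrix V V ℝ) (hW : ∀ i j, W i j = W j i) (hW0 : ∀ i j, 0 ≤ W i j)
    (η : V → ℝ) (hη : ∀ i, 0 < η i) :
    ∫⁻ t : V → ℝ, ENNReal.ofReal (√(swiH W (swiF W η t)).det * Real.exp (-swiS0 W η t))
      = ENNReal.ofReal (√(2 * Real.pi) ^ (Fintype.card V)) := by
  have h := swiP_all V W hW hW0 η hη
  rw [← swiF_range W hW hW0 η hη, lintegral_image_eq_lintegral_abs_det_fderiv_mul volume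
    MeasurableSet.univ (fun t _ => (swiF_hasFDerivAt W η t).hasFDerivWithinAt)
    (swiF_injective W hW hW0 η hη).injOn, Measure.restrict_univ] at h
  set K := (1/2) * ∑ i, ∑ j, W i j + ∑ i, η i with hK
  have hpt : ∀ t : V → ℝ, ENNReal.ofReal
      |(LinearMap.toContinuousLinearMap (Matrix.toLin' (swiJ W η t))).det| * swiG W η (swiF W η t)
      = ENNReal.ofReal (Real.exp (-K)) *
        ENNReal.ofReal (√(swiH W (swiF W η t)).det * Real.exp (-swiS0 W η t)) := by
    intro t
    have hp := (swiH_F_posDef W hW hW0 η t hη).det_pos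
    rw [LinearMap.det_toContinuousLinearMap, LinearMap.det_toLin', swiJ_abs_det W hW hW0 η t hη,
      swiG, swiF_inv W hW hW0 η t hη, ← ENNReal.ofReal_mul hp.le, ← ENNReal.ofReal_mul (by positivity),
      neg_div, swiF_energy W hW]
    congr 1
    rw [neg_add, Real.exp_add, ← hK]
    have : (swiH W (swiF W η t)).det / √(swiH W (swiF W η t)).det = √(swiH W (swiF W η t)).det :=
      Real.div_sqrt
    linear_combination (Real.exp (-swiS0 W η t) * Real.exp (-K)) * this
  simp_rw [hpt] at h
  rw [lintegral_const_mul' _ _ ENNReal.ofReal_ne_top] at h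
  have h2 : -(1/2) * ∑ i, ∑ j, W i j - ∑ i, η i = -K := by rw [hK]; ring
  rw [h2, mul_comm (√(2 * Real.pi) ^ _), ENNReal.ofReal_mul (by positivity)] at h
  exact (ENNReal.mul_right_inj (by simp [Real.exp_pos]) ENNReal.ofReal_ne_top).1 h

open scoped MatrixOrder in
lemma swi_gaussian (D : Matrix V V ℝ) (hD : D.PosDef) :
    ∫⁻ s : V → ℝ, ENNReal.ofReal (Real.exp (-(s ⬝ᵥ (D *ᵥ s)) / 2))
      = ENNReal.ofReal (√(2 * Real.pi) ^ (Fintype.card V) / √D.det) := by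
  obtain ⟨B, hB⟩ := CStarAlgebra.nonneg_iff_eq_star_mul_self.mp hD.posSemidef.nonneg
  have hdet : D.det = B.det ^ 2 := by
    rw [hB, Matrix.star_eq_conjTranspose, Matrix.det_mul, Matrix.det_conjTranspose]
    simp [sq]
  have hB0 : B.det ≠ 0 := by
    intro h0
    have := hD.det_pos
    rw [hdet, h0] at this
    simp at this
  have hq : ∀ s : V → ℝ, s ⬝ᵥ (D *ᵥ s) = ∑ i, (Matrix.toLin' B s) i ^ 2 := by
    intro s
    rw [hB, Matrix.star_eq_conjTranspose, ← Matrix.mulVec_mulVec, Matrix.dotProduct_mulVec,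
      Matrix.vecMul_conjTranspose]
    simp [dotProduct, sq, Matrix.toLin'_apply]
  set g : (V → ℝ) → ENNReal := fun v => ENNReal.ofReal (Real.exp (-(∑ i, v i ^ 2) / 2)) with hg
  have hgm : Measurable g := by simp only [hg]; fun_prop
  have h1 : ∫⁻ s : V → ℝ, ENNReal.ofReal (Real.exp (-(s ⬝ᵥ (D *ᵥ s)) / 2))
      = ∫⁻ v, g v ∂(Measure.map (Matrix.toLin' B) volume) := by
    rw [lintegral_map hgm (LinearMap.continuous_of_finiteDimensional _).measurable]
    simp_rw [hq]; rfl
  have h2 : ∫⁻ v, g v = ENNReal.ofReal (√(2 * Real.pi) ^ (Fintype.card V)) := by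
    have e : ∀ v : V → ℝ, g v = ENNReal.ofReal (∏ i, Real.exp (-(1/2) * v i ^ 2)) := by
      intro v
      simp only [hg]
      rw [← Real.exp_sum, ← Finset.mul_sum]
      congr 2; ring
    simp_rw [e]
    have hi : Integrable (fun v : ℝ => Real.exp (-(1/2) * v ^ 2)) :=
      integrable_exp_neg_mul_sq (by norm_num)
    rw [← ofReal_integral_eq_lintegral_ofReal]
    · rw [integral_fintype_prod_volume_eq_pow (fun v : ℝ => Real.exp (-(1/2) * v ^ 2)),
        integral_gaussian]
      congr 3
      ring
    · exact Integrable.fintype_prod (fun _ => hi)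
    · exact Filter.Eventually.of_forall fun v => Finset.prod_nonneg fun i _ => (Real.exp_pos _).le
  rw [h1, Real.map_matrix_volume_pi_eq_smul_volume_pi hB0, lintegral_smul_measure, h2, smul_eq_mul,
    ← ENNReal.ofReal_mul (abs_nonneg _), hdet, Real.sqrt_sq_eq_abs, abs_inv]
  congr 1
  ring

/-- The density of the `H^{2|2}` measure in `(t,s)` coordinates. -/
noncomputable def swiRho (W : Matrix V V ℝ) (η : V → ℝ) (p : (V → ℝ) × (V → ℝ)) : ℝ :=
  (swiD W η p.1).det * Real.exp (-swiS W η p.1 p.2) * (∏ k, Real.exp (-p.1 k)) *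
    ((2 * Real.pi)⁻¹) ^ (Fintype.card V)

lemma swiD_continuous (W : Matrix V V ℝ) (η : V → ℝ) : Continuous (swiD W η) := by
  have h1 : Continuous fun t => swiH W (swiF W η t) :=
    (swiH_continuous W).comp (swiF_continuous W η)
  unfold swiD
  fun_prop

lemma swiS_continuous (W : Matrix V V ℝ) (η : V → ℝ) :
    Continuous (fun p : (V → ℝ) × (V → ℝ) => swiS W η p.1 p.2) := by
  unfold swiS
  fun_prop

lemma swiRho_continuous (W : Matrix V V ℝ) (η : V → ℝ) : Continuous (swiRho W η) := by
  have h1 : Continuous fun p : (V → ℝ) × (V → ℝ) => (swiD W η p.1).det :=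
    ((swiD_continuous W η).comp continuous_fst).matrix_det
  have h2 := swiS_continuous W η
  unfold swiRho
  fun_prop

lemma swiRho_pos (W : Matrix V V ℝ) (hW : ∀ i j, W i j = W j i) (hW0 : ∀ i j, 0 ≤ W i j)
    (η : V → ℝ) (hη : ∀ i, 0 < η i) (p : (V → ℝ) × (V → ℝ)) : 0 < swiRho W η p := by
  have h1 := (swiD_posDef W hW hW0 η p.1 hη).det_pos
  have : 0 < ∏ i, Real.exp (-p.1 i) := Finset.prod_pos fun i _ => Real.exp_pos _
  unfold swiRho
  positivity

/-- Normalization of the `H^{2|2}` measure for arbitrary couplings. -/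
theorem swi_normalization (W : Matrix V V ℝ) (hW : ∀ i j, W i j = W j i) (hW0 : ∀ i j, 0 ≤ W i j)
    (η : V → ℝ) (hη : ∀ i, 0 < η i) :
    ∫⁻ p : (V → ℝ) × (V → ℝ), ENNReal.ofReal (swiRho W η p) = 1 := by
  rw [Measure.volume_eq_prod, lintegral_prod _
    (swiRho_continuous W η).measurable.ennreal_ofReal.aemeasurable]
  have hin : ∀ t : V → ℝ, ∫⁻ s : V → ℝ, ENNReal.ofReal (swiRho W η (t, s)) =
      ENNReal.ofReal ((√(2 * Real.pi) ^ (Fintype.card V))⁻¹) *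
      ENNReal.ofReal (√(swiH W (swiF W η t)).det * Real.exp (-swiS0 W η t)) := by
    intro t
    have hDp := (swiD_posDef W hW hW0 η t hη)
    have hd := hDp.det_pos
    have hHp := (swiH_F_posDef W hW hW0 η t hη).det_pos
    have hprod : 0 < ∏ i, Real.exp (-t i) := Finset.prod_pos fun i _ => Real.exp_pos _
    have hprod' : 0 < ∏ i, Real.exp (t i) := Finset.prod_pos fun i _ => Real.exp_pos _
    have e : ∀ s, ENNReal.ofReal (swiRho W η (t, s)) =
        ENNReal.ofReal ((swiD W η t).det * Real.exp (-swiS0 W η t) * (∏ k, Real.exp (-t k)) *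
          ((2 * Real.pi)⁻¹) ^ (Fintype.card V)) *
        ENNReal.ofReal (Real.exp (-(s ⬝ᵥ (swiD W η t *ᵥ s)) / 2)) := by
      intro s
      rw [← ENNReal.ofReal_mul (by positivity)]
      congr 1
      simp only [swiRho]
      rw [swiS_eq W hW, neg_add, Real.exp_add, neg_div]
      ring
    simp_rw [e]
    rw [lintegral_const_mul' _ _ ENNReal.ofReal_ne_top, swi_gaussian _ hDp,
      ← ENNReal.ofReal_mul (by positivity), ← ENNReal.ofReal_mul (by positivity)]
    congr 1
    have e1 : √(swiD W η t).det = √(swiH W (swiF W η t)).det * ∏ i, Real.exp (t i) := by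
      rw [swiD_det, Real.sqrt_mul hHp.le, Real.sqrt_sq hprod'.le]
    have e2 : (∏ k, Real.exp (-t k)) = (∏ i, Real.exp (t i))⁻¹ := by
      rw [← Finset.prod_inv_distrib]
      simp [Real.exp_neg]
    have e3 : ((2 * Real.pi)⁻¹) ^ (Fintype.card V) =
        (√(2 * Real.pi) ^ (Fintype.card V))⁻¹ * (√(2 * Real.pi) ^ (Fintype.card V))⁻¹ := by
      rw [← mul_inv, ← mul_pow, Real.mul_self_sqrt (by positivity), inv_pow]
    have e4 : (swiD W η t).det = √(swiD W η t).det * √(swiD W η t).det :=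
      (Real.mul_self_sqrt hd.le).symm
    have hsd : 0 < √(swiH W (swiF W η t)).det := Real.sqrt_pos.2 hHp
    have h2p : 0 < √(2 * Real.pi) ^ (Fintype.card V) := by positivity
    rw [e3, e2]
    nth_rewrite 1 [e4]
    rw [e1]
    field_simp
  simp_rw [hin]
  rw [lintegral_const_mul' _ _ ENNReal.ofReal_ne_top, swi_t_integral W hW hW0 η hη,
    ← ENNReal.ofReal_mul (by positivity), inv_mul_cancel₀ (by positivity)]
  simp

end

end swi_part_D

section swi_part_E
open MeasureTheory Matrix

lemma swi_gamma_lintegral (a r : ℝ) (ha : 0 < a) (hr : 0 < r) :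
    ∫⁻ t in Set.Ioi (0:ℝ), ENNReal.ofReal (t ^ (a - 1) * Real.exp (-(r * t)))
      = ENNReal.ofReal (r ^ (-a) * Real.Gamma a) := by
  have h := Real.integral_rpow_mul_exp_neg_mul_Ioi ha hr
  have hpos : 0 < (1 / r) ^ a * Real.Gamma a := by
    have := Real.Gamma_pos_of_pos ha
    positivity
  have hi : IntegrableOn (fun t : ℝ => t ^ (a - 1) * Real.exp (-(r * t))) (Set.Ioi 0) := by
    by_contra hc
    rw [integral_undef hc] at h
    linarith
  rw [← ofReal_integral_eq_lintegral_ofReal hi, h]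
  · congr 2
    rw [one_div, Real.inv_rpow hr.le, Real.rpow_neg hr.le]
  · rw [Filter.EventuallyLE, ae_restrict_iff' measurableSet_Ioi]
    refine ae_of_all _ fun t (ht : 0 < t) => ?_
    simp only [Pi.zero_apply]
    positivity

lemma swi_abstract_neg {Ω : Type*} [MeasurableSpace Ω] (μ : Measure Ω) [SFinite μ] (B T : Ω → ℝ)
    (hB : Measurable B) (hT : Measurable T) (hB1 : ∀ w, 1 ≤ B w) (hT0 : ∀ w, 0 ≤ T w)
    (hphi : ∀ l : ℝ, 0 < l →
      ∫⁻ w, ENNReal.ofReal (Real.exp (-(l * (B w - 1))) * (1 + l * T w)) ∂μ = 1)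
    (m : ℝ) (hm : m < 0) :
    ∫ w, B w ^ m * (1 - m * (T w / B w)) ∂μ = 1 := by
  obtain ⟨a, rfl⟩ : ∃ a, m = -a := ⟨-m, by simp⟩
  have ha : 0 < a := by linarith
  have hG := Real.Gamma_pos_of_pos ha
  have hswap := lintegral_lintegral_swap (μ := (volume.restrict (Set.Ioi (0:ℝ)))) (ν := μ)
    (f := fun l w => ENNReal.ofReal (l ^ (a - 1) * Real.exp (-(1 * l))) *
      ENNReal.ofReal (Real.exp (-(l * (B w - 1))) * (1 + l * T w)))
    (by
      apply Measurable.aemeasurable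
      unfold Function.uncurry
      fun_prop)
  have hL : ∀ l : ℝ, 0 < l → ∫⁻ w, ENNReal.ofReal (l ^ (a - 1) * Real.exp (-(1 * l))) *
      ENNReal.ofReal (Real.exp (-(l * (B w - 1))) * (1 + l * T w)) ∂μ =
      ENNReal.ofReal (l ^ (a - 1) * Real.exp (-(1 * l))) := by
    intro l hl
    rw [lintegral_const_mul _ (by fun_prop), hphi l hl, mul_one]
  rw [setLIntegral_congr_fun measurableSet_Ioi (fun l hl => hL l hl),
    swi_gamma_lintegral a 1 ha one_pos, Real.one_rpow, one_mul] at hswap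
  have hR : ∀ w, ∫⁻ l in Set.Ioi (0:ℝ), ENNReal.ofReal (l ^ (a - 1) * Real.exp (-(1 * l))) *
      ENNReal.ofReal (Real.exp (-(l * (B w - 1))) * (1 + l * T w)) =
      ENNReal.ofReal (Real.Gamma a) *
        ENNReal.ofReal (B w ^ (-a) * (1 - (-a) * (T w / B w))) := by
    intro w
    have hBw : 0 < B w := by linarith [hB1 w]
    have e : ∀ l ∈ Set.Ioi (0:ℝ), ENNReal.ofReal (l ^ (a - 1) * Real.exp (-(1 * l))) *
      ENNReal.ofReal (Real.exp (-(l * (B w - 1))) * (1 + l * T w)) =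
      ENNReal.ofReal (l ^ (a - 1) * Real.exp (-(B w * l))) + ENNReal.ofReal (T w) *
        ENNReal.ofReal (l ^ ((a + 1) - 1) * Real.exp (-(B w * l))) := by
      intro l (hl : 0 < l)
      have := hT0 w
      rw [← ENNReal.ofReal_mul (by positivity), ← ENNReal.ofReal_mul (by positivity),
        ← ENNReal.ofReal_add (by positivity) (by positivity)]
      congr 1
      have e1 : Real.exp (-(B w * l)) = Real.exp (-(1 * l)) * Real.exp (-(l * (B w - 1))) := by
        rw [← Real.exp_add]; congr 1; ring
      have e2 : l ^ ((a + 1) - 1) = l ^ (a - 1) * l := by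
        rw [← Real.rpow_add_one hl.ne']; congr 1; ring
      rw [e1, e2]; ring
    rw [setLIntegral_congr_fun measurableSet_Ioi e, lintegral_add_left (by fun_prop),
      lintegral_const_mul _ (by fun_prop), swi_gamma_lintegral a _ ha hBw,
      swi_gamma_lintegral (a + 1) _ (by linarith) hBw, Real.Gamma_add_one ha.ne']
    have := hT0 w
    rw [← ENNReal.ofReal_mul (by positivity), ← ENNReal.ofReal_mul (by positivity),
        ← ENNReal.ofReal_add (by positivity) (by positivity)]
    congr 1
    have e3 : B w ^ (-(a + 1)) = B w ^ (-a) / B w := by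
      rw [← Real.rpow_sub_one hBw.ne']; congr 1; ring
    rw [e3]
    field_simp
    ring
  simp_rw [hR] at hswap
  rw [lintegral_const_mul _ (by fun_prop)] at hswap
  have hG0 : ENNReal.ofReal (Real.Gamma a) ≠ 0 := by simpa using hG
  have h1 : ∫⁻ w, ENNReal.ofReal (B w ^ (-a) * (1 - (-a) * (T w / B w))) ∂μ = 1 := by
    have : ENNReal.ofReal (Real.Gamma a) *
      ∫⁻ w, ENNReal.ofReal (B w ^ (-a) * (1 - (-a) * (T w / B w))) ∂μ =
      ENNReal.ofReal (Real.Gamma a) * 1 := by rw [← hswap, mul_one]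
    exact (ENNReal.mul_right_inj hG0 ENNReal.ofReal_ne_top).1 this
  rw [integral_eq_lintegral_of_nonneg_ae, h1]
  · simp
  · refine ae_of_all _ fun w => ?_
    have hBw : 0 < B w := by linarith [hB1 w]
    have := hT0 w
    simp only [Pi.zero_apply]
    have : 0 ≤ a * (T w / B w) := by positivity
    apply mul_nonneg (by positivity); linarith
  · apply Measurable.aestronglyMeasurable
    fun_prop

lemma swi_abstract {Ω : Type*} [MeasurableSpace Ω] (μ : Measure Ω) [SFinite μ] (B T : Ω → ℝ)
    (hB : Measurable B) (hT : Measurable T) (hB1 : ∀ w, 1 ≤ B w) (hT0 : ∀ w, 0 ≤ T w)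
    (hphi : ∀ l : ℝ, 0 < l →
      ∫⁻ w, ENNReal.ofReal (Real.exp (-(l * (B w - 1))) * (1 + l * T w)) ∂μ = 1)
    (hi1 : ∀ m : ℝ, Integrable (fun w => B w ^ m) μ)
    (hi2 : ∀ m : ℝ, Integrable (fun w => B w ^ m * T w) μ) (m : ℝ) :
    ∫ w, B w ^ m * (1 - m * (T w / B w)) ∂μ = 1 := by
  have hBp : ∀ w, 0 < B w := fun w => by linarith [hB1 w]
  set X : Ω → ℝ := fun w => Real.log (B w) with hX
  have hexp : ∀ (r : ℝ) w, Real.exp (r * X w) = B w ^ r := by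
    intro r w
    rw [Real.rpow_def_of_pos (hBp w), mul_comm]
  set ν : Measure Ω := μ.withDensity (fun w => ENNReal.ofReal (T w)) with hν
  have hTm : Measurable (fun w => ENNReal.ofReal (T w)) := by fun_prop
  have hlt : ∀ᵐ w ∂μ, ENNReal.ofReal (T w) < ⊤ := ae_of_all _ fun w => ENNReal.ofReal_lt_top
  have s1 : ProbabilityTheory.integrableExpSet X μ = Set.univ := by
    ext r
    simp only [ProbabilityTheory.integrableExpSet, Set.mem_ofPred_eq, Set.mem_univ, iff_true, hexp]
    exact hi1 r
  have s2 : ProbabilityTheory.integrableExpSet X ν = Set.univ := by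
    ext r
    simp only [ProbabilityTheory.integrableExpSet, Set.mem_ofPred_eq, Set.mem_univ, iff_true, hexp]
    rw [hν, integrable_withDensity_iff hTm hlt]
    simpa only [ENNReal.toReal_ofReal (hT0 _)] using hi2 r
  have a1 : AnalyticOnNhd ℝ (ProbabilityTheory.mgf X μ) Set.univ := by
    have := ProbabilityTheory.analyticOnNhd_mgf (X := X) (μ := μ)
    rwa [s1, interior_univ] at this
  have a2 : AnalyticOnNhd ℝ (ProbabilityTheory.mgf X ν) Set.univ := by
    have := ProbabilityTheory.analyticOnNhd_mgf (X := X) (μ := ν)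
    rwa [s2, interior_univ] at this
  have key : ∀ r : ℝ, ∫ w, B w ^ r * (1 - r * (T w / B w)) ∂μ =
      ProbabilityTheory.mgf X μ r - r * ProbabilityTheory.mgf X ν (r - 1) := by
    intro r
    have e : ∀ w, B w ^ r * (1 - r * (T w / B w)) = B w ^ r - r * (B w ^ (r - 1) * T w) := by
      intro w
      rw [Real.rpow_sub_one (hBp w).ne']
      ring
    simp only [ProbabilityTheory.mgf, hexp]
    rw [hν, integral_withDensity_eq_integral_toReal_smul hTm hlt]
    simp only [ENNReal.toReal_ofReal (hT0 _), smul_eq_mul, e]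
    rw [integral_sub (hi1 r) ((hi2 _).const_mul r), integral_const_mul]
    simp only [mul_comm]
  have a3 : AnalyticOnNhd ℝ (fun r => ProbabilityTheory.mgf X μ r
      - r * ProbabilityTheory.mgf X ν (r - 1)) Set.univ := by
    intro r _
    have h2 : AnalyticAt ℝ (fun r : ℝ => ProbabilityTheory.mgf X ν (r - 1)) r :=
      AnalyticAt.fun_comp (a2 (r - 1) trivial) (analyticAt_id.sub analyticAt_const)
    exact (a1 r trivial).sub (analyticAt_id.mul h2)
  have h := a3.eq_of_eventuallyEq (g := fun _ => (1:ℝ)) (z₀ := -1) (fun _ _ => analyticAt_const) (by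
    filter_upwards [Iio_mem_nhds (show (-1:ℝ) < 0 by norm_num)] with r hr
    rw [← key r]
    exact swi_abstract_neg μ B T hB hT hB1 hT0 hphi r hr)
  rw [key m]
  exact congrFun h m

end swi_part_E

section swi_part_F
open MeasureTheory Matrix

set_option linter.unusedSectionVars false
set_option linter.unusedSimpArgs false

section
variable {V : Type} [Fintype V] [DecidableEq V]

/-- The vector `δ_x - δ_y`. -/
noncomputable def swiDel (x y : V) : V → ℝ := fun j => (if j = x then 1 else 0) - (if j = y then 1 else 0)

/-- The effective conductance observable. -/
noncomputable def swiT (W : Matrix V V ℝ) (η : V → ℝ) (x y : V) (t : V → ℝ) : ℝ :=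
  Real.exp (t x + t y) * (swiDel x y ⬝ᵥ ((swiD W η t)⁻¹ *ᵥ swiDel x y))

/-- The bond observable. -/
noncomputable def swiB (x y : V) (p : (V → ℝ) × (V → ℝ)) : ℝ :=
  Real.cosh (p.1 x - p.1 y) + (1/2) * (p.2 x - p.2 y) ^ 2 * Real.exp (p.1 x + p.1 y)

/-- The site observable. -/
noncomputable def swiZ (x : V) (p : (V → ℝ) × (V → ℝ)) : ℝ :=
  Real.cosh (p.1 x) + (1/2) * p.2 x ^ 2 * Real.exp (p.1 x)

/-- Couplings with one modified bond. -/
noncomputable def swiW (W : Matrix V V ℝ) (x y : V) (l : ℝ) : Matrix V V ℝ := Matrix.of fun i j =>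
  W i j + l * ((if i = x then if j = y then 1 else 0 else 0) +
    (if i = y then if j = x then 1 else 0 else 0))

lemma swiD_apply (W : Matrix V V ℝ) (η t : V → ℝ) (i j : V) :
    swiD W η t i j = Real.exp (t i) * ((if i = j then swiF W η t i else 0) - W i j) *
      Real.exp (t j) := by
  rw [swiD, Matrix.mul_diagonal, Matrix.diagonal_mul, swiH, Matrix.sub_apply,
    Matrix.diagonal_apply]

lemma swiW_symm (W : Matrix V V ℝ) (hW : ∀ i j, W i j = W j i) (x y : V) (l : ℝ) (i j : V) :
    swiW W x y l i j = swiW W x y l j i := by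
  simp only [swiW, Matrix.of_apply]
  rw [hW i j]
  split_ifs <;> simp_all

lemma swiW_nonneg (W : Matrix V V ℝ) (hW : ∀ i j, 0 ≤ W i j) (x y : V) (l : ℝ) (hl : 0 ≤ l)
    (i j : V) : 0 ≤ swiW W x y l i j := by
  simp only [swiW, Matrix.of_apply]
  have := hW i j
  have h1 : (0:ℝ) ≤ (if i = x then if j = y then 1 else 0 else 0) := by split_ifs <;> norm_num
  have h2 : (0:ℝ) ≤ (if i = y then if j = x then 1 else 0 else 0) := by split_ifs <;> norm_num
  positivity

lemma swiF_W (W : Matrix V V ℝ) (η t : V → ℝ) (x y : V) (l : ℝ) (i : V) :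
    swiF (swiW W x y l) η t i = swiF W η t i + l * ((if i = x then Real.exp (t y - t i) else 0)
      + (if i = y then Real.exp (t x - t i) else 0)) := by
  simp only [swiF, swiW, Matrix.of_apply, add_mul, Finset.sum_add_distrib, mul_add, mul_assoc,
    ← Finset.mul_sum]
  have e1 : ∑ j, (if i = x then if j = y then (1:ℝ) else 0 else 0) * Real.exp (t j - t i) =
      if i = x then Real.exp (t y - t i) else 0 := by
    split_ifs <;> simp
  have e2 : ∑ j, (if i = y then if j = x then (1:ℝ) else 0 else 0) * Real.exp (t j - t i) =
      if i = y then Real.exp (t x - t i) else 0 := by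
    split_ifs <;> simp
  rw [e1, e2]; ring

lemma swiD_W (W : Matrix V V ℝ) (η t : V → ℝ) (x y : V) (hxy : x ≠ y) (l : ℝ) :
    swiD (swiW W x y l) η t = swiD W η t +
      replicateCol Unit ((l * Real.exp (t x + t y)) • swiDel x y) *
        replicateRow Unit (swiDel x y) := by
  ext i j
  rw [Matrix.add_apply, swiD_apply, swiD_apply, swiF_W]
  simp only [Matrix.mul_apply, Finset.univ_unique, Finset.sum_singleton, replicateCol_apply,
    replicateRow_apply, Pi.smul_apply, smul_eq_mul, swiDel, swiW, Matrix.of_apply]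
  have ey : ∀ a b : ℝ, Real.exp (a - b) = Real.exp a * (Real.exp b)⁻¹ := by
    intro a b; rw [Real.exp_sub]; rfl
  have hx0 := Real.exp_pos (t x)
  have hy0 := Real.exp_pos (t y)
  rw [Real.exp_add]
  simp only [ey]
  have hyx := hxy.symm
  by_cases hix : i = x
  · subst hix
    by_cases hjx : j = i
    · subst hjx
      simp [hxy]; field_simp; ring
    · by_cases hjy : j = y
      · subst hjy; simp [hxy, hyx]; try (field_simp; try ring)
      · simp [hxy, hjx, hjy, Ne.symm hjx, eq_comm, (fun h => hjx h.symm : ¬ i = j)]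
  · by_cases hiy : i = y
    · subst hiy
      by_cases hjx : j = x
      · subst hjx; simp [hxy, hyx]; try (field_simp; try ring)
      · by_cases hjy : j = i
        · subst hjy; simp [hxy, hyx]; field_simp; ring
        · have hij : ¬ i = j := fun h => hjy h.symm
          simp [hxy, hyx, hjx, hjy, hij]
    · simp [hix, hiy]

lemma swiD_W_det (W : Matrix V V ℝ) (hW : ∀ i j, W i j = W j i) (hW0 : ∀ i j, 0 ≤ W i j)
    (η t : V → ℝ) (hη : ∀ i, 0 < η i) (x y : V) (hxy : x ≠ y) (l : ℝ) :
    (swiD (swiW W x y l) η t).det = (swiD W η t).det * (1 + l * swiT W η x y t) := by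
  have hu : IsUnit (swiD W η t).det := (swiD_posDef W hW hW0 η t hη).det_pos.ne'.isUnit
  rw [swiD_W W η t x y hxy, Matrix.det_add_replicateCol_mul_replicateRow hu]
  congr 1
  rw [Matrix.det_unique, Matrix.add_apply, Matrix.one_apply_eq, swiT]
  congr 1
  rw [Matrix.mul_assoc, ← Matrix.replicateCol_mulVec, Matrix.replicateRow_mul_replicateCol_apply,
    Matrix.mulVec_smul, dotProduct_smul, smul_eq_mul, mul_assoc]

lemma swiS_W (W : Matrix V V ℝ) (η : V → ℝ) (x y : V) (l : ℝ) (p : (V → ℝ) × (V → ℝ)) :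
    swiS (swiW W x y l) η p.1 p.2 = swiS W η p.1 p.2 + l * (swiB x y p - 1) := by
  simp only [swiS, swiW, Matrix.of_apply, add_mul, Finset.sum_add_distrib, mul_assoc,
    ← Finset.mul_sum]
  have e1 : ∀ f : V → V → ℝ, ∑ i, ∑ j, (if i = x then if j = y then (1:ℝ) else 0 else 0) * f i j =
      f x y := by
    intro f
    rw [Finset.sum_eq_single x, Finset.sum_eq_single y] <;> simp +contextual
  have e2 : ∀ f : V → V → ℝ, ∑ i, ∑ j, (if i = y then if j = x then (1:ℝ) else 0 else 0) * f i j =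
      f y x := by
    intro f
    rw [Finset.sum_eq_single y, Finset.sum_eq_single x] <;> simp +contextual
  rw [e1, e2, swiB, ← Real.cosh_neg (p.1 y - p.1 x), neg_sub, add_comm (p.1 y)]
  ring

lemma swiT_nonneg (W : Matrix V V ℝ) (hW : ∀ i j, W i j = W j i) (hW0 : ∀ i j, 0 ≤ W i j)
    (η t : V → ℝ) (hη : ∀ i, 0 < η i) (x y : V) : 0 ≤ swiT W η x y t := by
  have h := (swiD_posDef W hW hW0 η t hη).inv.posSemidef.dotProduct_mulVec_nonneg (swiDel x y)
  simp only [star_trivial] at h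
  rw [swiT]; positivity

lemma swiRho_W (W : Matrix V V ℝ) (hW : ∀ i j, W i j = W j i) (hW0 : ∀ i j, 0 ≤ W i j)
    (η : V → ℝ) (hη : ∀ i, 0 < η i) (x y : V) (hxy : x ≠ y) (l : ℝ) (p : (V → ℝ) × (V → ℝ)) :
    swiRho (swiW W x y l) η p =
      swiRho W η p * (Real.exp (-(l * (swiB x y p - 1))) * (1 + l * swiT W η x y p.1)) := by
  rw [swiRho, swiRho, swiD_W_det W hW hW0 η _ hη x y hxy, swiS_W, neg_add, Real.exp_add]
  ring

lemma swiB_one_le (x y : V) (p : (V → ℝ) × (V → ℝ)) : 1 ≤ swiB x y p := by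
  have h1 := Real.one_le_cosh (p.1 x - p.1 y)
  have h2 : 0 ≤ (1/2) * (p.2 x - p.2 y) ^ 2 * Real.exp (p.1 x + p.1 y) := by positivity
  rw [swiB]; linarith

lemma swiZ_one_le (x : V) (p : (V → ℝ) × (V → ℝ)) : 1 ≤ swiZ x p := by
  have h1 := Real.one_le_cosh (p.1 x)
  have h2 : 0 ≤ (1/2) * p.2 x ^ 2 * Real.exp (p.1 x) := by positivity
  rw [swiZ]; linarith

lemma swiZ_exp_le (x : V) (p : (V → ℝ) × (V → ℝ)) : Real.exp (p.1 x) ≤ 2 * swiZ x p := by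
  have h2 : 0 ≤ (1/2) * p.2 x ^ 2 * Real.exp (p.1 x) := by positivity
  rw [swiZ, Real.cosh_eq]
  have := Real.exp_pos (-p.1 x)
  linarith

lemma swiB_le (x y : V) (p : (V → ℝ) × (V → ℝ)) : swiB x y p ≤ 10 * (swiZ x p * swiZ y p) := by
  have h1 : Real.cosh (p.1 x - p.1 y) ≤ 2 * (Real.cosh (p.1 x) * Real.cosh (p.1 y)) := by
    have := Real.cosh_pos (p.1 x + p.1 y)
    rw [Real.cosh_add] at this
    rw [Real.cosh_sub]; linarith
  have h2 : Real.cosh (p.1 x) ≤ swiZ x p := by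
    have : 0 ≤ (1/2) * p.2 x ^ 2 * Real.exp (p.1 x) := by positivity
    rw [swiZ]; linarith
  have h3 : Real.cosh (p.1 y) ≤ swiZ y p := by
    have : 0 ≤ (1/2) * p.2 y ^ 2 * Real.exp (p.1 y) := by positivity
    rw [swiZ]; linarith
  have h4 : Real.cosh (p.1 x) * Real.cosh (p.1 y) ≤ swiZ x p * swiZ y p :=
    mul_le_mul h2 h3 (Real.cosh_pos _).le (by linarith [swiZ_one_le x p])
  have h5 : (1/2) * p.2 x ^ 2 * Real.exp (p.1 x) ≤ swiZ x p := by
    have := Real.cosh_pos (p.1 x); rw [swiZ]; linarith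
  have h6 : (1/2) * p.2 y ^ 2 * Real.exp (p.1 y) ≤ swiZ y p := by
    have := Real.cosh_pos (p.1 y); rw [swiZ]; linarith
  have h7 : (1/2) * p.2 x ^ 2 * Real.exp (p.1 x) * Real.exp (p.1 y) ≤ swiZ x p * (2 * swiZ y p) :=
    mul_le_mul h5 (swiZ_exp_le y p) (Real.exp_pos _).le (by linarith [swiZ_one_le x p])
  have h8 : (1/2) * p.2 y ^ 2 * Real.exp (p.1 y) * Real.exp (p.1 x) ≤ swiZ y p * (2 * swiZ x p) :=
    mul_le_mul h6 (swiZ_exp_le x p) (Real.exp_pos _).le (by linarith [swiZ_one_le y p])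
  have h9 : (1/2) * (p.2 x - p.2 y) ^ 2 * Real.exp (p.1 x + p.1 y) ≤
      2 * ((1/2) * p.2 x ^ 2 * Real.exp (p.1 x) * Real.exp (p.1 y)) +
      2 * ((1/2) * p.2 y ^ 2 * Real.exp (p.1 y) * Real.exp (p.1 x)) := by
    rw [Real.exp_add]
    have : 0 ≤ (1/2) * (p.2 x + p.2 y) ^ 2 * (Real.exp (p.1 x) * Real.exp (p.1 y)) := by positivity
    nlinarith
  rw [swiB]
  linarith

lemma swiT_le (W : Matrix V V ℝ) (hW : ∀ i j, W i j = W j i) (hW0 : ∀ i j, 0 ≤ W i j)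
    (ε : ℝ) (hε : 0 < ε) (t : V → ℝ) (x y : V) (hxy : x ≠ y) :
    swiT W (fun _ => ε) x y t ≤ (Real.exp (t x) + Real.exp (t y)) / ε := by
  have hP := swiD_posDef W hW hW0 (fun _ => ε) t (fun _ => hε)
  set D := swiD W (fun _ => ε) t with hD
  set u := D⁻¹ *ᵥ swiDel x y with hu
  have hDu : D *ᵥ u = swiDel x y := by
    rw [hu, Matrix.mulVec_mulVec, Matrix.mul_nonsing_inv _ hP.det_pos.ne'.isUnit, Matrix.one_mulVec]
  have hq : swiDel x y ⬝ᵥ u = u x - u y := by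
    simp [swiDel, dotProduct, sub_mul, Finset.sum_sub_distrib]
  have hq2 : u ⬝ᵥ (D *ᵥ u) = u x - u y := by rw [hDu, dotProduct_comm, hq]
  have hlow : ε * (Real.exp (t x) * u x ^ 2 + Real.exp (t y) * u y ^ 2) ≤ u x - u y := by
    rw [← hq2, hD, swiD_quad W hW]
    have h1 : 0 ≤ (1/2) * ∑ i, ∑ j, W i j * Real.exp (t i + t j) * (u i - u j) ^ 2 := by
      apply mul_nonneg (by norm_num)
      refine Finset.sum_nonneg fun i _ => Finset.sum_nonneg fun j _ => ?_
      have := hW0 i j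
      positivity
    have h2 : ∑ i ∈ ({x, y} : Finset V), ε * Real.exp (t i) * u i ^ 2 ≤
        ∑ i, ε * Real.exp (t i) * u i ^ 2 :=
      Finset.sum_le_sum_of_subset_of_nonneg (Finset.subset_univ _) fun i _ _ => by positivity
    rw [Finset.sum_pair hxy] at h2
    linarith
  rw [swiT, ← hD, ← hu, hq, Real.exp_add, le_div_iff₀ hε]
  set a := Real.exp (t x)
  set b := Real.exp (t y)
  have ha : 0 < a := Real.exp_pos _
  have hb : 0 < b := Real.exp_pos _
  set q := u x - u y with hqq
  have hCS : a * b * q ^ 2 ≤ (a + b) * (a * u x ^ 2 + b * u y ^ 2) := by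
    have : 0 ≤ (a * u x + b * u y) ^ 2 := sq_nonneg _
    rw [hqq]; nlinarith
  rcases le_or_gt q 0 with h0 | h0
  · have : a * b * q * ε ≤ 0 := by
      have : 0 ≤ a * b * ε * (-q) := mul_nonneg (by positivity) (by linarith)
      linarith
    linarith
  · have h1 : (a * b * q * ε) * q ≤ (a + b) * q := by
      calc (a * b * q * ε) * q = ε * (a * b * q ^ 2) := by ring
        _ ≤ ε * ((a + b) * (a * u x ^ 2 + b * u y ^ 2)) := by gcongr
        _ = (a + b) * (ε * (a * u x ^ 2 + b * u y ^ 2)) := by ring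
        _ ≤ (a + b) * q := by gcongr
    exact le_of_mul_le_mul_right h1 h0

lemma swiT_le' (W : Matrix V V ℝ) (hW : ∀ i j, W i j = W j i) (hW0 : ∀ i j, 0 ≤ W i j)
    (ε : ℝ) (hε : 0 < ε) (p : (V → ℝ) × (V → ℝ)) (x y : V) (hxy : x ≠ y) :
    1 + swiT W (fun _ => ε) x y p.1 ≤ (1 + 4 / ε) * (swiZ x p * swiZ y p) := by
  have h := swiT_le W hW hW0 ε hε p.1 x y hxy
  have h1 := swiZ_one_le x p
  have h2 := swiZ_one_le y p
  have h3 := swiZ_exp_le x p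
  have h4 := swiZ_exp_le y p
  have h5 : 1 ≤ swiZ x p * swiZ y p := by nlinarith
  have h6 : Real.exp (p.1 x) + Real.exp (p.1 y) ≤ 4 * (swiZ x p * swiZ y p) := by nlinarith
  have h7 : (Real.exp (p.1 x) + Real.exp (p.1 y)) / ε ≤ 4 * (swiZ x p * swiZ y p) / ε := by gcongr
  calc _ ≤ swiZ x p * swiZ y p + 4 * (swiZ x p * swiZ y p) / ε := by linarith
    _ = _ := by ring

lemma swiS_lower (W : Matrix V V ℝ) (hW0 : ∀ i j, 0 ≤ W i j)
    (ε : ℝ) (hε : 0 < ε) (p : (V → ℝ) × (V → ℝ)) (x y : V) (hxy : x ≠ y) :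
    ε * (swiZ x p - 1) + ε * (swiZ y p - 1) ≤ swiS W (fun _ => ε) p.1 p.2 := by
  have h1 : 0 ≤ (1/2) * ∑ i, ∑ j, W i j * (swiB i j p - 1) := by
    apply mul_nonneg (by norm_num)
    refine Finset.sum_nonneg fun i _ => Finset.sum_nonneg fun j _ => ?_
    exact mul_nonneg (hW0 i j) (by linarith [swiB_one_le i j p])
  have h2 : ∑ i ∈ ({x, y} : Finset V), ε * (swiZ i p - 1) ≤ ∑ i, ε * (swiZ i p - 1) :=
    Finset.sum_le_sum_of_subset_of_nonneg (Finset.subset_univ _) fun i _ _ =>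
      mul_nonneg hε.le (by linarith [swiZ_one_le i p])
  rw [Finset.sum_pair hxy] at h2
  have h3 : swiS W (fun _ => ε) p.1 p.2 = (1/2) * ∑ i, ∑ j, W i j * (swiB i j p - 1) +
    ∑ i, ε * (swiZ i p - 1) := rfl
  linarith

lemma swi_pow_exp (n : ℕ) (c z : ℝ) (hc : 0 < c) (hz : 1 ≤ z) :
    z ^ n * Real.exp (-(c * (z - 1))) ≤ n.factorial / c ^ n * Real.exp c := by
  have h := Real.pow_div_factorial_le_exp (c * z) (by positivity) n
  have hf : (0:ℝ) < n.factorial := by positivity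
  rw [div_le_iff₀ hf, mul_pow] at h
  have e : Real.exp (-(c * (z - 1))) = Real.exp c * Real.exp (-(c * z)) := by
    rw [← Real.exp_add]; congr 1; ring
  rw [e, div_mul_eq_mul_div, le_div_iff₀ (by positivity)]
  calc z ^ n * (Real.exp c * Real.exp (-(c * z))) * c ^ n
      = (c ^ n * z ^ n) * (Real.exp c * Real.exp (-(c * z))) := by ring
    _ ≤ (Real.exp (c * z) * n.factorial) * (Real.exp c * Real.exp (-(c * z))) := by gcongr
    _ = n.factorial * Real.exp c * (Real.exp (c * z) * Real.exp (-(c * z))) := by ring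
    _ = _ := by rw [← Real.exp_add]; simp

lemma swi_bound (W : Matrix V V ℝ) (hW : ∀ i j, W i j = W j i) (hW0 : ∀ i j, 0 ≤ W i j)
    (W' : Matrix V V ℝ) (hW0' : ∀ i j, 0 ≤ W' i j)
    (ε c : ℝ) (hε : 0 < ε) (hc : 0 < c) (x y : V) (hxy : x ≠ y) (m : ℝ) :
    ∃ K : ℝ, 0 ≤ K ∧ ∀ p : (V → ℝ) × (V → ℝ),
      swiB x y p ^ m * (1 + swiT W (fun _ => ε) x y p.1) * Real.exp (-swiS W' (fun _ => c) p.1 p.2)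
        ≤ K := by
  obtain ⟨n, hn⟩ := exists_nat_ge m
  set K1 : ℝ := (n + 1).factorial / c ^ (n + 1) * Real.exp c with hK1
  refine ⟨10 ^ n * (1 + 4 / ε) * (K1 * K1), by positivity, fun p => ?_⟩
  have hB1 := swiB_one_le x y p
  have hzx := swiZ_one_le x p
  have hzy := swiZ_one_le y p
  have h1 : swiB x y p ^ m ≤ (10 * (swiZ x p * swiZ y p)) ^ n := by
    calc swiB x y p ^ m ≤ swiB x y p ^ (n : ℝ) := Real.rpow_le_rpow_of_exponent_le hB1 hn
      _ = swiB x y p ^ n := Real.rpow_natCast _ _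
      _ ≤ _ := by
        have := swiB_le x y p
        gcongr
  have h2 := swiT_le' W hW hW0 ε hε p x y hxy
  have h3 : Real.exp (-swiS W' (fun _ => c) p.1 p.2) ≤
      Real.exp (-(c * (swiZ x p - 1))) * Real.exp (-(c * (swiZ y p - 1))) := by
    rw [← Real.exp_add]
    apply Real.exp_le_exp.2
    linarith [swiS_lower W' hW0' c hc p x y hxy]
  have hT := swiT_nonneg W hW hW0 (fun _ => ε) p.1 (fun _ => hε) x y
  have hxK := swi_pow_exp (n + 1) c (swiZ x p) hc hzx
  have hyK := swi_pow_exp (n + 1) c (swiZ y p) hc hzy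
  have hB0 : 0 ≤ swiB x y p ^ m := Real.rpow_nonneg (by linarith) _
  calc _ ≤ (10 * (swiZ x p * swiZ y p)) ^ n * ((1 + 4 / ε) * (swiZ x p * swiZ y p)) *
        (Real.exp (-(c * (swiZ x p - 1))) * Real.exp (-(c * (swiZ y p - 1)))) := by
        gcongr
    _ = 10 ^ n * (1 + 4 / ε) * ((swiZ x p ^ (n + 1) * Real.exp (-(c * (swiZ x p - 1)))) *
        (swiZ y p ^ (n + 1) * Real.exp (-(c * (swiZ y p - 1))))) := by ring
    _ ≤ _ := by
        gcongr

lemma swiRho_half (W : Matrix V V ℝ) (ε : ℝ) (p : (V → ℝ) × (V → ℝ)) :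
    swiRho W (fun _ => ε) p = 2 ^ Fintype.card V * swiRho ((1/2 : ℝ) • W) (fun _ => ε / 2) p *
      Real.exp (-swiS ((1/2 : ℝ) • W) (fun _ => ε / 2) p.1 p.2) := by
  have hD : swiD W (fun _ => ε) p.1 = (2:ℝ) • swiD ((1/2 : ℝ) • W) (fun _ => ε / 2) p.1 := by
    ext i j
    rw [Matrix.smul_apply, swiD_apply, swiD_apply]
    have : swiF W (fun _ => ε) p.1 i = 2 * swiF ((1/2 : ℝ) • W) (fun _ => ε / 2) p.1 i := by
      simp only [swiF, Matrix.smul_apply, smul_eq_mul, mul_assoc, ← Finset.mul_sum]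
      ring
    rw [this]
    simp only [Matrix.smul_apply, smul_eq_mul]
    split_ifs <;> ring
  have hS : swiS W (fun _ => ε) p.1 p.2 = 2 * swiS ((1/2 : ℝ) • W) (fun _ => ε / 2) p.1 p.2 := by
    simp only [swiS, Matrix.smul_apply, smul_eq_mul, mul_assoc, ← Finset.mul_sum]
    ring
  rw [swiRho, swiRho, hD, Matrix.det_smul, hS, two_mul, neg_add, Real.exp_add]
  ring

lemma swiT_measurable (W : Matrix V V ℝ) (η : V → ℝ) (x y : V) : Measurable (swiT W η x y) := by
  have hD := swiD_continuous W η
  have h1 : Continuous fun t => (swiD W η t).det := hD.matrix_det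
  have h2 : Continuous fun t => (swiD W η t).adjugate := hD.matrix_adjugate
  have hij : ∀ i j, Measurable fun t => (swiD W η t)⁻¹ i j := by
    intro i j
    have h3 : Continuous fun t => (swiD W η t).adjugate i j := h2.matrix_elem i j
    have e : (fun t => (swiD W η t)⁻¹ i j) =
        fun t => ((swiD W η t).det)⁻¹ * (swiD W η t).adjugate i j := by
      funext t
      rw [Matrix.inv_def, Matrix.smul_apply, smul_eq_mul, Ring.inverse_eq_inv']
    rw [e]
    exact h1.measurable.inv.mul h3.measurable
  have h4 : Measurable fun t : V → ℝ => Real.exp (t x + t y) := by fun_prop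
  have h5 : Measurable fun t => swiDel x y ⬝ᵥ ((swiD W η t)⁻¹ *ᵥ swiDel x y) := by
    simp only [dotProduct, Matrix.mulVec]
    generalize swiDel x y = d
    refine Finset.measurable_fun_sum _ fun i _ => Measurable.const_mul ?_ _
    exact Finset.measurable_fun_sum _ fun j _ => Measurable.mul_const (hij i j) _
  exact h4.mul h5

/-- The Ward identity for general symmetric couplings. -/
theorem swi_ward (W : Matrix V V ℝ) (hW : ∀ i j, W i j = W j i) (hW0 : ∀ i j, 0 ≤ W i j)
    (ε : ℝ) (hε : 0 < ε) (x y : V) (hxy : x ≠ y) (m : ℝ) :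
    ∫ p : (V → ℝ) × (V → ℝ), swiB x y p ^ m *
      (1 - m * (swiT W (fun _ => ε) x y p.1 / swiB x y p)) * swiRho W (fun _ => ε) p = 1 := by
  have hρ := swiRho_continuous W (fun _ : V => ε)
  have hρ0 : ∀ p, 0 ≤ swiRho W (fun _ => ε) p := fun p =>
    (swiRho_pos W hW hW0 _ (fun _ => hε) p).le
  set r : (V → ℝ) × (V → ℝ) → ENNReal := fun p => ENNReal.ofReal (swiRho W (fun _ => ε) p) with hr
  have hrm : Measurable r := hρ.measurable.ennreal_ofReal
  have hrlt : ∀ᵐ p ∂(volume : Measure ((V → ℝ) × (V → ℝ))), r p < ⊤ :=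
    ae_of_all _ fun _ => ENNReal.ofReal_lt_top
  have hBm : Measurable (swiB x y) := by unfold swiB; fun_prop
  have hTm : Measurable fun p : (V → ℝ) × (V → ℝ) => swiT W (fun _ => ε) x y p.1 :=
    (swiT_measurable W _ x y).comp measurable_fst
  have hT0 : ∀ p : (V → ℝ) × (V → ℝ), 0 ≤ swiT W (fun _ => ε) x y p.1 := fun p =>
    swiT_nonneg W hW hW0 _ p.1 (fun _ => hε) x y
  have hh : ∀ i j, ((1/2 : ℝ) • W) i j = ((1/2 : ℝ) • W) j i := fun i j => by
    simp [hW i j]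
  have hh0 : ∀ i j, 0 ≤ ((1/2 : ℝ) • W) i j := fun i j => by
    have := hW0 i j
    simp only [Matrix.smul_apply, smul_eq_mul]; positivity
  have hhalf : Integrable (swiRho ((1/2 : ℝ) • W) (fun _ : V => ε / 2)) := by
    refine ⟨(swiRho_continuous _ _).aestronglyMeasurable, ?_⟩
    rw [hasFiniteIntegral_iff_ofReal (ae_of_all _ fun p =>
      (swiRho_pos _ hh hh0 _ (fun _ => by positivity) p).le),
      swi_normalization _ hh hh0 _ (fun _ => by positivity)]
    simp
  have hintg : ∀ f : (V → ℝ) × (V → ℝ) → ℝ, Measurable f → (∀ p, 0 ≤ f p) → ∀ m : ℝ,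
      (∀ p, f p ≤ swiB x y p ^ m * (1 + swiT W (fun _ => ε) x y p.1)) →
      Integrable f (volume.withDensity r) := by
    intro f hf hf0 m hfm
    rw [integrable_withDensity_iff hrm hrlt]
    obtain ⟨K, hK0, hK⟩ := swi_bound W hW hW0 ((1/2 : ℝ) • W) hh0 ε (ε / 2) hε (by positivity)
      x y hxy m
    refine Integrable.mono' (hhalf.const_mul (K * 2 ^ Fintype.card V)) ?_ (ae_of_all _ fun p => ?_)
    · exact (hf.mul hrm.ennreal_toReal).aestronglyMeasurable
    · simp only [hr, ENNReal.toReal_ofReal (hρ0 p)]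
      rw [Real.norm_of_nonneg (mul_nonneg (hf0 p) (hρ0 p)), swiRho_half]
      have hpos := swiRho_pos _ hh hh0 (fun _ => ε / 2) (fun _ => by positivity) p
      set R := swiRho ((1/2 : ℝ) • W) (fun _ => ε / 2) p
      set S := Real.exp (-swiS ((1/2 : ℝ) • W) (fun _ => ε / 2) p.1 p.2) with hS
      have h1 : f p * S ≤ K := by
        refine le_trans ?_ (hK p)
        have := hfm p
        gcongr
      calc f p * (2 ^ Fintype.card V * R * S) = (f p * S) * (2 ^ Fintype.card V * R) := by ring
        _ ≤ K * (2 ^ Fintype.card V * R) := by gcongr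
        _ = _ := by ring
  have main := swi_abstract (volume.withDensity r) (swiB x y)
    (fun p => swiT W (fun _ => ε) x y p.1) hBm hTm (swiB_one_le x y) hT0 ?_ ?_ ?_ m
  · rw [integral_withDensity_eq_integral_toReal_smul hrm hrlt] at main
    refine Eq.trans ?_ main
    refine integral_congr_ae (ae_of_all _ fun p => ?_)
    simp only [hr, ENNReal.toReal_ofReal (hρ0 p), smul_eq_mul]
    ring
  · intro l hl
    rw [lintegral_withDensity_eq_lintegral_mul _ hrm (by fun_prop)]
    rw [← swi_normalization (swiW W x y l) (swiW_symm W hW x y l) (swiW_nonneg W hW0 x y l hl.le)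
      (fun _ => ε) (fun _ => hε)]
    refine lintegral_congr fun p => ?_
    rw [swiRho_W W hW hW0 _ (fun _ => hε) x y hxy, ENNReal.ofReal_mul (hρ0 p)]
    rfl
  · intro m'
    refine hintg _ (by fun_prop) (fun p => Real.rpow_nonneg (by linarith [swiB_one_le x y p]) _) m'
      fun p => ?_
    have h1 : 0 ≤ swiB x y p ^ m' := Real.rpow_nonneg (by linarith [swiB_one_le x y p]) _
    have h2 := hT0 p
    nlinarith [mul_nonneg h1 h2]
  · intro m'
    have h1 : ∀ p, 0 ≤ swiB x y p ^ m' := fun p =>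
      Real.rpow_nonneg (by linarith [swiB_one_le x y p]) _
    refine hintg _ (by fun_prop) (fun p => mul_nonneg (h1 p) (hT0 p)) m' fun p => ?_
    nlinarith [h1 p]

end

end swi_part_F

/-- Nearest-neighbor couplings. -/
def swiNN (L : ℕ) (β : ℝ) : Matrix (Torus (L + 2)) (Torus (L + 2)) ℝ :=
  Matrix.of fun i j => if NN i j then β else 0

lemma swi_NN_symm {L : ℕ} (x y : Torus L) : NN x y ↔ NN y x := by
  have h : ∀ x y : Torus L, NN x y → NN y x := by
    rintro x y ⟨hne, i, h | h⟩
    · exact ⟨hne.symm, i, Or.inr (by rw [h]; simp)⟩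
    · exact ⟨hne.symm, i, Or.inl (by rw [h]; simp)⟩
  exact ⟨h x y, h y x⟩

lemma swi_Dmat (L : ℕ) (β ε : ℝ) (t : Torus (L + 2) → ℝ) :
    Dmat β ε t = swiD (swiNN L β) (fun _ => ε) t := by
  ext i j
  rw [swiD_apply, Dmat, Matrix.of_apply]
  by_cases hij : i = j
  · subst hij
    have h0 : ¬ NN i i := fun h => h.1 rfl
    simp only [if_true, swiNN, Matrix.of_apply, if_neg h0, sub_zero, swiF]
    rw [mul_add, add_mul, Finset.mul_sum, Finset.mul_sum, Finset.sum_mul]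
    congr 1
    · refine Finset.sum_congr rfl fun k _ => ?_
      simp only [swi_NN_symm k i]
      split_ifs
      · have : Real.exp (t k + t i) = Real.exp (t i) * Real.exp (t k - t i) * Real.exp (t i) := by
          rw [← Real.exp_add, ← Real.exp_add]; congr 1; ring
        rw [this]; ring
      · simp
    · have : Real.exp (t i) = Real.exp (t i) * Real.exp (- t i) * Real.exp (t i) := by
        rw [← Real.exp_add, ← Real.exp_add]; congr 1; ring
      calc ε * Real.exp (t i) = ε * (Real.exp (t i) * Real.exp (- t i) * Real.exp (t i)) := by
            rw [← this]
        _ = _ := by ring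
  · simp only [if_neg hij, swiNN, Matrix.of_apply]
    split_ifs
    · rw [Real.exp_add]; ring
    · simp

lemma swi_action (L : ℕ) (β ε : ℝ) (t s : Torus (L + 2) → ℝ) :
    -(β * nnSum (fun i j => Bq t s i j - 1)) - ε * ∑ k : Torus (L + 2), (zb t s k - 1) =
      -swiS (swiNN L β) (fun _ => ε) t s := by
  have h : β * nnSum (fun i j => Bq t s i j - 1) = (1/2) * ∑ i, ∑ j, swiNN L β i j *
      (Real.cosh (t i - t j) + (1/2) * (s i - s j) ^ 2 * Real.exp (t i + t j) - 1) := by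
    rw [nnSum, mul_left_comm, Finset.mul_sum]
    congr 1
    refine Finset.sum_congr rfl fun i _ => ?_
    rw [Finset.mul_sum]
    refine Finset.sum_congr rfl fun j _ => ?_
    simp only [swiNN, Matrix.of_apply, Bq]
    split_ifs <;> simp
  have h2 : ε * ∑ k : Torus (L + 2), (zb t s k - 1) =
      ∑ i, ε * (Real.cosh (t i) + (1/2) * s i ^ 2 * Real.exp (t i) - 1) := by
    rw [Finset.mul_sum]
    rfl
  rw [h, h2, swiS, neg_add, sub_eq_add_neg]

lemma swi_Gfun (L : ℕ) (β ε : ℝ) (p : (Torus (L + 2) → ℝ) × (Torus (L + 2) → ℝ))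
    (x y : Torus (L + 2)) :
    Gfun β ε p.1 p.2 x y = swiT (swiNN L β) (fun _ => ε) x y p.1 / swiB x y p := by
  have hd : delta x - delta y = swiDel x y := by
    funext j
    simp [delta, swiDel]
  have hq : qform (Dmat β ε p.1)⁻¹ (delta x - delta y) (delta x - delta y) =
      dotProduct (swiDel x y)
        (Matrix.mulVec (swiD (swiNN L β) (fun _ => ε) p.1)⁻¹ (swiDel x y)) := by
    rw [qform, hd, swi_Dmat]
    simp only [dotProduct, Matrix.mulVec, Finset.mul_sum, mul_assoc]
  have hb : Bq p.1 p.2 x y = swiB x y p := rfl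
  rw [Gfun, hq, hb, swiT]
  ring

/-- **Basic supersymmetric Ward identity.** For every `m ∈ ℝ` and distinct sites `x ≠ y`,
`⟨B_{xy}^m (1 - m G_{xy})⟩ = 1`. -/
theorem susy_ward_identity (β ε : ℝ) (hβ : 0 < β) (hε : 0 < ε) (L : ℕ)
    (m : ℝ) (x y : Torus (L + 2)) (hxy : x ≠ y) :
    tsExpect β ε (fun t s => Bq t s x y ^ m * (1 - m * Gfun β ε t s x y)) = 1 := by
  have hW : ∀ i j, swiNN L β i j = swiNN L β j i := by
    intro i j
    simp only [swiNN, Matrix.of_apply, swi_NN_symm i j]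
  have hW0 : ∀ i j, 0 ≤ swiNN L β i j := by
    intro i j
    simp only [swiNN, Matrix.of_apply]
    split_ifs
    · exact hβ.le
    · exact le_rfl
  refine Eq.trans ?_ (swi_ward (swiNN L β) hW hW0 ε hε x y hxy m)
  rw [tsExpect]
  refine integral_congr_ae (ae_of_all _ fun p => ?_)
  have hb : Bq p.1 p.2 x y = swiB x y p := rfl
  simp only [swi_Dmat, swi_action, swi_Gfun, hb, swiRho]
  ring

end
end

section
/- Multi-pair supersymmetric Ward identity: for every β > 0, ε > 0, L ≥ 2, every m ∈ ℝ, and every n pairs of sites (x₁,y₁), …, (xₙ,yₙ) with x_i ≠ y_i, one has 1 = ⟨∏_{i=1}^n B_{x_i y_i}^m · det(Iₙ − m 𝒢)⟩ₜₛ, where 𝒢 is the n×n matrix with entries 𝒢_{ij} = [g_i; D_{β,ε}(t)^{-1} g_j] and g_i = B_{x_i y_i}^{-1/2} e^{(t_{x_i}+t_{y_i})/2}(δ_{x_i} − δ_{y_i}). -/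
open scoped BigOperators Classical
open MeasureTheory

noncomputable section

variable {L : ℕ}

/-- The vector `g_i = B_{x_i y_i}^{-1/2} e^{(t_{x_i}+t_{y_i})/2}(δ_{x_i} - δ_{y_i})`. -/
def gvec {L : ℕ} (t s : Torus L → ℝ) (x y : Torus L) : Torus L → ℝ :=
  fun a => Bq t s x y ^ (-(1 / 2) : ℝ) * Real.exp ((t x + t y) / 2) *
    (delta x a - delta y a)

section PartA

lemma H22.lintegral_gauss : ∫⁻ y : ℝ, ENNReal.ofReal (Real.exp (-(1/2) * y^2)) = ENNReal.ofReal (Real.sqrt (2 * Real.pi)) := by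
  rw [← ofReal_integral_eq_lintegral_ofReal (integrable_exp_neg_mul_sq (by norm_num)) (Filter.Eventually.of_forall fun _ => (Real.exp_pos _).le), integral_gaussian]
  congr 2; ring

/-- The one-dimensional (reciprocal) inverse Gaussian integral. -/
lemma H22.invGauss (A : ℝ) (hA : 0 < A) :
    ∫⁻ c in Set.Ioi (0:ℝ), ENNReal.ofReal (Real.exp (-(1/2) * c - (1/2) * (A^2 / c)) / Real.sqrt c)
      = ENNReal.ofReal (Real.sqrt (2 * Real.pi) * Real.exp (-A)) := by
  set r : ℝ → ℝ := fun y => Real.sqrt (y^2 + 4*A) with hr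
  have hrpos : ∀ y, 0 < r y := fun y => Real.sqrt_pos.2 (by positivity)
  have hrsq : ∀ y, r y ^ 2 = y^2 + 4*A := fun y => Real.sq_sqrt (by positivity)
  have hlt : ∀ y, |y| < r y := fun y => by
    apply abs_lt_of_sq_lt_sq _ (hrpos y).le
    rw [hrsq]; linarith
  set X : ℝ → ℝ := fun y => (y + r y)/2 with hX
  have hXpos : ∀ y, 0 < X y := fun y => by
    have := neg_abs_le y; have := hlt y; simp only [hX]; linarith
  have hXeq : ∀ y, X y ^2 - A = y * X y := fun y => by
    have := hrsq y
    simp only [hX]; nlinarith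
  have hrd : ∀ y, HasDerivAt r (y / r y) y := fun y => by
    have h1 : HasDerivAt (fun y : ℝ => y^2 + 4*A) (2*y) y := by
      simpa using (hasDerivAt_pow 2 y).add_const (4*A)
    have := h1.sqrt (by positivity)
    convert this using 1
    simp only [hr]; rw [mul_div_mul_left _ _ two_ne_zero]
  have hXd : ∀ y, HasDerivAt (fun y => X y ^ 2) (X y * (1 + y / r y)) y := fun y => by
    have := (((hasDerivAt_id y).add (hrd y)).div_const 2).pow 2
    refine HasDerivAt.congr_deriv (f := fun y => X y ^ 2) this ?_
    simp [hX]; ring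
  have himg : (fun y => X y ^ 2) '' Set.univ = Set.Ioi 0 := by
    ext c
    simp only [Set.image_univ, Set.mem_range, Set.mem_Ioi]
    constructor
    · rintro ⟨y, rfl⟩; have := hXpos y; positivity
    · intro hc
      refine ⟨Real.sqrt c - A / Real.sqrt c, ?_⟩
      have hs := Real.sqrt_pos.2 hc
      have : r (Real.sqrt c - A / Real.sqrt c) = Real.sqrt c + A / Real.sqrt c := by
        simp only [hr]
        rw [Real.sqrt_eq_iff_mul_self_eq (by positivity) (by positivity)]
        field_simp; ring
      simp only [hX, this]
      rw [show (Real.sqrt c - A / Real.sqrt c + (Real.sqrt c + A / Real.sqrt c))/2 = Real.sqrt c by ring, Real.sq_sqrt hc.le]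
  have hinj : Set.InjOn (fun y => X y ^ 2) Set.univ := by
    intro a _ b _ hab
    have hab' : X a = X b := by
      have := (sq_eq_sq_iff_abs_eq_abs _ _).1 hab
      rwa [abs_of_pos (hXpos a), abs_of_pos (hXpos b)] at this
    have h1 := hXeq a
    rw [hab', hXeq b] at h1
    exact (mul_right_cancel₀ (hXpos b).ne' h1).symm
  rw [← himg, lintegral_image_eq_lintegral_abs_deriv_mul MeasurableSet.univ (fun y _ => (hXd y).hasDerivWithinAt) hinj]
  simp only [Measure.restrict_univ]
  have key : ∀ y, ENNReal.ofReal |X y * (1 + y / r y)| * ENNReal.ofReal (Real.exp (-(1/2) * X y ^ 2 - (1/2) * (A^2 / X y ^ 2)) / Real.sqrt (X y ^ 2)) = ENNReal.ofReal (Real.exp (-A)) * ENNReal.ofReal ((1 + y / r y) * Real.exp (-(1/2) * y^2)) := by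
    intro y
    have hp := hXpos y
    have h1 : 0 < 1 + y / r y := by
      have := neg_abs_le y; have := hlt y; have := hrpos y
      rw [show 1 + y / r y = (r y + y)/ r y by field_simp]
      apply div_pos _ this; linarith
    rw [abs_of_pos (mul_pos hp h1), Real.sqrt_sq hp.le, ← ENNReal.ofReal_mul (by positivity), ← ENNReal.ofReal_mul (by positivity)]
    have h2 : -(1/2) * X y ^ 2 - (1/2) * (A^2 / X y ^ 2) = -A + -(1/2) * y^2 := by
      have : y = (X y ^2 - A)/ X y := by rw [hXeq]; field_simp
      have h3 : y^2 = (X y ^2 - A)^2/ X y^2 := by rw [← div_pow, ← this]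
      rw [h3]; field_simp; ring
    rw [h2, Real.exp_add]
    congr 1; field_simp
  simp_rw [key]
  have hcr : Continuous r := continuous_iff_continuousAt.2 fun y => (hrd y).continuousAt
  have hm : Measurable fun y => ENNReal.ofReal ((1 + y / r y) * Real.exp (-(1/2) * y^2)) := by
    have := hcr.measurable
    fun_prop
  rw [lintegral_const_mul _ hm]
  have hint0 : Integrable (fun y : ℝ => Real.exp (-(1/2) * y^2)) := integrable_exp_neg_mul_sq (by norm_num)
  have hint1 : Integrable (fun y : ℝ => y / r y * Real.exp (-(1/2) * y^2)) := by
    refine hint0.mono (by have := hcr.measurable; exact Measurable.aestronglyMeasurable (by fun_prop)) (Filter.Eventually.of_forall fun y => ?_)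
    rw [norm_mul]
    refine mul_le_of_le_one_left (norm_nonneg _) ?_
    rw [Real.norm_eq_abs, abs_div, abs_of_pos (hrpos y)]
    exact (div_le_one (hrpos y)).2 (hlt y).le
  have hodd : ∫ y : ℝ, y / r y * Real.exp (-(1/2) * y^2) = 0 := by
    have := integral_neg_eq_self (fun y : ℝ => y / r y * Real.exp (-(1/2) * y^2)) volume
    have h2 : ∀ y : ℝ, (-y) / r (-y) * Real.exp (-(1/2) * (-y)^2) = - (y / r y * Real.exp (-(1/2) * y^2)) := by
      intro y; simp only [hr, neg_sq]; ring
    simp_rw [h2] at this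
    rw [integral_neg] at this
    linarith
  rw [← ofReal_integral_eq_lintegral_ofReal, mul_comm, ← ENNReal.ofReal_mul']
  · congr 2
    simp_rw [add_mul, one_mul]
    rw [integral_add hint0 hint1, hodd, integral_gaussian, add_zero]; congr 1; ring
  · positivity
  · simp_rw [add_mul, one_mul]; exact hint0.add hint1
  · refine Filter.Eventually.of_forall fun y => ?_
    have : 0 ≤ 1 + y / r y := by
      have := neg_abs_le y; have := hlt y; have := hrpos y
      rw [show 1 + y / r y = (r y + y)/ r y by field_simp]
      apply div_nonneg _ this.le; linarith
    simp only [Pi.zero_apply]; positivity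

end PartA

section PartB
open Matrix

def H22.Hm {V : Type*} [Fintype V] [DecidableEq V] (W : Matrix V V ℝ) (b : V → ℝ) : Matrix V V ℝ :=
  Matrix.diagonal b - W

def H22.Dg {V : Type*} [Fintype V] [DecidableEq V] (W : Matrix V V ℝ) (η : V → ℝ) (t : V → ℝ) : Matrix V V ℝ :=
  Matrix.diagonal (fun i => (∑ j, W i j * Real.exp (t i + t j)) + η i * Real.exp (t i)) -
    Matrix.of fun i j => W i j * Real.exp (t i + t j)

def H22.bmap {V : Type*} [Fintype V] [DecidableEq V] (W : Matrix V V ℝ) (η : V → ℝ) (t : V → ℝ) : V → ℝ :=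
  fun i => (∑ j, W i j * Real.exp (t j - t i)) + η i * Real.exp (-t i)

structure H22.Good {V : Type*} (W : Matrix V V ℝ) : Prop where
  symm : ∀ i j, W i j = W j i
  nonneg : ∀ i j, 0 ≤ W i j
  diag : ∀ i, W i i = 0

namespace H22
variable {V : Type*} [Fintype V] [DecidableEq V]

lemma mmatrix (H : Matrix V V ℝ) (hH : H.PosDef) (hoff : ∀ i j, i ≠ j → H i j ≤ 0) (η u : V → ℝ)
    (hη : ∀ i, 0 < η i) (hu : H *ᵥ u = η) (i : V) : 0 < u i := by
  set p : V → ℝ := fun i => max (-u i) 0 with hp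
  have hp0 : ∀ i, 0 ≤ p i := fun i => le_max_right _ _
  have hup : ∀ i, 0 ≤ u i + p i := fun i => by have := le_max_left (-u i) 0; simp only [hp]; linarith
  have hpu : ∀ i, p i * (u i + p i) = 0 := fun i => by
    simp only [hp]; rcases le_total (-u i) 0 with h | h
    · rw [max_eq_right h]; simp
    · rw [max_eq_left h]; simp
  have h1 : p ⬝ᵥ (H *ᵥ (u + p)) ≤ 0 := by
    simp only [dotProduct, mulVec, Finset.mul_sum, Pi.add_apply]
    refine Finset.sum_nonpos fun i _ => Finset.sum_nonpos fun j _ => ?_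
    by_cases hij : i = j
    · subst hij
      have := hpu i
      have : p i * (H i i * (u i + p i)) = H i i * (p i * (u i + p i)) := by ring
      rw [this, hpu]; simp
    · have h3 := mul_nonneg (hp0 i) (hup j)
      have := mul_nonpos_of_nonneg_of_nonpos h3 (hoff i j hij)
      linarith
  have h2 : 0 ≤ p ⬝ᵥ η := Finset.sum_nonneg fun i _ => mul_nonneg (hp0 i) (hη i).le
  rw [mulVec_add, dotProduct_add, hu] at h1
  have h3 : p = 0 := by
    by_contra hne
    have := hH.dotProduct_mulVec_pos hne
    simp only [star_trivial] at this
    linarith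
  have hu0 : ∀ i, 0 ≤ u i := fun i => by have := hup i; rw [h3] at this; simpa using this
  have h4 : η i = ∑ j, H i j * u j := by rw [← hu]; rfl
  have h5 : ∑ j, H i j * u j ≤ H i i * u i := by
    rw [← Finset.add_sum_erase _ _ (Finset.mem_univ i)]
    have : ∑ j ∈ Finset.univ.erase i, H i j * u j ≤ 0 := Finset.sum_nonpos fun j hj =>
      mul_nonpos_of_nonpos_of_nonneg (hoff i j (Finset.ne_of_mem_erase hj).symm) (hu0 j)
    linarith
  have h6 := hη i
  have h7 := hH.diag_pos (i := i)
  by_contra hcon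
  have : u i = 0 := le_antisymm (not_lt.1 hcon) (hu0 i)
  rw [this] at h5; linarith

lemma quad_Dg (W : Matrix V V ℝ) (hW : Good W) (η t v : V → ℝ) :
    v ⬝ᵥ (Dg W η t *ᵥ v) = (1/2) * ∑ i, ∑ j, W i j * Real.exp (t i + t j) * (v i - v j)^2
      + ∑ i, η i * Real.exp (t i) * v i ^ 2 := by
  have h1 : v ⬝ᵥ (Dg W η t *ᵥ v) = ∑ i, ∑ j, W i j * Real.exp (t i + t j) * (v i ^ 2 - v i * v j) + ∑ i, η i * Real.exp (t i) * v i ^ 2 := by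
    rw [← Finset.sum_add_distrib]
    simp only [Dg, sub_mulVec, dotProduct, Pi.sub_apply, mulVec_diagonal]
    refine Finset.sum_congr rfl fun i _ => ?_
    simp only [mulVec, dotProduct, of_apply]
    have : ∑ j, W i j * Real.exp (t i + t j) * (v i ^ 2 - v i * v j) = (∑ j, W i j * Real.exp (t i + t j)) * v i ^ 2 - v i * ∑ j, W i j * Real.exp (t i + t j) * v j := by
      rw [Finset.mul_sum, Finset.sum_mul, ← Finset.sum_sub_distrib]
      exact Finset.sum_congr rfl fun j _ => by ring
    rw [this]; ring
  have h2 : ∑ i, ∑ j, W i j * Real.exp (t i + t j) * (v i ^ 2 - v i * v j) = ∑ i, ∑ j, W i j * Real.exp (t i + t j) * (v j ^ 2 - v i * v j) := by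
    rw [Finset.sum_comm]
    refine Finset.sum_congr rfl fun i _ => Finset.sum_congr rfl fun j _ => ?_
    rw [hW.symm j i, add_comm (t j)]; ring
  have h3 : ∑ i, ∑ j, W i j * Real.exp (t i + t j) * (v i - v j)^2 = ∑ i, ∑ j, W i j * Real.exp (t i + t j) * (v i ^ 2 - v i * v j) + ∑ i, ∑ j, W i j * Real.exp (t i + t j) * (v j ^ 2 - v i * v j) := by
    simp_rw [← Finset.sum_add_distrib]
    refine Finset.sum_congr rfl fun i _ => Finset.sum_congr rfl fun j _ => ?_
    ring
  rw [h1, h3, ← h2]; ring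

lemma Dg_herm (W : Matrix V V ℝ) (hW : Good W) (η t : V → ℝ) : (Dg W η t).IsHermitian := by
  ext i j
  simp only [Dg, conjTranspose_apply, Matrix.sub_apply, diagonal_apply, of_apply, star_trivial]
  rw [hW.symm j i, add_comm (t j)]
  by_cases h : i = j
  · subst h; rfl
  · rw [if_neg h, if_neg (Ne.symm h)]

lemma Dg_posDef (W : Matrix V V ℝ) (hW : Good W) (η t : V → ℝ) (hη : ∀ i, 0 < η i) : (Dg W η t).PosDef := by
  refine PosDef.of_dotProduct_mulVec_pos (Dg_herm W hW η t) fun v hv => ?_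
  rw [star_trivial, quad_Dg W hW]
  have h1 : 0 ≤ ∑ i, ∑ j, W i j * Real.exp (t i + t j) * (v i - v j)^2 :=
    Finset.sum_nonneg fun i _ => Finset.sum_nonneg fun j _ => by
      have := hW.nonneg i j; positivity
  have h2 : 0 < ∑ i, η i * Real.exp (t i) * v i ^ 2 := by
    obtain ⟨i, hi⟩ := Function.ne_iff.1 hv
    refine Finset.sum_pos' (fun i _ => ?_) ⟨i, Finset.mem_univ i, ?_⟩
    · have := hη i; positivity
    · have := hη i; have : v i ≠ 0 := hi; positivity
  linarith

lemma Hm_bmap (W : Matrix V V ℝ) (η t : V → ℝ) :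
    Hm W (bmap W η t) = diagonal (fun i => Real.exp (-t i)) * Dg W η t * diagonal (fun i => Real.exp (-t i)) := by
  ext i j
  simp only [Hm, Dg, mul_diagonal, diagonal_mul, Matrix.sub_apply, diagonal_apply, of_apply]
  have hw : Real.exp (-t i) * (W i j * Real.exp (t i + t j)) * Real.exp (-t j) = W i j := by
    rw [show Real.exp (-t i) * (W i j * Real.exp (t i + t j)) * Real.exp (-t j) = W i j * (Real.exp (-t i) * Real.exp (t i + t j) * Real.exp (-t j)) by ring, ← Real.exp_add, ← Real.exp_add]
    ring_nf; simp
  by_cases h : i = j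
  · subst h
    simp only [if_true, mul_sub, sub_mul, hw, bmap]
    congr 1
    rw [mul_add, add_mul, Finset.mul_sum, Finset.sum_mul]
    congr 1
    · refine Finset.sum_congr rfl fun k _ => ?_
      rw [show Real.exp (-t i) * (W i k * Real.exp (t i + t k)) * Real.exp (-t i) = W i k * (Real.exp (-t i) * Real.exp (t i + t k) * Real.exp (-t i)) by ring, ← Real.exp_add, ← Real.exp_add]
      ring_nf
    · rw [show Real.exp (-t i) * (η i * Real.exp (t i)) * Real.exp (-t i) = η i * (Real.exp (-t i) * Real.exp (t i) * Real.exp (-t i)) by ring, ← Real.exp_add, ← Real.exp_add]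
      ring_nf
  · simp only [if_neg h, mul_sub, sub_mul, hw]; ring

lemma Hm_bmap_posDef (W : Matrix V V ℝ) (hW : Good W) (η t : V → ℝ) (hη : ∀ i, 0 < η i) :
    (Hm W (bmap W η t)).PosDef := by
  rw [Hm_bmap]
  have hU : IsUnit (diagonal (fun i => Real.exp (-t i))) := by
    rw [isUnit_diagonal]
    exact Pi.isUnit_iff.2 fun i => (Real.exp_pos _).ne'.isUnit
  have := (IsUnit.posDef_star_right_conjugate_iff (x := Dg W η t) hU).2 (Dg_posDef W hW η t hη)
  rwa [star_eq_conjTranspose, diagonal_conjTranspose, star_trivial] at this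

lemma Hm_bmap_mulVec (W : Matrix V V ℝ) (η t : V → ℝ) :
    Hm W (bmap W η t) *ᵥ (fun i => Real.exp (t i)) = η := by
  ext i
  simp only [Hm, sub_mulVec, Pi.sub_apply, mulVec_diagonal, bmap]
  simp only [mulVec, dotProduct, add_mul, Finset.sum_mul]
  have : ∀ j, W i j * Real.exp (t j - t i) * Real.exp (t i) = W i j * Real.exp (t j) := fun j => by
    rw [mul_assoc, ← Real.exp_add]; ring_nf
  simp_rw [this]
  rw [mul_assoc, ← Real.exp_add]; simp

lemma bmap_inj (W : Matrix V V ℝ) (hW : Good W) (η : V → ℝ) (hη : ∀ i, 0 < η i) : Function.Injective (bmap W η) := by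
  intro t t' h
  have h1 := Hm_bmap_mulVec W η t
  have h2 := Hm_bmap_mulVec W η t'
  rw [← h] at h2
  have := mulVec_injective_of_isUnit (Hm_bmap_posDef W hW η t hη).isUnit (h1.trans h2.symm)
  ext i
  exact Real.exp_injective (congrFun this i)

lemma bmap_range (W : Matrix V V ℝ) (hW : Good W) (η : V → ℝ) (hη : ∀ i, 0 < η i) :
    bmap W η '' Set.univ = {b | (Hm W b).PosDef} := by
  ext b
  simp only [Set.image_univ, Set.mem_range, Set.mem_ofPred_eq]
  constructor
  · rintro ⟨t, rfl⟩; exact Hm_bmap_posDef W hW η t hη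
  · intro hb
    set u := (Hm W b)⁻¹ *ᵥ η with hu
    have hHu : Hm W b *ᵥ u = η := by
      rw [hu, mulVec_mulVec, mul_nonsing_inv _ ((isUnit_iff_isUnit_det _).1 hb.isUnit), one_mulVec]
    have hpos := mmatrix (Hm W b) hb (fun i j hij => by
      simp only [Hm, Matrix.sub_apply, diagonal_apply, if_neg hij]; linarith [hW.nonneg i j]) η u hη hHu
    refine ⟨fun i => Real.log (u i), ?_⟩
    ext i
    have h1 := congrFun hHu i
    simp only [Hm, sub_mulVec, Pi.sub_apply, mulVec_diagonal] at h1
    simp only [mulVec, dotProduct] at h1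
    simp only [bmap, Real.exp_sub, Real.exp_neg, Real.exp_log (hpos _)]
    have h2 : ∑ j, W i j * (u j / u i) = (∑ j, W i j * u j) / u i := by
      rw [Finset.sum_div]; exact Finset.sum_congr rfl fun j _ => by ring
    have := hpos i
    rw [h2, ← h1]; field_simp; ring

lemma Dg_cont (W : Matrix V V ℝ) (η : V → ℝ) : Continuous (Dg W η) := by
  refine continuous_matrix fun i j => ?_
  simp only [Dg, Matrix.sub_apply, diagonal_apply, of_apply]
  split_ifs <;> fun_prop

lemma bmap_cont (W : Matrix V V ℝ) (η : V → ℝ) : Continuous (bmap W η) := by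
  unfold bmap; fun_prop

lemma Hm_cont (W : Matrix V V ℝ) : Continuous (Hm W) := by
  unfold Hm; fun_prop

lemma measurableSet_posDef (W : Matrix V V ℝ) (hW : Good W) : MeasurableSet {b | (Hm W b).PosDef} := by
  rw [← bmap_range W hW (fun _ => 1) (fun _ => one_pos)]
  exact MeasurableSet.univ.image_of_continuousOn_injOn (bmap_cont W _).continuousOn (bmap_inj W hW _ (fun _ => one_pos)).injOn

end H22

end PartB

section PartC
open Matrix

namespace H22

def Jf {V : Type*} [Fintype V] [DecidableEq V] (W : Matrix V V ℝ) (η b : V → ℝ) : ENNReal :=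
  Set.indicator {b | (Hm W b).PosDef} (fun b => ENNReal.ofReal
    (Real.exp (-(1/2) * (∑ i, ∑ j, Hm W b i j) - (1/2) * (η ⬝ᵥ ((Hm W b)⁻¹ *ᵥ η)) + ∑ i, η i) / Real.sqrt (Hm W b).det)) b

lemma inv_apply_meas {V : Type*} [Fintype V] [DecidableEq V] {X : Type*} [MeasurableSpace X] [TopologicalSpace X] [OpensMeasurableSpace X]
    (M : X → Matrix V V ℝ) (hM : Continuous M) (i j : V) : Measurable fun x => (M x)⁻¹ i j := by
  have h1 : Continuous fun x => (M x).det := hM.matrix_det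
  have h2 : Continuous fun x => (M x).adjugate i j := (hM.matrix_adjugate).matrix_elem i j
  have : (fun x => (M x)⁻¹ i j) = fun x => ((M x).det)⁻¹ * (M x).adjugate i j := by
    ext x; rw [Matrix.inv_def, Ring.inverse_eq_inv', Matrix.smul_apply, smul_eq_mul]
  rw [this]
  exact h1.measurable.inv.mul h2.measurable

lemma Jf_meas {V : Type*} [Fintype V] [DecidableEq V] (W : Matrix V V ℝ) (hW : Good W) (η : V → ℝ) : Measurable (Jf W η) := by
  unfold Jf
  refine Measurable.indicator ?_ (measurableSet_posDef W hW)
  have h1 : Measurable fun b => (Hm W b).det := (Hm_cont W).matrix_det.measurable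
  have h2 : ∀ i j, Measurable fun b => Hm W b i j := fun i j => ((Hm_cont W).matrix_elem i j).measurable
  have h3 := inv_apply_meas _ (Hm_cont W)
  have h4 : Measurable fun b => η ⬝ᵥ ((Hm W b)⁻¹ *ᵥ η) := by
    simp only [dotProduct, mulVec]
    exact Finset.measurable_sum _ fun i _ => measurable_const.mul
      (Finset.measurable_sum _ fun j _ => (h3 i j).mul measurable_const)
  have h5 : Measurable fun b => ∑ i, ∑ j, Hm W b i j :=
    Finset.measurable_sum _ fun i _ => Finset.measurable_sum _ fun j _ => h2 i j
  exact ((((h5.const_mul _).sub (h4.const_mul _)).add_const _).exp.div h1.sqrt).ennreal_ofReal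

def JP (V : Type) [Fintype V] [DecidableEq V] : Prop :=
  ∀ (W : Matrix V V ℝ) (η : V → ℝ), Good W → (∀ i, 0 < η i) →
    ∫⁻ b, Jf W η b = ENNReal.ofReal (Real.sqrt (2 * Real.pi) ^ Fintype.card V)

lemma JP_transfer {V V' : Type} [Fintype V] [DecidableEq V] [Fintype V'] [DecidableEq V'] (e : V ≃ V') (h : JP V) : JP V' := by
  intro W η hW hη
  have h1 := h (W.submatrix e e) (η ∘ e) ⟨fun i j => hW.symm _ _, fun i j => hW.nonneg _ _, fun i => hW.diag _⟩ (fun i => hη _)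
  rw [← Fintype.card_congr e, ← h1]
  have mp := volume_measurePreserving_piCongrLeft (fun _ : V => ℝ) e.symm
  rw [← mp.lintegral_comp_emb (MeasurableEquiv.measurableEmbedding _)]
  refine lintegral_congr fun b => ?_
  have hb : (MeasurableEquiv.piCongrLeft (fun _ : V => ℝ) e.symm) b = b ∘ e := by
    ext i
    have := MeasurableEquiv.piCongrLeft_apply_apply (β := fun _ : V => ℝ) e.symm b (e i)
    simpa using this
  rw [hb]
  have hH : Hm (W.submatrix e e) (b ∘ e) = (Hm W b).submatrix e e := by
    ext i j; simp [Hm, diagonal_apply]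
  have hpd : (Hm (W.submatrix e e) (b ∘ e)).PosDef ↔ (Hm W b).PosDef := by
    rw [hH]
    constructor
    · intro h
      have := h.submatrix e.symm.injective
      simpa using this
    · intro h; exact h.submatrix e.injective
  have hinv : (η ∘ e) ⬝ᵥ ((Hm (W.submatrix e e) (b ∘ e))⁻¹ *ᵥ (η ∘ e)) = η ⬝ᵥ ((Hm W b)⁻¹ *ᵥ η) := by
    rw [hH, inv_submatrix_equiv, submatrix_mulVec_equiv]
    simp only [Function.comp_assoc, Equiv.self_comp_symm, Function.comp_id]
    exact comp_equiv_dotProduct_comp_equiv _ _ e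
  have hsum : ∑ i, ∑ j, Hm (W.submatrix e e) (b ∘ e) i j = ∑ i, ∑ j, Hm W b i j := by
    rw [hH]; simp only [submatrix_apply]
    rw [e.sum_comp (fun i => ∑ j, Hm W b i (e j))]
    exact Finset.sum_congr rfl fun i _ => e.sum_comp (fun j => Hm W b i j)
  have hs : ∑ i, (η ∘ e) i = ∑ i, η i := e.sum_comp η
  have hdet : (Hm (W.submatrix e e) (b ∘ e)).det = (Hm W b).det := by
    rw [hH, det_submatrix_equiv_self]
  unfold Jf
  by_cases hp : (Hm W b).PosDef
  · rw [Set.indicator_of_mem (show b ∈ {b | (Hm W b).PosDef} from hp), Set.indicator_of_mem (show b ∘ e ∈ {b | (Hm (W.submatrix e e) b).PosDef} from hpd.2 hp), hinv, hsum, hs, hdet]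
  · rw [Set.indicator_of_notMem (show b ∉ {b | (Hm W b).PosDef} from hp), Set.indicator_of_notMem (show b ∘ e ∉ {b | (Hm (W.submatrix e e) b).PosDef} from fun h => hp (hpd.1 h))]

lemma lintegral_split {α : Type} [Fintype α] (f : (Unit ⊕ α → ℝ) → ENNReal) (hf : Measurable f) :
    ∫⁻ b, f b = ∫⁻ b' : α → ℝ, ∫⁻ c : ℝ, f (Sum.elim (fun _ => c) b') := by
  have mp := volume_measurePreserving_sumPiEquivProdPi_symm (fun _ : Unit ⊕ α => ℝ)
  rw [← mp.lintegral_comp_emb (MeasurableEquiv.measurableEmbedding _)]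
  have hm : Measurable fun p : (Unit → ℝ) × (α → ℝ) => f ((MeasurableEquiv.sumPiEquivProdPi (fun _ : Unit ⊕ α => ℝ)).symm p) :=
    hf.comp (MeasurableEquiv.measurable _)
  rw [show (volume : Measure ((Unit → ℝ) × (α → ℝ))) = volume.prod volume from rfl, lintegral_prod_symm _ hm.aemeasurable]
  refine lintegral_congr fun b' => ?_
  have mp2 := (volume_preserving_funUnique Unit ℝ).symm
  rw [← mp2.lintegral_comp_emb (MeasurableEquiv.measurableEmbedding _)]
  refine lintegral_congr fun c => ?_
  congr 1

end H22

end PartC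

section PartD
open Matrix

namespace H22
variable {α : Type} [Fintype α] [DecidableEq α]

lemma Hm_block (W : Matrix (Unit ⊕ α) (Unit ⊕ α) ℝ) (hW : Good W) (b0 : ℝ) (b' : α → ℝ) :
    Hm W (Sum.elim (fun _ => b0) b') = fromBlocks (of fun _ _ => b0) (of fun _ j => - W (.inl ()) (.inr j))
      (of fun (_ : Unit) j => - W (.inl ()) (.inr j))ᴴ (Hm (W.submatrix Sum.inr Sum.inr) b') := by
  ext i j
  rcases i with i | i <;> rcases j with j | j
  · simp [Hm, hW.diag]
  · simp [Hm]
  · simp [Hm, hW.symm (.inr i)]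
  · simp [Hm, diagonal_apply]

lemma schur_entry (b0 : ℝ) (w : α → ℝ) (H : Matrix α α ℝ) :
    ((of fun _ _ => b0 : Matrix Unit Unit ℝ) - (of fun (_ : Unit) j => - w j) * H⁻¹ * (of fun (_ : Unit) j => - w j)ᴴ)
      = of fun _ _ => b0 - w ⬝ᵥ (H⁻¹ *ᵥ w) := by
  ext i j
  simp only [Matrix.sub_apply, of_apply, Matrix.mul_assoc]
  congr 1
  simp only [Matrix.mul_apply, dotProduct, mulVec, of_apply, conjTranspose_apply, star_trivial]
  refine Finset.sum_congr rfl fun i _ => ?_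
  simp

lemma block_posDef (b0 : ℝ) (w : α → ℝ) (H : Matrix α α ℝ) (hH : H.PosDef) :
    (fromBlocks (of fun _ _ => b0 : Matrix Unit Unit ℝ) (of fun _ j => - w j) (of fun (_ : Unit) j => - w j)ᴴ H).PosDef
      ↔ 0 < b0 - w ⬝ᵥ (H⁻¹ *ᵥ w) := by
  have := hH.isUnit.invertible
  have key := fun x y => schur_complement_eq₂₂ (of fun _ _ => b0 : Matrix Unit Unit ℝ) (of fun _ j => - w j) (D := H) x y hH.1
  simp only [schur_entry, star_trivial] at key
  constructor
  · intro h
    have h1 := key (fun _ => 1) (-((H⁻¹ * (of fun (_ : Unit) j => - w j)ᴴ) *ᵥ (fun _ => 1)))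
    have h2 := h.dotProduct_mulVec_pos (x := Sum.elim (fun _ => 1) (-((H⁻¹ * (of fun (_ : Unit) j => - w j)ᴴ) *ᵥ (fun _ => 1)))) (by
      intro h; have := congrFun h (.inl ()); simp at this)
    rw [star_trivial, dotProduct_mulVec, h1] at h2
    simpa [vecMul, dotProduct] using h2
  · intro hc
    refine PosDef.of_dotProduct_mulVec_pos ((IsHermitian.fromBlocks₂₂ _ _ hH.1).2 ?_) fun v hv => ?_
    · rw [schur_entry]; ext i j; simp
    rw [star_trivial, dotProduct_mulVec, ← Sum.elim_comp_inl_inr v, key]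
    set x := v ∘ Sum.inl
    set y := v ∘ Sum.inr
    have e1 : x ᵥ* (of fun _ _ => b0 - w ⬝ᵥ (H⁻¹ *ᵥ w)) ⬝ᵥ x = (b0 - w ⬝ᵥ (H⁻¹ *ᵥ w)) * x () ^ 2 := by
      simp [vecMul, dotProduct]; ring
    rw [e1, ← dotProduct_mulVec]
    have hps := fun z => hH.posSemidef.dotProduct_mulVec_nonneg z
    simp only [star_trivial] at hps
    by_cases hx : x () = 0
    · have hx' : x = 0 := by ext; exact hx
      have hy : y ≠ 0 := by
        intro hy; apply hv; ext i; rcases i with i | i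
        · exact congrFun hx' i
        · exact congrFun hy i
      have := hH.dotProduct_mulVec_pos hy
      simp only [star_trivial] at this
      rw [hx', mulVec_zero, zero_add]; simpa using this
    · have : 0 < (b0 - w ⬝ᵥ (H⁻¹ *ᵥ w)) * x () ^ 2 := by positivity
      have := hps ((H⁻¹ * (of fun (_ : Unit) j => - w j)ᴴ) *ᵥ x + y)
      linarith

lemma block_det (b0 : ℝ) (w : α → ℝ) (H : Matrix α α ℝ) (hH : H.PosDef) :
    (fromBlocks (of fun _ _ => b0 : Matrix Unit Unit ℝ) (of fun _ j => - w j) (of fun (_ : Unit) j => - w j)ᴴ H).det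
      = H.det * (b0 - w ⬝ᵥ (H⁻¹ *ᵥ w)) := by
  have := hH.isUnit.invertible
  rw [det_fromBlocks₂₂, invOf_eq_nonsing_inv, schur_entry]
  simp

lemma symm_inv (H : Matrix α α ℝ) (hH : H.PosDef) (u v : α → ℝ) : u ⬝ᵥ (H⁻¹ *ᵥ v) = v ⬝ᵥ (H⁻¹ *ᵥ u) := by
  have h : (H⁻¹)ᵀ = H⁻¹ := by
    have := hH.inv.1
    rwa [IsHermitian, conjTranspose_eq_transpose_of_trivial] at this
  rw [dotProduct_mulVec, ← mulVec_transpose, h, dotProduct_comm]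

lemma block_inv (b0 : ℝ) (w : α → ℝ) (H : Matrix α α ℝ) (hH : H.PosDef) (hc : 0 < b0 - w ⬝ᵥ (H⁻¹ *ᵥ w))
    (η : Unit ⊕ α → ℝ) :
    η ⬝ᵥ ((fromBlocks (of fun _ _ => b0 : Matrix Unit Unit ℝ) (of fun _ j => - w j) (of fun (_ : Unit) j => - w j)ᴴ H)⁻¹ *ᵥ η)
      = (η (.inl ()) + w ⬝ᵥ (H⁻¹ *ᵥ (η ∘ Sum.inr)))^2 / (b0 - w ⬝ᵥ (H⁻¹ *ᵥ w)) + (η ∘ Sum.inr) ⬝ᵥ (H⁻¹ *ᵥ (η ∘ Sum.inr)) := by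
  set M := fromBlocks (of fun _ _ => b0 : Matrix Unit Unit ℝ) (of fun _ j => - w j) (of fun (_ : Unit) j => - w j)ᴴ H with hM
  set c := b0 - w ⬝ᵥ (H⁻¹ *ᵥ w) with hcdef
  set η' := η ∘ Sum.inr with hη'
  set A := η (.inl ()) + w ⬝ᵥ (H⁻¹ *ᵥ η') with hA
  have hMpd : M.PosDef := (block_posDef b0 w H hH).2 hc
  have hHu : IsUnit H.det := (isUnit_iff_isUnit_det _).1 hH.isUnit
  set u : Unit ⊕ α → ℝ := Sum.elim (fun _ => A / c) (H⁻¹ *ᵥ η' + (A/c) • (H⁻¹ *ᵥ w)) with hu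
  have hMu : M *ᵥ u = η := by
    rw [hM, hu, fromBlocks_mulVec]
    ext i
    rcases i with i | i
    · simp only [Sum.elim_inl, Sum.elim_comp_inl, Sum.elim_comp_inr, Pi.add_apply]
      have e1 : ((of fun (_ : Unit) j => - w j) *ᵥ (H⁻¹ *ᵥ η' + (A/c) • (H⁻¹ *ᵥ w))) i = - (w ⬝ᵥ (H⁻¹ *ᵥ η') + (A/c) * (w ⬝ᵥ (H⁻¹ *ᵥ w))) := by
        have : ((of fun (_ : Unit) j => - w j) *ᵥ (H⁻¹ *ᵥ η' + (A/c) • (H⁻¹ *ᵥ w))) i = (-w) ⬝ᵥ (H⁻¹ *ᵥ η' + (A/c) • (H⁻¹ *ᵥ w)) := rfl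
        rw [this, neg_dotProduct, dotProduct_add, dotProduct_smul, smul_eq_mul]
      rw [e1]
      have e2 : ((of fun _ _ => b0 : Matrix Unit Unit ℝ) *ᵥ fun _ => A / c) i = b0 * (A/c) := by
        simp [mulVec, dotProduct]
      rw [e2]
      have e3 : b0 * (A/c) - (A/c) * (w ⬝ᵥ (H⁻¹ *ᵥ w)) = A := by
        rw [mul_comm, ← mul_sub, ← hcdef]; field_simp
      rcases i
      linarith
    · simp only [Sum.elim_inr, Sum.elim_comp_inl, Sum.elim_comp_inr, Pi.add_apply, mulVec_add, mulVec_smul, mulVec_mulVec, mul_nonsing_inv _ hHu, one_mulVec]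
      simp [mulVec, dotProduct, hη']
      ring
  have hinv : M⁻¹ *ᵥ η = u := by
    rw [← hMu, mulVec_mulVec, nonsing_inv_mul _ ((isUnit_iff_isUnit_det _).1 hMpd.isUnit), one_mulVec]
  rw [hinv, hu]
  have e1 : η ⬝ᵥ Sum.elim (fun _ => A / c) (H⁻¹ *ᵥ η' + (A/c) • (H⁻¹ *ᵥ w)) = η (.inl ()) * (A / c) + η' ⬝ᵥ (H⁻¹ *ᵥ η' + (A/c) • (H⁻¹ *ᵥ w)) := by
    simp [dotProduct, Fintype.sum_sum_type, hη']
  rw [e1, dotProduct_add, dotProduct_smul, symm_inv H hH η' w, smul_eq_mul]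
  have : η (.inl ()) = A - w ⬝ᵥ (H⁻¹ *ᵥ η') := by rw [hA]; ring
  rw [this]; ring

lemma JP_empty : JP Empty := by
  intro W η hW hη
  have h1 : ∀ b, Jf W η b = 1 := by
    intro b
    unfold Jf
    rw [Set.indicator_of_mem]
    · simp
    · exact PosDef.of_dotProduct_mulVec_pos (by ext i; exact i.elim) fun v hv => absurd (Subsingleton.elim v 0) hv
  simp only [h1, lintegral_const, one_mul, Fintype.card_empty, pow_zero, ENNReal.ofReal_one]
  rw [volume_pi, Measure.pi_univ]; simp

lemma JP_step (h : JP α) : JP (Unit ⊕ α) := by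
  intro W η hW hη
  rw [lintegral_split _ (Jf_meas W hW η)]
  set w : α → ℝ := fun j => W (.inl ()) (.inr j) with hw
  set W' : Matrix α α ℝ := W.submatrix Sum.inr Sum.inr with hW'
  set η' : α → ℝ := η ∘ Sum.inr with hη'
  have hWg : Good W' := ⟨fun i j => hW.symm _ _, fun i j => hW.nonneg _ _, fun i => hW.diag _⟩
  have h1 := h W' (η' + w) hWg (fun i => by
    have := hη (.inr i); have := hW.nonneg (.inl ()) (.inr i)
    simp only [Pi.add_apply, hη', hw, Function.comp]; linarith)
  have key : ∀ b' : α → ℝ, ∫⁻ c : ℝ, Jf W η (Sum.elim (fun _ => c) b') = ENNReal.ofReal (Real.sqrt (2 * Real.pi)) * Jf W' (η' + w) b' := by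
    intro b'
    by_cases hp : (Hm W' b').PosDef
    · set H := Hm W' b' with hH
      set q := w ⬝ᵥ (H⁻¹ *ᵥ w) with hq
      have hHu : IsUnit H.det := (isUnit_iff_isUnit_det _).1 hp.isUnit
      set A := η (.inl ()) + w ⬝ᵥ (H⁻¹ *ᵥ η') with hA
      have hApos : 0 < A := by
        have h2 := mmatrix H hp (fun i j hij => by
          simp only [hH, Hm, Matrix.sub_apply, diagonal_apply, if_neg hij]; linarith [hWg.nonneg i j]) η' (H⁻¹ *ᵥ η') (fun i => hη _) (by rw [mulVec_mulVec, mul_nonsing_inv _ hHu, one_mulVec])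
        have : 0 ≤ w ⬝ᵥ (H⁻¹ *ᵥ η') := Finset.sum_nonneg fun i _ => mul_nonneg (hW.nonneg _ _) (h2 i).le
        have := hη (.inl ())
        linarith
      rw [← lintegral_add_right_eq_self _ q]
      have hdet := hp.det_pos
      set S := -(1/2) * (∑ i, ∑ j, H i j) - (1/2) * ((η' + w) ⬝ᵥ (H⁻¹ *ᵥ (η' + w))) + ∑ i, (η' + w) i with hS
      have h3 : ∀ c, Jf W η (Sum.elim (fun _ => c + q) b') = Set.indicator (Set.Ioi 0) (fun c => ENNReal.ofReal (Real.exp (S + A) / Real.sqrt H.det) * ENNReal.ofReal (Real.exp (-(1/2) * c - (1/2) * (A^2 / c)) / Real.sqrt c)) c := by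
        intro c
        unfold Jf
        have hiff := block_posDef (c + q) w H hp
        have hcq : c + q - w ⬝ᵥ (H⁻¹ *ᵥ w) = c := by rw [← hq]; ring
        rw [hcq, hw, hH, ← Hm_block W hW] at hiff
        by_cases hc : 0 < c
        · rw [Set.indicator_of_mem (show c ∈ Set.Ioi 0 from hc), Set.indicator_of_mem (show Sum.elim (fun _ => c + q) b' ∈ {b | (Hm W b).PosDef} from hiff.2 hc), ← ENNReal.ofReal_mul (by positivity)]
          have hinv := block_inv (c + q) w H hp (by rw [hcq]; exact hc) η
          have hd := block_det (c + q) w H hp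
          rw [hcq, hw, hH, ← Hm_block W hW] at hinv hd
          rw [hinv, hd]
          have hsum : ∑ i, ∑ j, Hm W (Sum.elim (fun _ => c + q) b') i j = c + q - 2 * ∑ i, w i + ∑ i, ∑ j, H i j := by
            rw [Hm_block W hW]
            simp only [Fintype.sum_sum_type, fromBlocks_apply₁₁, fromBlocks_apply₁₂, fromBlocks_apply₂₁, fromBlocks_apply₂₂, of_apply, conjTranspose_apply, star_trivial, Finset.sum_add_distrib, Finset.univ_unique, Finset.sum_singleton, Finset.sum_neg_distrib, hw, hH, hW']
            ring
          rw [hsum]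
          have hquad : (η' + w) ⬝ᵥ (H⁻¹ *ᵥ (η' + w)) = η' ⬝ᵥ (H⁻¹ *ᵥ η') + 2 * (w ⬝ᵥ (H⁻¹ *ᵥ η')) + q := by
            rw [mulVec_add, dotProduct_add, add_dotProduct, add_dotProduct, symm_inv H hp η' w]; ring
          have hηs : ∑ i, η i = η (.inl ()) + ∑ i, η' i := by
            simp [Fintype.sum_sum_type, hη']
          congr 1
          rw [div_mul_div_comm, ← Real.exp_add, ← Real.sqrt_mul hdet.le]
          congr 2
          rw [hηs, hS, hquad]
          simp only [Pi.add_apply, Finset.sum_add_distrib]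
          rw [hA]
          ring
        · rw [Set.indicator_of_notMem (show c ∉ Set.Ioi 0 from hc), Set.indicator_of_notMem (show Sum.elim (fun _ => c + q) b' ∉ {b | (Hm W b).PosDef} from fun h => hc (hiff.1 h))]
      simp_rw [h3]
      rw [lintegral_indicator measurableSet_Ioi, lintegral_const_mul' _ _ ENNReal.ofReal_ne_top, invGauss A hApos]
      unfold Jf
      rw [Set.indicator_of_mem (show b' ∈ {b | (Hm W' b).PosDef} from hp), ← ENNReal.ofReal_mul (by positivity), ← ENNReal.ofReal_mul (by positivity), ← hH, ← hS, Real.exp_add]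
      congr 1
      rw [Real.exp_neg]
      field_simp
    · have h0 : Jf W' (η' + w) b' = 0 := Set.indicator_of_notMem (show b' ∉ {b | (Hm W' b).PosDef} from hp) _
      rw [h0, mul_zero, lintegral_eq_zero_iff']
      · refine Filter.Eventually.of_forall fun c => Set.indicator_of_notMem (fun hc => hp ?_) _
        have hc' : (Hm W (Sum.elim (fun _ => c) b')).PosDef := hc
        rw [Hm_block W hW] at hc'
        exact hc'.submatrix Sum.inr_injective
      · refine ((Jf_meas W hW η).comp ?_).aemeasurable
        refine measurable_pi_lambda _ fun i => ?_
        rcases i with i | i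
        · exact measurable_id
        · exact measurable_const
  simp_rw [key]
  rw [lintegral_const_mul' _ _ ENNReal.ofReal_ne_top, h1, ← ENNReal.ofReal_mul (by positivity)]
  congr 1
  rw [Fintype.card_sum, Fintype.card_unit, pow_add, pow_one]

end H22

theorem H22.JP_all (V : Type) [Fintype V] [DecidableEq V] : H22.JP V := by
  have : ∀ (n : ℕ) (V : Type) [Fintype V] [DecidableEq V], Fintype.card V = n → H22.JP V := by
    intro n
    induction n with
    | zero =>
      intro V _ _ hV
      have := Fintype.card_eq_zero_iff.1 hV
      exact H22.JP_transfer (Equiv.equivOfIsEmpty Empty V) H22.JP_empty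
    | succ n ih =>
      intro V _ _ hV
      have e : Unit ⊕ Fin n ≃ V := Fintype.equivOfCardEq (by simp [hV, add_comm])
      exact H22.JP_transfer e (H22.JP_step (ih (Fin n) (by simp)))
  exact this _ V rfl

end PartD

section PartE
open Matrix
namespace H22

lemma bmap_hasFDerivAt {V : Type} [Fintype V] [DecidableEq V] (W : Matrix V V ℝ) (hW : Good W) (η t : V → ℝ) :
    HasFDerivAt (bmap W η) (LinearMap.toContinuousLinearMap
      (Matrix.toLin' (-(diagonal (fun i => Real.exp (-(2 * t i))) * Dg W η t)))) t := by
  rw [hasFDerivAt_pi']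
  intro i
  have hp : ∀ j : V, HasFDerivAt (fun t : V → ℝ => t j) (ContinuousLinearMap.proj (R := ℝ) (φ := fun _ : V => ℝ) j) t :=
    fun j => (ContinuousLinearMap.proj (R := ℝ) (φ := fun _ : V => ℝ) j).hasFDerivAt
  have h1 : HasFDerivAt (fun t : V → ℝ => (∑ j, W i j * Real.exp (t j - t i)) + η i * Real.exp (-t i)) _ t :=
    (HasFDerivAt.fun_sum (u := Finset.univ) fun j _ => ((((hp j).fun_sub (hp i)).exp).const_mul (W i j))).add
      (((hp i).fun_neg.exp).const_mul (η i))
  refine HasFDerivAt.congr_fderiv h1 ?_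
  ext v
  simp only [_root_.add_apply, _root_.sum_apply, _root_.smul_apply,
    _root_.sub_apply, _root_.neg_apply, ContinuousLinearMap.proj_apply, smul_eq_mul,
    ContinuousLinearMap.comp_apply, LinearMap.coe_toContinuousLinearMap', Matrix.toLin'_apply]
  have e1 : ∀ j, Real.exp (-(2 * t i)) * Real.exp (t i + t j) = Real.exp (t j - t i) := fun j => by
    rw [← Real.exp_add]; congr 1; ring
  have e2 : Real.exp (-(2 * t i)) * Real.exp (t i) = Real.exp (- t i) := by
    rw [← Real.exp_add]; congr 1; ring
  rw [Matrix.neg_mulVec, Pi.neg_apply, ← Matrix.mulVec_mulVec, Matrix.mulVec_diagonal]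
  simp only [Dg, Matrix.sub_mulVec, Pi.sub_apply, Matrix.mulVec_diagonal]
  simp only [mulVec, dotProduct, of_apply]
  rw [← e2]
  simp only [← e1]
  simp only [mul_sub, add_mul, mul_add, Finset.mul_sum, Finset.sum_mul, Finset.sum_sub_distrib]
  rw [show ∀ a b c d e : ℝ, -(a + b - c) = c - a - b from fun a b c d e => by ring]
  · congr 1
    · congr 1
      · refine Finset.sum_congr rfl fun j _ => by ring
      · refine Finset.sum_congr rfl fun j _ => by ring
    · ring
  all_goals exact 0

lemma t_integral {V : Type} [Fintype V] [DecidableEq V] (W : Matrix V V ℝ) (hW : Good W) (η : V → ℝ) (hη : ∀ i, 0 < η i) :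
    ∫⁻ t : V → ℝ, ENNReal.ofReal (Real.exp (-((1/2) * ∑ i, ∑ j, W i j * (Real.cosh (t i - t j) - 1)) - ∑ i, η i * (Real.cosh (t i) - 1)) *
      (∏ i, Real.exp (- t i)) * Real.sqrt (Dg W η t).det) = ENNReal.ofReal (Real.sqrt (2 * Real.pi) ^ Fintype.card V) := by
  have h0 := JP_all V W η hW hη
  have h1 : ∫⁻ b, Jf W η b = ∫⁻ b in bmap W η '' Set.univ, Jf W η b := by
    rw [bmap_range W hW η hη, ← lintegral_indicator (measurableSet_posDef W hW)]
    refine lintegral_congr fun b => ?_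
    unfold Jf
    rw [Set.indicator_indicator, Set.inter_self]
  rw [h1, lintegral_image_eq_lintegral_abs_det_fderiv_mul volume MeasurableSet.univ
    (fun t _ => (bmap_hasFDerivAt W hW η t).hasFDerivWithinAt) (bmap_inj W hW η hη).injOn, Measure.restrict_univ] at h0
  rw [← h0]
  refine lintegral_congr fun t => ?_
  have hpd := Hm_bmap_posDef W hW η t hη
  have hD := (Dg_posDef W hW η t hη).det_pos
  have hexp : (∏ i, Real.exp (-(2 * t i))) = (∏ i, Real.exp (- t i)) ^ 2 := by
    rw [← Finset.prod_pow]
    refine Finset.prod_congr rfl fun i _ => ?_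
    rw [← Real.exp_nat_mul]; congr 1; push_cast; ring
  have hdet : |(LinearMap.toContinuousLinearMap
      (Matrix.toLin' (-(diagonal (fun i => Real.exp (-(2 * t i))) * Dg W η t)))).det| = (∏ i, Real.exp (- t i)) ^ 2 * (Dg W η t).det := by
    rw [ContinuousLinearMap.det, LinearMap.coe_toContinuousLinearMap, LinearMap.det_toLin', Matrix.det_neg, abs_mul, abs_pow, abs_neg, abs_one, one_pow, one_mul,
      Matrix.det_mul, Matrix.det_diagonal, hexp, abs_of_pos]
    positivity
  have hdH : (Hm W (bmap W η t)).det = (∏ i, Real.exp (- t i)) ^ 2 * (Dg W η t).det := by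
    rw [Hm_bmap, Matrix.det_mul, Matrix.det_mul, Matrix.det_diagonal]; ring
  have hinv : (Hm W (bmap W η t))⁻¹ *ᵥ η = fun i => Real.exp (t i) := by
    have h := Hm_bmap_mulVec W η t
    have h' : (Hm W (bmap W η t))⁻¹ *ᵥ η = (Hm W (bmap W η t))⁻¹ *ᵥ (Hm W (bmap W η t) *ᵥ (fun i => Real.exp (t i))) := by rw [h]
    rw [h', Matrix.mulVec_mulVec, Matrix.nonsing_inv_mul _ hpd.det_pos.ne'.isUnit, Matrix.one_mulVec]
  rw [hdet, Jf, Set.indicator_of_mem (by exact hpd), hinv, hdH, ← ENNReal.ofReal_mul (by positivity)]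
  congr 1
  have hs : ∀ x : ℝ, 0 ≤ x → x * (1 / Real.sqrt x) = Real.sqrt x := fun x hx => by
    rw [mul_one_div, Real.div_sqrt]
  rw [div_eq_mul_one_div _ (Real.sqrt _), mul_left_comm, hs _ (by positivity), Real.sqrt_mul (by positivity), Real.sqrt_sq (by positivity), ← mul_assoc]
  congr 3
  have s1 : ∑ i, ∑ j, Hm W (bmap W η t) i j = (∑ i, ∑ j, W i j * (Real.cosh (t i - t j) - 1)) + ∑ i, η i * Real.exp (- t i) := by
    have a1 : ∀ i, ∑ j, Hm W (bmap W η t) i j = (∑ j, W i j * (Real.exp (t j - t i) - 1)) + η i * Real.exp (-t i) := fun i => by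
      simp only [Hm, Matrix.sub_apply, diagonal_apply, Finset.sum_sub_distrib, Finset.sum_ite_eq, Finset.mem_univ, if_true, bmap, mul_sub, mul_one]
      ring
    simp only [a1, Finset.sum_add_distrib]
    congr 1
    have a2 : ∑ i, ∑ j, W i j * (Real.exp (t j - t i) - 1) = ∑ i, ∑ j, W i j * (Real.exp (t i - t j) - 1) := by
      rw [Finset.sum_comm]
      refine Finset.sum_congr rfl fun i _ => Finset.sum_congr rfl fun j _ => ?_
      rw [hW.symm]
    have a3 : ∑ i, ∑ j, W i j * (Real.cosh (t i - t j) - 1) = (1/2) * (∑ i, ∑ j, W i j * (Real.exp (t i - t j) - 1)) + (1/2) * (∑ i, ∑ j, W i j * (Real.exp (t j - t i) - 1)) := by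
      simp only [Finset.mul_sum]
      simp only [← Finset.sum_add_distrib]
      refine Finset.sum_congr rfl fun i _ => Finset.sum_congr rfl fun j _ => ?_
      rw [Real.cosh_eq, neg_sub]; ring
    rw [a3, ← a2]; ring
  rw [s1]
  have s2 : ∑ i, η i * (Real.cosh (t i) - 1) = (1/2) * (∑ i, η i * Real.exp (- t i)) + (1/2) * (η ⬝ᵥ fun i => Real.exp (t i)) - ∑ i, η i := by
    simp only [dotProduct, Finset.mul_sum]
    simp only [← Finset.sum_add_distrib, ← Finset.sum_sub_distrib]
    refine Finset.sum_congr rfl fun i _ => ?_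
    rw [Real.cosh_eq]; ring
  rw [s2]; ring

end H22

end PartE

section PartF
open Matrix
namespace H22

def Bv {V : Type} (t s : V → ℝ) (x y : V) : ℝ :=
  Real.cosh (t x - t y) + (1 / 2) * (s x - s y) ^ 2 * Real.exp (t x + t y)

def zv {V : Type} (t s : V → ℝ) (k : V) : ℝ :=
  Real.cosh (t k) + (1 / 2) * (s k) ^ 2 * Real.exp (t k)

def dens {V : Type} [Fintype V] (W : Matrix V V ℝ) (η : V → ℝ) (p : (V → ℝ) × (V → ℝ)) : ℝ :=
  Real.exp (-((1/2) * ∑ i, ∑ j, W i j * (Bv p.1 p.2 i j - 1)) - ∑ k, η k * (zv p.1 p.2 k - 1)) *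
    (∏ k, Real.exp (-(p.1 k))) * ((2 * Real.pi)⁻¹) ^ (Fintype.card V)

lemma std_gauss {V : Type} [Fintype V] :
    ∫⁻ y : V → ℝ, ENNReal.ofReal (Real.exp (-(1/2) * (y ⬝ᵥ y))) = ENNReal.ofReal (Real.sqrt (2 * Real.pi) ^ Fintype.card V) := by
  have h1 : ∀ y : V → ℝ, Real.exp (-(1/2) * (y ⬝ᵥ y)) = ∏ i, Real.exp (-(1/2) * (y i)^2) := fun y => by
    rw [← Real.exp_sum, dotProduct, Finset.mul_sum]; congr 1
    exact Finset.sum_congr rfl fun i _ => by ring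
  have hint : Integrable (fun y : ℝ => Real.exp (-(1/2) * y^2)) := integrable_exp_neg_mul_sq (by norm_num)
  have hI : ∫ y : ℝ, Real.exp (-(1/2) * y^2) = Real.sqrt (2 * Real.pi) := by
    rw [integral_gaussian]; congr 1; ring
  simp only [h1]
  have hint2 : Integrable (fun y : V → ℝ => ∏ i, Real.exp (-(1/2) * (y i)^2)) := Integrable.fintype_prod fun _ => hint
  rw [← ofReal_integral_eq_lintegral_ofReal hint2
    (Filter.Eventually.of_forall fun y => Finset.prod_nonneg fun i _ => (Real.exp_pos _).le),
    integral_fintype_prod_volume_eq_pow (fun y : ℝ => Real.exp (-(1/2) * y^2)), hI]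

open scoped MatrixOrder in
lemma exists_sq {V : Type} [Fintype V] [DecidableEq V] (D : Matrix V V ℝ) (hD : D.PosDef) :
    ∃ B : Matrix V V ℝ, D = Bᵀ * B := by
  obtain ⟨B, hB⟩ := CStarAlgebra.nonneg_iff_eq_star_mul_self.mp hD.posSemidef.nonneg
  exact ⟨B, by rw [hB, star_eq_conjTranspose, conjTranspose_eq_transpose_of_trivial]⟩

lemma gauss {V : Type} [Fintype V] [DecidableEq V] (D : Matrix V V ℝ) (hD : D.PosDef) :
    ∫⁻ s : V → ℝ, ENNReal.ofReal (Real.exp (-(1/2) * (s ⬝ᵥ (D *ᵥ s)))) =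
      ENNReal.ofReal (Real.sqrt (2 * Real.pi) ^ Fintype.card V / Real.sqrt D.det) := by
  obtain ⟨B, hB⟩ := exists_sq D hD
  have hdet : D.det = B.det ^ 2 := by rw [hB, det_mul, det_transpose]; ring
  have hd : B.det ≠ 0 := by
    intro h; have := hD.det_pos; rw [hdet, h] at this; norm_num at this
  have h1 : ∀ s : V → ℝ, s ⬝ᵥ (D *ᵥ s) = (toLin' B s) ⬝ᵥ (toLin' B s) := fun s => by
    rw [hB, toLin'_apply, ← mulVec_mulVec, dotProduct_mulVec, vecMul_transpose]
  simp only [h1]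
  have hm : Measurable fun y : V → ℝ => ENNReal.ofReal (Real.exp (-(1/2) * (y ⬝ᵥ y))) := by
    refine ENNReal.measurable_ofReal.comp (Real.measurable_exp.comp ?_)
    simp only [dotProduct]; fun_prop
  have hl : Measurable (toLin' B) := (LinearMap.continuous_of_finiteDimensional (toLin' B)).measurable
  rw [← lintegral_map (f := fun y : V → ℝ => ENNReal.ofReal (Real.exp (-(1/2) * (y ⬝ᵥ y)))) hm hl,
    Real.map_matrix_volume_pi_eq_smul_volume_pi hd, lintegral_smul_measure, std_gauss, smul_eq_mul, ← ENNReal.ofReal_mul (abs_nonneg _)]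
  congr 1
  rw [hdet, Real.sqrt_sq_eq_abs, abs_inv]; ring

lemma dens_cont {V : Type} [Fintype V] (W : Matrix V V ℝ) (η : V → ℝ) : Continuous (dens W η) := by
  unfold dens Bv zv
  refine Continuous.mul (Continuous.mul ?_ ?_) continuous_const
  · refine Real.continuous_exp.comp ?_
    refine Continuous.sub ?_ ?_
    · refine Continuous.neg (continuous_const.mul ?_)
      refine continuous_finsetSum _ fun i _ => continuous_finsetSum _ fun j _ => ?_
      refine continuous_const.mul ?_
      fun_prop
    · fun_prop
  · fun_prop

lemma dens_pos {V : Type} [Fintype V] (W : Matrix V V ℝ) (η : V → ℝ) (p) : 0 < dens W η p := by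
  unfold dens
  have : 0 < ∏ k, Real.exp (-(p.1 k)) := Finset.prod_pos fun _ _ => Real.exp_pos _
  positivity

lemma dens_eq {V : Type} [Fintype V] [DecidableEq V] (W : Matrix V V ℝ) (hW : Good W) (η : V → ℝ) (t s : V → ℝ) :
    dens W η (t, s) = (Real.exp (-((1/2) * ∑ i, ∑ j, W i j * (Real.cosh (t i - t j) - 1)) - ∑ i, η i * (Real.cosh (t i) - 1)) *
      (∏ i, Real.exp (- t i)) * ((2 * Real.pi)⁻¹) ^ (Fintype.card V)) * Real.exp (-(1/2) * (s ⬝ᵥ (Dg W η t *ᵥ s))) := by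
  rw [quad_Dg W hW]
  unfold dens
  have h : -((1/2) * ∑ i, ∑ j, W i j * (Bv t s i j - 1)) - ∑ k, η k * (zv t s k - 1) =
     (-((1/2) * ∑ i, ∑ j, W i j * (Real.cosh (t i - t j) - 1)) - ∑ i, η i * (Real.cosh (t i) - 1)) +
      (-(1/2) * ((1/2) * ∑ i, ∑ j, W i j * Real.exp (t i + t j) * (s i - s j)^2
      + ∑ i, η i * Real.exp (t i) * s i ^ 2)) := by
    have a1 : ∑ i, ∑ j, W i j * (Bv t s i j - 1) = ∑ i, ∑ j, W i j * (Real.cosh (t i - t j) - 1) + (1/2) * ∑ i, ∑ j, W i j * Real.exp (t i + t j) * (s i - s j)^2 := by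
      simp only [Finset.mul_sum]
      simp only [← Finset.sum_add_distrib]
      refine Finset.sum_congr rfl fun i _ => Finset.sum_congr rfl fun j _ => ?_
      unfold Bv; ring
    have a2 : ∑ k, η k * (zv t s k - 1) = ∑ i, η i * (Real.cosh (t i) - 1) + (1/2) * ∑ i, η i * Real.exp (t i) * s i ^ 2 := by
      simp only [Finset.mul_sum]
      simp only [← Finset.sum_add_distrib]
      refine Finset.sum_congr rfl fun i _ => ?_
      unfold zv; ring
    rw [a1, a2]; ring
  dsimp only
  rw [h, Real.exp_add]; ring

lemma Dg_cont' {V : Type} [Fintype V] [DecidableEq V] (W : Matrix V V ℝ) (η : V → ℝ) :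
    Continuous fun p : (V → ℝ) × (V → ℝ) => Dg W η p.1 := (Dg_cont W η).comp continuous_fst

theorem Z_one {V : Type} [Fintype V] [DecidableEq V] (W : Matrix V V ℝ) (hW : Good W) (η : V → ℝ) (hη : ∀ i, 0 < η i) :
    ∫⁻ p : (V → ℝ) × (V → ℝ), ENNReal.ofReal ((Dg W η p.1).det * dens W η p) = 1 := by
  have hmeas : Measurable fun p : (V → ℝ) × (V → ℝ) => ENNReal.ofReal ((Dg W η p.1).det * dens W η p) :=
    ENNReal.measurable_ofReal.comp ((Dg_cont' W η).matrix_det.mul (dens_cont W η)).measurable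
  rw [Measure.volume_eq_prod, lintegral_prod _ hmeas.aemeasurable]
  have h1 : ∀ t : V → ℝ, ∫⁻ s : V → ℝ, ENNReal.ofReal ((Dg W η t).det * dens W η (t, s)) =
      ENNReal.ofReal (((2 * Real.pi)⁻¹) ^ (Fintype.card V) * Real.sqrt (2 * Real.pi) ^ Fintype.card V) * 
      ENNReal.ofReal (Real.exp (-((1/2) * ∑ i, ∑ j, W i j * (Real.cosh (t i - t j) - 1)) - ∑ i, η i * (Real.cosh (t i) - 1)) *
      (∏ i, Real.exp (- t i)) * Real.sqrt (Dg W η t).det) := fun t => by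
    have hpd := Dg_posDef W hW η t hη
    have hD := hpd.det_pos
    have hp : 0 ≤ ∏ k, Real.exp (-(t k)) := Finset.prod_nonneg fun _ _ => (Real.exp_pos _).le
    simp only [dens_eq W hW]
    simp only [← mul_assoc]
    have hnn : 0 ≤ (Dg W η t).det * Real.exp (-((1/2) * ∑ i, ∑ j, W i j * (Real.cosh (t i - t j) - 1)) - ∑ i, η i * (Real.cosh (t i) - 1)) *
      (∏ i, Real.exp (- t i)) * ((2 * Real.pi)⁻¹) ^ (Fintype.card V) := by positivity
    have hstep : ∀ s : V → ℝ, ENNReal.ofReal ((Dg W η t).det * Real.exp (-((1/2) * ∑ i, ∑ j, W i j * (Real.cosh (t i - t j) - 1)) - ∑ i, η i * (Real.cosh (t i) - 1)) *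
      (∏ i, Real.exp (- t i)) * ((2 * Real.pi)⁻¹) ^ (Fintype.card V) * Real.exp (-(1/2) * (s ⬝ᵥ (Dg W η t *ᵥ s)))) = 
      ENNReal.ofReal ((Dg W η t).det * Real.exp (-((1/2) * ∑ i, ∑ j, W i j * (Real.cosh (t i - t j) - 1)) - ∑ i, η i * (Real.cosh (t i) - 1)) *
      (∏ i, Real.exp (- t i)) * ((2 * Real.pi)⁻¹) ^ (Fintype.card V)) * ENNReal.ofReal (Real.exp (-(1/2) * (s ⬝ᵥ (Dg W η t *ᵥ s)))) := fun s =>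
        ENNReal.ofReal_mul hnn
    refine (lintegral_congr hstep).trans ?_
    rw [lintegral_const_mul' _ _ ENNReal.ofReal_ne_top, gauss _ hpd, ← ENNReal.ofReal_mul hnn, ← ENNReal.ofReal_mul (by positivity)]
    congr 1
    have hsq : (Dg W η t).det * (1 / Real.sqrt (Dg W η t).det) = Real.sqrt (Dg W η t).det := by rw [mul_one_div, Real.div_sqrt]
    rw [div_eq_mul_inv _ (Real.sqrt (Dg W η t).det)]; rw [mul_one_div, div_eq_mul_inv] at hsq
    generalize (Real.sqrt (Dg W η t).det)⁻¹ = u at hsq ⊢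
    rw [← hsq]; ring
  simp only [h1]
  rw [lintegral_const_mul' _ _ ENNReal.ofReal_ne_top, t_integral W hW η hη, ← ENNReal.ofReal_mul (by positivity), ← ENNReal.ofReal_one]
  congr 1
  rw [mul_assoc, ← mul_pow, ← mul_pow, Real.mul_self_sqrt (by positivity), inv_mul_cancel₀ (by positivity), one_pow]

end H22

end PartF

section PartG
open Matrix
namespace H22

lemma gamma_mix (a B P0 P1 C : ℝ) (ha : 0 < a) (hB : 0 < B) (hC : 0 ≤ C) (hP : ∀ γ, 0 < γ → 0 ≤ P0 + γ * P1) :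
    ∫⁻ γ in Set.Ioi (0:ℝ), ENNReal.ofReal (γ ^ (a - 1) * Real.exp (-γ) / Real.Gamma a * (C * (P0 + γ * P1) * Real.exp (-(γ * (B - 1))))) =
      ENNReal.ofReal (C * B ^ (-a) * (P0 + (a / B) * P1)) := by
  have hG := Real.Gamma_pos_of_pos ha
  have i0 := Real.integral_rpow_mul_exp_neg_mul_Ioi ha hB
  have i1 := Real.integral_rpow_mul_exp_neg_mul_Ioi (a := a + 1) (by linarith) hB
  have j0 : Integrable (fun γ : ℝ => γ ^ (a - 1) * Real.exp (-(B * γ))) (volume.restrict (Set.Ioi 0)) :=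
    Integrable.of_integral_ne_zero (by rw [i0]; positivity)
  have j1 : Integrable (fun γ : ℝ => γ ^ (a + 1 - 1) * Real.exp (-(B * γ))) (volume.restrict (Set.Ioi 0)) :=
    Integrable.of_integral_ne_zero (by rw [i1]; have := Real.Gamma_pos_of_pos (show 0 < a + 1 by linarith); positivity)
  have e : ∀ γ ∈ Set.Ioi (0:ℝ), γ ^ (a - 1) * Real.exp (-γ) / Real.Gamma a * (C * (P0 + γ * P1) * Real.exp (-(γ * (B - 1)))) =
      (C * P0 / Real.Gamma a) * (γ ^ (a - 1) * Real.exp (-(B * γ))) + (C * P1 / Real.Gamma a) * (γ ^ (a + 1 - 1) * Real.exp (-(B * γ))) := fun γ hγ => by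
    have hγ' : 0 < γ := hγ
    have e1 : Real.exp (-(B * γ)) = Real.exp (-γ) * Real.exp (-(γ * (B - 1))) := by rw [← Real.exp_add]; congr 1; ring
    have e2 : γ ^ (a + 1 - 1) = γ ^ (a - 1) * γ := by
      rw [show a + 1 - 1 = (a - 1) + 1 by ring, Real.rpow_add_one hγ'.ne']
    rw [e1, e2]; ring
  rw [setLIntegral_congr_fun measurableSet_Ioi (fun γ hγ => by rw [e γ hγ])]
  rw [← ofReal_integral_eq_lintegral_ofReal ((j0.const_mul _).fun_add (j1.const_mul _))]
  · rw [integral_add (j0.const_mul _) (j1.const_mul _), integral_const_mul, integral_const_mul, i0, i1, Real.Gamma_add_one ha.ne']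
    congr 1
    rw [one_div, Real.inv_rpow hB.le, Real.inv_rpow hB.le, Real.rpow_add_one hB.ne', Real.rpow_neg hB.le]
    field_simp
  · refine (ae_restrict_iff' measurableSet_Ioi).2 (Filter.Eventually.of_forall fun γ hγ => ?_)
    simp only [Pi.zero_apply]
    rw [← e γ hγ]
    have hγ' : 0 < γ := hγ
    have := hP γ hγ'
    positivity

def dl {V : Type} [DecidableEq V] (x y : V) : V → ℝ := fun a => (if a = x then 1 else 0) - (if a = y then 1 else 0)

def Kp {V : Type} [DecidableEq V] (t : V → ℝ) (x y : V) : Matrix V V ℝ :=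
  Real.exp (t x + t y) • vecMulVec (dl x y) (dl x y)

def Ep {V : Type} [DecidableEq V] (x y : V) : Matrix V V ℝ :=
  Matrix.of fun i j => (if i = x ∧ j = y then 1 else 0) + (if i = y ∧ j = x then 1 else 0)

variable {V : Type} [Fintype V] [DecidableEq V]

lemma Kp_posSemidef (t : V → ℝ) (x y : V) : (Kp t x y).PosSemidef := by
  unfold Kp
  refine PosSemidef.smul ?_ (Real.exp_pos _).le
  have := posSemidef_vecMulVec_self_star (R := ℝ) (dl x y)
  rwa [star_trivial] at this

lemma one_le_Bv (t s : V → ℝ) (x y : V) : 1 ≤ Bv t s x y := by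
  unfold Bv
  have := Real.one_le_cosh (t x - t y)
  have : 0 ≤ (1 / 2) * (s x - s y) ^ 2 * Real.exp (t x + t y) := by positivity
  linarith

lemma Bv_pos (t s : V → ℝ) (x y : V) : 0 < Bv t s x y := lt_of_lt_of_le one_pos (one_le_Bv t s x y)

lemma Bv_cont (x y : V) : Continuous fun p : (V → ℝ) × (V → ℝ) => Bv p.1 p.2 x y := by
  unfold Bv; fun_prop

lemma Kp_cont (x y : V) : Continuous fun p : (V → ℝ) × (V → ℝ) => Kp p.1 x y := by
  unfold Kp
  have h : Continuous fun p : (V → ℝ) × (V → ℝ) => Real.exp (p.1 x + p.1 y) := by fun_prop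
  exact h.smul continuous_const

lemma good_add (W : Matrix V V ℝ) (hW : Good W) (x y : V) (hxy : x ≠ y) (γ : ℝ) (hγ : 0 ≤ γ) : Good (W + γ • Ep x y) where
  symm i j := by
    simp only [Matrix.add_apply, Matrix.smul_apply, Ep, of_apply, smul_eq_mul, hW.symm i j]
    rw [add_comm (if i = x ∧ j = y then (1:ℝ) else 0)]
    simp only [and_comm]
  nonneg i j := by
    simp only [Matrix.add_apply, Matrix.smul_apply, Ep, of_apply, smul_eq_mul]
    have := hW.nonneg i j
    split_ifs <;> simp <;> linarith
  diag i := by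
    simp only [Matrix.add_apply, Matrix.smul_apply, Ep, of_apply, smul_eq_mul, hW.diag]
    rw [if_neg, if_neg]
    · simp
    · rintro ⟨rfl, h⟩; exact hxy h.symm
    · rintro ⟨rfl, h⟩; exact hxy h

lemma Dg_add (W : Matrix V V ℝ) (η t : V → ℝ) (x y : V) (hxy : x ≠ y) (γ : ℝ) :
    Dg (W + γ • Ep x y) η t = Dg W η t + γ • Kp t x y := by
  ext i j
  have hs : ∑ k, (W + γ • Ep x y) i k * Real.exp (t i + t k) = ∑ k, W i k * Real.exp (t i + t k) + γ * ((if i = x then Real.exp (t x + t y) else 0) + (if i = y then Real.exp (t x + t y) else 0)) := by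
    simp only [Matrix.add_apply, Matrix.smul_apply, Ep, of_apply, smul_eq_mul, add_mul, Finset.sum_add_distrib, mul_add, mul_assoc]
    congr 1
    simp only [← Finset.mul_sum]
    congr 2
    · by_cases h : i = x
      · subst h; simp
      · simp [h]
    · by_cases h : i = y
      · subst h; simp [add_comm]
      · simp [h]
  simp only [Dg, Matrix.add_apply (Matrix.diagonal _ - _), Matrix.sub_apply, diagonal_apply, of_apply]
  rw [hs]
  clear hs
  simp only [Kp, dl, Matrix.add_apply, Matrix.smul_apply, vecMulVec_apply, Ep, smul_eq_mul, of_apply]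
  generalize ∑ k, W i k * Real.exp (t i + t k) = Q
  by_cases h1 : i = x <;> by_cases h2 : j = x <;> by_cases h3 : i = y <;> by_cases h4 : j = y <;> by_cases h5 : i = j <;>
    first
    | (exfalso; apply hxy; subst_vars; first | rfl | assumption)
    | (exfalso; subst_vars; simp_all; done)
    | (simp [*, Ne.symm hxy]; try subst_vars; try ring_nf; try simp [*])
  
lemma dens_add (W : Matrix V V ℝ) (η : V → ℝ) (p : (V → ℝ) × (V → ℝ)) (x y : V) (γ : ℝ) :
    dens (W + γ • Ep x y) η p = dens W η p * Real.exp (-(γ * (Bv p.1 p.2 x y - 1))) := by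
  have hsymm : Bv p.1 p.2 y x = Bv p.1 p.2 x y := by
    unfold Bv; rw [← neg_sub (p.1 x), Real.cosh_neg, add_comm (p.1 y)]; ring
  have hs : ∑ i, ∑ j, (W + γ • Ep x y) i j * (Bv p.1 p.2 i j - 1) = ∑ i, ∑ j, W i j * (Bv p.1 p.2 i j - 1) + 2 * (γ * (Bv p.1 p.2 x y - 1)) := by
    simp only [Matrix.add_apply, Matrix.smul_apply, Ep, of_apply, smul_eq_mul, add_mul, Finset.sum_add_distrib, mul_add, mul_assoc]
    congr 1
    simp only [← Finset.mul_sum, ite_and, ite_mul, one_mul, zero_mul, Finset.sum_ite_irrel, Finset.sum_const_zero, Finset.sum_ite_eq', Finset.sum_ite_eq, Finset.mem_univ, if_true, hsymm]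
    ring
  unfold dens
  rw [hs, show ∀ a b c : ℝ, -((1/2) * (a + 2 * b)) - c = (-((1/2) * a) - c) + -b from fun a b c => by ring, Real.exp_add]
  ring

lemma det_affine (M : Matrix V V ℝ) (hM : M.PosDef) (t : V → ℝ) (x y : V) :
    ∃ P0 P1 : ℝ, ∀ γ : ℝ, (M + γ • Kp t x y).det = P0 + γ * P1 := by
  refine ⟨M.det, M.det * (Real.exp (t x + t y) * ((replicateRow Unit (dl x y) * M⁻¹ * replicateCol Unit (dl x y)) () ())), fun γ => ?_⟩
  have : M + γ • Kp t x y = M + replicateCol Unit ((γ * Real.exp (t x + t y)) • dl x y) * replicateRow Unit (dl x y) := by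
    congr 1
    ext i j
    simp [Kp, vecMulVec_apply, Matrix.mul_apply]; ring
  rw [this, det_add_replicateCol_mul_replicateRow hM.det_pos.ne'.isUnit, det_unique (n := Unit)]
  simp only [Matrix.add_apply, Matrix.one_apply, if_true, replicateCol_smul, Matrix.mul_smul, Matrix.smul_apply, smul_eq_mul, PUnit.default_eq_unit]
  ring

end H22

end PartG

section PartH
open Matrix
namespace H22
variable {V : Type} [Fintype V] [DecidableEq V]

/-- `D + a ∑_{i ∈ S} B_i⁻¹ K_i`. -/
def MK {ι : Type} (W : Matrix V V ℝ) (η : V → ℝ) (x y : ι → V) (a : ℝ) (S : Finset ι) (p : (V → ℝ) × (V → ℝ)) : Matrix V V ℝ :=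
  Dg W η p.1 + ∑ i ∈ S, (a / Bv p.1 p.2 (x i) (y i)) • Kp p.1 (x i) (y i)

lemma sumK_posSemidef {ι : Type} (x y : ι → V) (a : ℝ) (ha : 0 ≤ a) (S : Finset ι) (p : (V → ℝ) × (V → ℝ)) :
    (∑ i ∈ S, (a / Bv p.1 p.2 (x i) (y i)) • Kp p.1 (x i) (y i)).PosSemidef := by
  induction S using Finset.induction_on with
  | empty => simpa using PosSemidef.zero
  | insert i S hi ih =>
    rw [Finset.sum_insert hi]
    refine PosSemidef.add ?_ ih
    have := Bv_pos p.1 p.2 (x i) (y i)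
    exact (Kp_posSemidef _ _ _).smul (by positivity)

lemma MK_posDef {ι : Type} (W : Matrix V V ℝ) (hW : Good W) (η : V → ℝ) (hη : ∀ i, 0 < η i) (x y : ι → V) (a : ℝ) (ha : 0 ≤ a) (S : Finset ι) (p : (V → ℝ) × (V → ℝ)) :
    (MK W η x y a S p).PosDef :=
  (Dg_posDef W hW η p.1 hη).add_posSemidef (sumK_posSemidef x y a ha S p)

lemma MK_cont {ι : Type} (W : Matrix V V ℝ) (η : V → ℝ) (x y : ι → V) (a : ℝ) (S : Finset ι) :
    Continuous (MK W η x y a S) := by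
  unfold MK
  refine (Dg_cont' W η).add (continuous_finsetSum _ fun i _ => ?_)
  have h : Continuous fun p : (V → ℝ) × (V → ℝ) => a / Bv p.1 p.2 (x i) (y i) :=
    continuous_const.div (Bv_cont _ _) fun p => (Bv_pos _ _ _ _).ne'
  exact h.smul (Kp_cont (x i) (y i))

lemma prodB_cont {ι : Type} (x y : ι → V) (m : ℝ) (S : Finset ι) :
    Continuous fun p : (V → ℝ) × (V → ℝ) => ∏ i ∈ S, Bv p.1 p.2 (x i) (y i) ^ m :=
  continuous_finsetProd _ fun i _ => (Bv_cont _ _).rpow_const fun p => Or.inl (Bv_pos _ _ _ _).ne'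

lemma prodB_pos {ι : Type} (x y : ι → V) (m : ℝ) (S : Finset ι) (p : (V → ℝ) × (V → ℝ)) :
    0 < ∏ i ∈ S, Bv p.1 p.2 (x i) (y i) ^ m :=
  Finset.prod_pos fun i _ => Real.rpow_pos_of_pos (Bv_pos _ _ _ _) _

lemma gamma_total (a : ℝ) (ha : 0 < a) :
    ∫⁻ γ in Set.Ioi (0:ℝ), ENNReal.ofReal (γ ^ (a - 1) * Real.exp (-γ) / Real.Gamma a) = 1 := by
  have := gamma_mix a 1 1 0 1 ha one_pos zero_le_one (fun γ _ => by simp)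
  simpa using this

theorem neg_case {ι : Type} (η : V → ℝ) (hη : ∀ i, 0 < η i) (x y : ι → V) (hxy : ∀ i, x i ≠ y i) (a : ℝ) (ha : 0 < a) (S : Finset ι) :
    ∀ (W : Matrix V V ℝ), Good W →
    ∫⁻ p : (V → ℝ) × (V → ℝ), ENNReal.ofReal ((∏ i ∈ S, Bv p.1 p.2 (x i) (y i) ^ (-a)) * (MK W η x y a S p).det * dens W η p) = 1 := by
  induction S using Finset.induction_on with
  | empty =>
    intro W hW
    simpa [MK] using Z_one W hW η hη
  | insert k S hk ih =>
    intro W hW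
    have hMKadd : ∀ γ p, MK (W + γ • Ep (x k) (y k)) η x y a S p = MK W η x y a S p + γ • Kp p.1 (x k) (y k) := fun γ p => by
      unfold MK; rw [Dg_add _ _ _ _ _ (hxy k)]; abel
    have h1 : ∀ γ ∈ Set.Ioi (0:ℝ), ENNReal.ofReal (γ ^ (a - 1) * Real.exp (-γ) / Real.Gamma a) =
        ∫⁻ p : (V → ℝ) × (V → ℝ), ENNReal.ofReal (γ ^ (a - 1) * Real.exp (-γ) / Real.Gamma a *
          ((∏ i ∈ S, Bv p.1 p.2 (x i) (y i) ^ (-a)) * dens W η p * (MK W η x y a S p + γ • Kp p.1 (x k) (y k)).det * Real.exp (-(γ * (Bv p.1 p.2 (x k) (y k) - 1))))) := fun γ hγ => by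
      have hγ' : 0 < γ := hγ
      have h := ih _ (good_add W hW (x k) (y k) (hxy k) γ hγ'.le)
      have hG := Real.Gamma_pos_of_pos ha
      have hnn : 0 ≤ γ ^ (a - 1) * Real.exp (-γ) / Real.Gamma a := by positivity
      simp only [ENNReal.ofReal_mul hnn]
      rw [lintegral_const_mul' _ _ ENNReal.ofReal_ne_top]
      refine (mul_one _).symm.trans ?_
      rw [← h]
      congr 1
      refine lintegral_congr fun p => ?_
      rw [dens_add, hMKadd]
      congr 1; ring
    have h2 := gamma_total a ha
    rw [setLIntegral_congr_fun measurableSet_Ioi h1, lintegral_lintegral_swap] at h2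
    · rw [← h2]
      refine lintegral_congr fun p => ?_
      obtain ⟨P0, P1, hP⟩ := det_affine (MK W η x y a S p) (MK_posDef W hW η hη x y a ha.le S p) p.1 (x k) (y k)
      simp only [hP]
      rw [gamma_mix a _ P0 P1 _ ha (Bv_pos _ _ _ _) (mul_nonneg (prodB_pos x y (-a) S p).le (dens_pos W η p).le)]
      · congr 1
        rw [← hP, Finset.prod_insert hk]
        have : MK W η x y a (insert k S) p = MK W η x y a S p + (a / Bv p.1 p.2 (x k) (y k)) • Kp p.1 (x k) (y k) := by
          unfold MK; rw [Finset.sum_insert hk]; abel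
        rw [this]; ring
      · intro γ hγ
        rw [← hP]
        exact ((MK_posDef W hW η hη x y a ha.le S p).add_posSemidef ((Kp_posSemidef _ _ _).smul hγ.le)).det_pos.le
    · refine Measurable.aemeasurable ?_
      refine ENNReal.measurable_ofReal.comp ?_
      refine Measurable.mul ?_ ?_
      · refine Measurable.div_const (Measurable.mul ?_ ?_) _
        · exact measurable_fst.pow_const _
        · exact Real.measurable_exp.comp measurable_fst.neg
      · refine Continuous.measurable ?_
        refine Continuous.mul (Continuous.mul (Continuous.mul ?_ ?_) ?_) ?_
        · exact (prodB_cont x y (-a) S).comp continuous_snd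
        · exact (dens_cont W η).comp continuous_snd
        · refine Continuous.matrix_det ?_
          exact ((MK_cont W η x y a S).comp continuous_snd).add (continuous_fst.smul ((Kp_cont _ _).comp continuous_snd))
        · refine Real.continuous_exp.comp (Continuous.neg (continuous_fst.mul (Continuous.sub ?_ continuous_const)))
          exact (Bv_cont _ _).comp continuous_snd

end H22

end PartH

section PartI
open Matrix
namespace H22
variable {V : Type} [Fintype V] [DecidableEq V]

lemma one_le_zv (t s : V → ℝ) (k : V) : 1 ≤ zv t s k := by
  unfold zv
  have := Real.one_le_cosh (t k)
  have : 0 ≤ (1 / 2) * (s k) ^ 2 * Real.exp (t k) := by positivity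
  linarith

lemma Bv_le (t s : V → ℝ) (x y : V) : Bv t s x y ≤ 4 * (zv t s x * zv t s y) := by
  unfold Bv zv
  rw [Real.exp_add, Real.cosh_sub]
  have hx := Real.one_le_cosh (t x)
  have hy := Real.one_le_cosh (t y)
  have ex := Real.exp_pos (t x)
  have ey := Real.exp_pos (t y)
  have hx2 : Real.exp (t x) ≤ 2 * Real.cosh (t x) := by rw [Real.cosh_eq]; have := Real.exp_pos (-t x); linarith
  have hy2 : Real.exp (t y) ≤ 2 * Real.cosh (t y) := by rw [Real.cosh_eq]; have := Real.exp_pos (-t y); linarith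
  have hs : -(Real.sinh (t x) * Real.sinh (t y)) ≤ Real.cosh (t x) * Real.cosh (t y) := by
    have := Real.cosh_pos (t x + t y); rw [Real.cosh_add] at this; linarith
  have h1 : (s x - s y)^2 ≤ 2 * s x ^ 2 + 2 * s y ^ 2 := by nlinarith [sq_nonneg (s x + s y)]
  have h2 : (s x - s y)^2 * (Real.exp (t x) * Real.exp (t y)) ≤ (2 * s x ^ 2 + 2 * s y ^ 2) * (Real.exp (t x) * Real.exp (t y)) :=
    mul_le_mul_of_nonneg_right h1 (by positivity)
  have h3 : s x ^ 2 * Real.exp (t x) * Real.exp (t y) ≤ s x ^ 2 * Real.exp (t x) * (2 * Real.cosh (t y)) :=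
    mul_le_mul_of_nonneg_left hy2 (by positivity)
  have h4 : s y ^ 2 * Real.exp (t y) * Real.exp (t x) ≤ s y ^ 2 * Real.exp (t y) * (2 * Real.cosh (t x)) :=
    mul_le_mul_of_nonneg_left hx2 (by positivity)
  have h5 : 0 ≤ s x ^ 2 * Real.exp (t x) * (s y ^ 2 * Real.exp (t y)) := by positivity
  have h6 : 0 ≤ Real.cosh (t x) * Real.cosh (t y) := by positivity
  nlinarith

lemma exp_bound (δ : ℝ) (hδ : 0 < δ) (M : ℕ) (Z : ℝ) (hZ : 0 ≤ Z) : Z ^ M * Real.exp (-(δ * Z)) ≤ M.factorial / δ ^ M := by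
  have h := Real.pow_div_factorial_le_exp (x := δ * Z) (by positivity) M
  rw [Real.exp_neg, ← div_eq_mul_inv, div_le_div_iff₀ (Real.exp_pos _) (by positivity)]
  rw [div_le_iff₀ (by positivity), mul_pow] at h
  linarith

/-- the remaining half of the weight -/
def hw (W : Matrix V V ℝ) (η : V → ℝ) (p : (V → ℝ) × (V → ℝ)) : ℝ :=
  Real.exp (-((1/2) * ∑ i, ∑ j, W i j * (Bv p.1 p.2 i j - 1)) - ∑ k, η k * (zv p.1 p.2 k - 1))

lemma weight_bound {ι : Type} [Fintype ι] (W : Matrix V V ℝ) (hW : Good W) (ε : ℝ) (hε : 0 < ε) (x y : ι → V) (c : ℝ) :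
    ∃ C : ℝ, ∀ p : (V → ℝ) × (V → ℝ), (∏ i, Bv p.1 p.2 (x i) (y i) ^ c) * hw W (fun _ => ε) p ≤ C := by
  obtain ⟨k, hk⟩ := exists_nat_ge c
  refine ⟨(4 ^ k) ^ Fintype.card ι * Real.exp (ε * Fintype.card V) * ((2 * k * Fintype.card ι).factorial / ε ^ (2 * k * Fintype.card ι)), fun p => ?_⟩
  set Z := ∑ v, zv p.1 p.2 v with hZ
  have hz : ∀ v, zv p.1 p.2 v ≤ Z := fun v =>
    Finset.single_le_sum (f := fun v => zv p.1 p.2 v) (fun v _ => zero_le_one.trans (one_le_zv _ _ _)) (Finset.mem_univ v)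
  have hZ0 : 0 ≤ Z := Finset.sum_nonneg fun v _ => zero_le_one.trans (one_le_zv _ _ _)
  have h1 : ∏ i, Bv p.1 p.2 (x i) (y i) ^ c ≤ ∏ i : ι, (4 ^ k * Z ^ (2 * k)) := by
    refine Finset.prod_le_prod (fun i _ => (Real.rpow_pos_of_pos (Bv_pos _ _ _ _) _).le) fun i _ => ?_
    calc Bv p.1 p.2 (x i) (y i) ^ c ≤ Bv p.1 p.2 (x i) (y i) ^ (k : ℝ) := Real.rpow_le_rpow_of_exponent_le (one_le_Bv _ _ _ _) hk
      _ = Bv p.1 p.2 (x i) (y i) ^ k := Real.rpow_natCast _ _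
      _ ≤ (4 * (Z * Z)) ^ k := by
        refine pow_le_pow_left₀ (Bv_pos _ _ _ _).le ((Bv_le _ _ _ _).trans ?_) _
        have := mul_le_mul (hz (x i)) (hz (y i)) (zero_le_one.trans (one_le_zv _ _ _)) hZ0
        linarith
      _ = 4 ^ k * Z ^ (2 * k) := by rw [mul_pow, ← pow_two, ← pow_mul]
  have h2 : hw W (fun _ => ε) p ≤ Real.exp (ε * Fintype.card V) * Real.exp (-(ε * Z)) := by
    unfold hw
    rw [← Real.exp_add]
    refine Real.exp_le_exp.2 ?_
    have : 0 ≤ ∑ i, ∑ j, W i j * (Bv p.1 p.2 i j - 1) := Finset.sum_nonneg fun i _ => Finset.sum_nonneg fun j _ =>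
      mul_nonneg (hW.nonneg i j) (sub_nonneg.2 (one_le_Bv _ _ _ _))
    rw [← Finset.mul_sum, Finset.sum_sub_distrib, ← hZ]
    simp only [Finset.sum_const, Finset.card_univ, nsmul_eq_mul, mul_one]
    linarith
  have h3 := exp_bound ε hε (2 * k * Fintype.card ι) Z hZ0
  rw [Finset.prod_const, Finset.card_univ, mul_pow, ← pow_mul Z] at h1
  calc (∏ i, Bv p.1 p.2 (x i) (y i) ^ c) * hw W (fun _ => ε) p ≤ 
      ((4 ^ k) ^ Fintype.card ι * Z ^ (2 * k * Fintype.card ι)) * (Real.exp (ε * Fintype.card V) * Real.exp (-(ε * Z))) :=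
        mul_le_mul h1 h2 (Real.exp_pos _).le (by positivity)
    _ = (4 ^ k) ^ Fintype.card ι * Real.exp (ε * Fintype.card V) * (Z ^ (2 * k * Fintype.card ι) * Real.exp (-(ε * Z))) := by ring
    _ ≤ _ := mul_le_mul_of_nonneg_left h3 (by positivity)

lemma Dg_half (W : Matrix V V ℝ) (η t : V → ℝ) : Dg W η t = (2:ℝ) • Dg ((1/2 : ℝ) • W) (fun k => η k / 2) t := by
  ext i j
  simp only [Dg, Matrix.sub_apply, Matrix.smul_apply, diagonal_apply, of_apply, smul_eq_mul, mul_assoc, ← Finset.mul_sum]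
  split_ifs <;> ring

lemma MK_half {ι : Type} (W : Matrix V V ℝ) (η : V → ℝ) (x y : ι → V) (a : ℝ) (S : Finset ι) (p : (V → ℝ) × (V → ℝ)) :
    MK W η x y a S p = (2:ℝ) • MK ((1/2 : ℝ) • W) (fun k => η k / 2) x y (a/2) S p := by
  unfold MK
  rw [smul_add, ← Dg_half, Finset.smul_sum]
  congr 1
  refine Finset.sum_congr rfl fun i _ => ?_
  rw [smul_smul]; congr 1; ring

lemma dens_half (W : Matrix V V ℝ) (η : V → ℝ) (p : (V → ℝ) × (V → ℝ)) :
    dens W η p = dens ((1/2 : ℝ) • W) (fun k => η k / 2) p * hw ((1/2 : ℝ) • W) (fun k => η k / 2) p := by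
  unfold dens hw
  have h1 : ∑ i, ∑ j, ((1/2 : ℝ) • W) i j * (Bv p.1 p.2 i j - 1) = (1/2) * ∑ i, ∑ j, W i j * (Bv p.1 p.2 i j - 1) := by
    simp only [Finset.mul_sum, Matrix.smul_apply, smul_eq_mul, mul_assoc]
  have h2 : ∑ k, η k / 2 * (zv p.1 p.2 k - 1) = (1/2) * ∑ k, η k * (zv p.1 p.2 k - 1) := by
    rw [Finset.mul_sum]; exact Finset.sum_congr rfl fun k _ => by ring
  rw [h1, h2]
  set A := ∑ i, ∑ j, W i j * (Bv p.1 p.2 i j - 1)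
  set E := ∑ k, η k * (zv p.1 p.2 k - 1)
  rw [show -((1/2) * A) - E = (-((1/2) * ((1/2) * A)) - (1/2) * E) + (-((1/2) * ((1/2) * A)) - (1/2) * E) by ring, Real.exp_add]
  ring

lemma integrable_all {ι : Type} [Fintype ι] (W : Matrix V V ℝ) (hW : Good W) (ε : ℝ) (hε : 0 < ε) (x y : ι → V) (hxy : ∀ i, x i ≠ y i)
    (a : ℝ) (ha : 0 < a) (m : ℝ) :
    Integrable fun p : (V → ℝ) × (V → ℝ) => (∏ i, Bv p.1 p.2 (x i) (y i) ^ m) * (MK W (fun _ => ε) x y a Finset.univ p).det * dens W (fun _ => ε) p := by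
  set W' := (1/2 : ℝ) • W with hW'
  have hG : Good W' := ⟨fun i j => by simp [hW', hW.symm i j], fun i j => by have := hW.nonneg i j; simp [hW']; linarith, fun i => by simp [hW', hW.diag]⟩
  obtain ⟨C, hC⟩ := weight_bound W' hG (ε/2) (by positivity) x y (m + a/2)
  have hneg := neg_case (fun _ => ε/2) (fun _ => by positivity) x y hxy (a/2) (by positivity) Finset.univ W' hG
  set f := fun p : (V → ℝ) × (V → ℝ) => (∏ i, Bv p.1 p.2 (x i) (y i) ^ (-(a/2))) * (MK W' (fun _ => ε/2) x y (a/2) Finset.univ p).det * dens W' (fun _ => ε/2) p with hf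
  have hfc : Continuous f := ((prodB_cont x y _ _).mul (MK_cont W' _ x y _ _).matrix_det).mul (dens_cont _ _)
  have hf0 : ∀ p, 0 ≤ f p := fun p => mul_nonneg (mul_nonneg (prodB_pos x y _ _ p).le (MK_posDef W' hG _ (fun _ => by positivity) x y _ (by positivity) _ p).det_pos.le) (dens_pos _ _ p).le
  have hfi : Integrable f := by
    refine ⟨hfc.aestronglyMeasurable, ?_⟩
    rw [hasFiniteIntegral_iff_ofReal (Filter.Eventually.of_forall hf0), hneg]
    exact ENNReal.one_lt_top
  refine (hfi.const_mul (2 ^ Fintype.card V * C)).mono' ?_ ?_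
  · exact (((prodB_cont x y _ _).mul (MK_cont W _ x y _ _).matrix_det).mul (dens_cont _ _)).aestronglyMeasurable
  · refine Filter.Eventually.of_forall fun p => ?_
    have hnn : 0 ≤ (∏ i, Bv p.1 p.2 (x i) (y i) ^ m) * (MK W (fun _ => ε) x y a Finset.univ p).det * dens W (fun _ => ε) p :=
      mul_nonneg (mul_nonneg (prodB_pos x y _ _ p).le (MK_posDef W hW _ (fun _ => hε) x y _ ha.le _ p).det_pos.le) (dens_pos _ _ p).le
    rw [Real.norm_of_nonneg hnn]
    have e1 : (∏ i, Bv p.1 p.2 (x i) (y i) ^ m) = (∏ i, Bv p.1 p.2 (x i) (y i) ^ (m + a/2)) * (∏ i, Bv p.1 p.2 (x i) (y i) ^ (-(a/2))) := by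
      rw [← Finset.prod_mul_distrib]
      refine Finset.prod_congr rfl fun i _ => ?_
      rw [← Real.rpow_add (Bv_pos _ _ _ _)]; congr 1; ring
    rw [MK_half, dens_half, det_smul, e1]
    have := mul_le_mul_of_nonneg_left (hC p) (mul_nonneg (show (0:ℝ) ≤ 2 ^ Fintype.card V by positivity) (hf0 p))
    simp only [hf] at this ⊢
    linarith

lemma MK_eq_smul {ι : Type} (W : Matrix V V ℝ) (η : V → ℝ) (x y : ι → V) (a : ℝ) (S : Finset ι) (p : (V → ℝ) × (V → ℝ)) :
    MK W η x y a S p = a • (∑ i ∈ S, (1 / Bv p.1 p.2 (x i) (y i)) • Kp p.1 (x i) (y i)) + Dg W η p.1 := by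
  unfold MK
  rw [add_comm, Finset.smul_sum]
  congr 1
  refine Finset.sum_congr rfl fun i _ => ?_
  rw [smul_smul]; congr 1; ring

open Polynomial in
lemma det_interp (A D : Matrix V V ℝ) (c : ℝ) :
    (c • A + D).det = ∑ j ∈ Finset.range (Fintype.card V + 1), (Lagrange.basis (Finset.range (Fintype.card V + 1)) (fun j : ℕ => (j:ℝ) + 1) j).eval c * (((j:ℝ) + 1) • A + D).det := by
  set f : ℝ[X] := det ((X : ℝ[X]) • A.map C + D.map C) with hf
  have hev : ∀ c : ℝ, f.eval c = (c • A + D).det := fun c => by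
    rw [hf, ← Polynomial.coe_evalRingHom, RingHom.map_det]
    congr 1
    ext i j
    simp
    ring
  have hdeg : f.degree < (Finset.range (Fintype.card V + 1)).card := by
    rw [Finset.card_range]
    refine lt_of_le_of_lt Polynomial.degree_le_natDegree ?_
    have := Polynomial.natDegree_det_X_add_C_le A D
    exact_mod_cast Nat.lt_succ_of_le this
  have h := Lagrange.eq_interpolate (v := fun j : ℕ => (j:ℝ) + 1) (fun a _ b _ hab => by simpa using hab) hdeg
  rw [← hev c]
  conv_lhs => rw [h, Lagrange.interpolate_apply]
  rw [Polynomial.eval_finsetSum]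
  refine Finset.sum_congr rfl fun j _ => ?_
  rw [eval_mul, eval_C, hev]; ring

theorem ward_all {ι : Type} [Fintype ι] (W : Matrix V V ℝ) (hW : Good W) (ε : ℝ) (hε : 0 < ε) (x y : ι → V) (hxy : ∀ i, x i ≠ y i) (m : ℝ) :
    ∫ p : (V → ℝ) × (V → ℝ), (∏ i, Bv p.1 p.2 (x i) (y i) ^ m) * (MK W (fun _ => ε) x y (-m) Finset.univ p).det * dens W (fun _ => ε) p = 1 := by
  set η : V → ℝ := fun _ => ε with hη
  set X : (V → ℝ) × (V → ℝ) → ℝ := fun p => ∑ i, Real.log (Bv p.1 p.2 (x i) (y i)) with hX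
  have hXe : ∀ (m : ℝ) p, ∏ i, Bv p.1 p.2 (x i) (y i) ^ m = Real.exp (m * X p) := fun m p => by
    rw [hX, Finset.mul_sum, Real.exp_sum]
    refine Finset.prod_congr rfl fun i _ => ?_
    rw [Real.rpow_def_of_pos (Bv_pos _ _ _ _), mul_comm]
  set Q : ℕ → (V → ℝ) × (V → ℝ) → ℝ := fun j p => (MK W η x y ((j:ℝ)+1) Finset.univ p).det * dens W η p with hQ
  have hQ0 : ∀ j p, 0 ≤ Q j p := fun j p => mul_nonneg (MK_posDef W hW _ (fun _ => hε) x y _ (by positivity) _ p).det_pos.le (dens_pos _ _ p).le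
  have hQc : ∀ j, Continuous (Q j) := fun j => (MK_cont W _ x y _ _).matrix_det.mul (dens_cont _ _)
  have hQm : ∀ j, Measurable fun p => ENNReal.ofReal (Q j p) := fun j => ENNReal.measurable_ofReal.comp (hQc j).measurable
  set μ : ℕ → Measure ((V → ℝ) × (V → ℝ)) := fun j => volume.withDensity fun p => ENNReal.ofReal (Q j p) with hμ
  have hint : ∀ j (m : ℝ), Integrable fun p => Q j p * Real.exp (m * X p) := fun j m => by
    have := integrable_all W hW ε hε x y hxy ((j:ℝ)+1) (by positivity) m
    refine this.congr (Filter.Eventually.of_forall fun p => ?_)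
    dsimp only
    rw [hXe]; simp only [hQ]; ring
  have hintμ : ∀ j (m : ℝ), Integrable (fun p => Real.exp (m * X p)) (μ j) := fun j m => by
    rw [hμ, integrable_withDensity_iff_integrable_smul' (hQm j) (Filter.Eventually.of_forall fun _ => ENNReal.ofReal_lt_top)]
    refine (hint j m).congr (Filter.Eventually.of_forall fun p => ?_)
    dsimp only
    rw [ENNReal.toReal_ofReal (hQ0 j p), smul_eq_mul]
  have hmgf : ∀ j (m : ℝ), ProbabilityTheory.mgf X (μ j) m = ∫ p, Q j p * Real.exp (m * X p) := fun j m => by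
    rw [ProbabilityTheory.mgf, hμ, integral_withDensity_eq_integral_toReal_smul (hQm j) (Filter.Eventually.of_forall fun _ => ENNReal.ofReal_lt_top)]
    refine integral_congr_ae (Filter.Eventually.of_forall fun p => ?_)
    dsimp only
    rw [ENNReal.toReal_ofReal (hQ0 j p), smul_eq_mul]
  have han : ∀ j, AnalyticOnNhd ℝ (ProbabilityTheory.mgf X (μ j)) Set.univ := fun j => by
    have : ProbabilityTheory.integrableExpSet X (μ j) = Set.univ := Set.eq_univ_of_forall fun m => hintμ j m
    have h := ProbabilityTheory.analyticOnNhd_mgf (X := X) (μ := μ j)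
    rwa [this, interior_univ] at h
  set s := Finset.range (Fintype.card V + 1) with hs
  set ℓ : ℕ → Polynomial ℝ := fun j => Lagrange.basis s (fun j : ℕ => (j:ℝ) + 1) j with hℓ
  set F : ℝ → ℝ := fun m => ∑ j ∈ s, (ℓ j).eval (-m) * ProbabilityTheory.mgf X (μ j) m with hF
  have hFan : AnalyticOnNhd ℝ F Set.univ := by
    refine Finset.analyticOnNhd_fun_sum _ fun j _ => AnalyticOnNhd.mul ?_ (han j)
    have : AnalyticOnNhd ℝ (fun m : ℝ => -m) Set.univ := analyticOnNhd_id.neg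
    have h2 := this.aeval_polynomial (ℓ j)
    simpa [Polynomial.coe_aeval_eq_eval] using h2
  have hFint : ∀ m, F m = ∫ p : (V → ℝ) × (V → ℝ), (∏ i, Bv p.1 p.2 (x i) (y i) ^ m) * (MK W η x y (-m) Finset.univ p).det * dens W η p := fun m => by
    simp only [hF, hmgf]
    simp only [← integral_const_mul]
    rw [← integral_finsetSum _ fun j _ => (hint j m).const_mul _]
    refine integral_congr_ae (Filter.Eventually.of_forall fun p => ?_)
    dsimp only
    rw [hXe]
    generalize Real.exp (m * X p) = ee
    rw [MK_eq_smul, det_interp, Finset.mul_sum, Finset.sum_mul]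
    refine Finset.sum_congr rfl fun j _ => ?_
    simp only [hQ, hℓ]
    rw [MK_eq_smul]; ring
  have hneg : ∀ m < 0, F m = 1 := fun m hm => by
    rw [hFint]
    have h := neg_case η (fun _ => hε) x y hxy (-m) (by linarith) Finset.univ W hW
    rw [neg_neg] at h
    rw [integral_eq_lintegral_of_nonneg_ae, h, ENNReal.toReal_one]
    · refine Filter.Eventually.of_forall fun p => ?_
      exact mul_nonneg (mul_nonneg (prodB_pos x y _ _ p).le (MK_posDef W hW _ (fun _ => hε) x y _ (by linarith) _ p).det_pos.le) (dens_pos _ _ p).le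
    · exact (((prodB_cont x y _ _).mul (MK_cont W _ x y _ _).matrix_det).mul (dens_cont _ _)).aestronglyMeasurable
  have hall : F = fun _ => 1 := hFan.eq_of_eventuallyEq analyticOnNhd_const (z₀ := -1)
    (Filter.eventually_of_mem (Iio_mem_nhds (by norm_num : (-1:ℝ) < 0)) fun m hm => hneg m hm)
  rw [← hFint, hall]

end H22

end PartI

/-- The nearest-neighbour weight matrix. -/
def H22.WNN {L : ℕ} (β : ℝ) : Matrix (Torus (L + 2)) (Torus (L + 2)) ℝ :=
  Matrix.of fun i j => if NN i j then β else 0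

lemma H22.NN_symm {L : ℕ} {x y : Torus L} (h : NN x y) : NN y x := by
  obtain ⟨h1, i, h2 | h2⟩ := h
  · exact ⟨h1.symm, i, Or.inr (by rw [h2]; abel)⟩
  · exact ⟨h1.symm, i, Or.inl (by rw [h2]; abel)⟩

lemma H22.good_WNN {L : ℕ} (β : ℝ) (hβ : 0 < β) : H22.Good (H22.WNN (L := L) β) where
  symm i j := by
    have : NN i j ↔ NN j i := ⟨H22.NN_symm, H22.NN_symm⟩
    simp only [H22.WNN, Matrix.of_apply, this]
  nonneg i j := by
    simp only [H22.WNN, Matrix.of_apply]; split_ifs <;> linarith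
  diag i := by
    have : ¬ NN i i := fun h => h.1 rfl
    simp only [H22.WNN, Matrix.of_apply, this, if_false]

lemma H22.Dmat_eq {L : ℕ} (β ε : ℝ) (t : Torus (L + 2) → ℝ) :
    Dmat β ε t = H22.Dg (H22.WNN β) (fun _ => ε) t := by
  ext i j
  have hs : ∀ i : Torus (L+2), ∑ k, H22.WNN β i k * Real.exp (t i + t k) = β * ∑ k : Torus (L+2), if NN k i then Real.exp (t k + t i) else 0 := fun i => by
    rw [Finset.mul_sum]
    refine Finset.sum_congr rfl fun k _ => ?_
    have : NN i k ↔ NN k i := ⟨H22.NN_symm, H22.NN_symm⟩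
    simp only [H22.WNN, Matrix.of_apply, this]
    split_ifs
    · rw [add_comm]
    · simp
  simp only [Dmat, H22.Dg, Matrix.sub_apply, Matrix.of_apply, Matrix.diagonal_apply]
  rw [hs]
  by_cases h : i = j
  · subst h
    have : ¬ NN i i := fun h => h.1 rfl
    simp [H22.WNN, this]
  · simp only [h, if_false, H22.WNN, Matrix.of_apply]
    split_ifs <;> simp

lemma H22.dens_eq_final {L : ℕ} (β ε : ℝ) (p : (Torus (L + 2) → ℝ) × (Torus (L + 2) → ℝ)) :
    Real.exp (-(β * nnSum (fun i j => Bq p.1 p.2 i j - 1))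
        - ε * ∑ k : Torus (L + 2), (zb p.1 p.2 k - 1)) *
      (∏ k : Torus (L + 2), Real.exp (-(p.1 k))) * ((2 * Real.pi)⁻¹) ^ (Fintype.card (Torus (L + 2))) =
    H22.dens (H22.WNN β) (fun _ => ε) p := by
  unfold H22.dens nnSum
  have h1 : β * ((1 / 2) * ∑ x : Torus (L + 2), ∑ y : Torus (L + 2), if NN x y then Bq p.1 p.2 x y - 1 else 0) =
      (1/2) * ∑ i, ∑ j, H22.WNN β i j * (H22.Bv p.1 p.2 i j - 1) := by
    rw [mul_left_comm, Finset.mul_sum]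
    congr 1
    refine Finset.sum_congr rfl fun i _ => ?_
    rw [Finset.mul_sum]
    refine Finset.sum_congr rfl fun j _ => ?_
    simp only [H22.WNN, Matrix.of_apply]
    split_ifs
    · rfl
    · simp
  have h2 : ε * ∑ k : Torus (L + 2), (zb p.1 p.2 k - 1) =
      ∑ k : Torus (L + 2), (fun _ => ε) k * (H22.zv p.1 p.2 k - 1) := by
    rw [Finset.mul_sum]; rfl
  rw [h1, h2]

lemma H22.det_final {L : ℕ} (β ε : ℝ) (hβ : 0 < β) (hε : 0 < ε) (m : ℝ) (n : ℕ) (x y : Fin n → Torus (L + 2))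
    (t s : Torus (L + 2) → ℝ) :
    ((1 : Matrix (Fin n) (Fin n) ℝ) - m • Matrix.of fun i j : Fin n =>
              qform (Dmat β ε t)⁻¹ (gvec t s (x i) (y i)) (gvec t s (x j) (y j))).det * (Dmat β ε t).det =
    (H22.MK (H22.WNN β) (fun _ => ε) x y (-m) Finset.univ (t, s)).det := by
  have hpd := H22.Dg_posDef (H22.WNN β) (H22.good_WNN β hβ) (fun _ => ε) t (fun _ => hε)
  rw [H22.Dmat_eq]
  set D := H22.Dg (H22.WNN β) (fun _ => ε) t with hD
  set G : Matrix (Fin n) (Torus (L + 2)) ℝ := Matrix.of fun i a => gvec t s (x i) (y i) a with hG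
  have h1 : (Matrix.of fun i j : Fin n => qform D⁻¹ (gvec t s (x i) (y i)) (gvec t s (x j) (y j))) = G * D⁻¹ * G.transpose := by
    ext i j
    simp only [qform, Matrix.of_apply, Matrix.mul_apply, Matrix.transpose_apply, hG, Finset.sum_mul]
    rw [Finset.sum_comm]
  have h2 : H22.MK (H22.WNN β) (fun _ => ε) x y (-m) Finset.univ (t, s) = D + ((-m) • G.transpose) * G := by
    unfold H22.MK
    rw [← hD]
    congr 1
    ext a b
    rw [Matrix.sum_apply]
    simp only [Matrix.smul_mul, Matrix.smul_apply, Matrix.mul_apply, Matrix.transpose_apply, smul_eq_mul, Finset.mul_sum]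
    refine Finset.sum_congr rfl fun i _ => ?_
    simp only [hG, Matrix.of_apply, gvec, H22.Kp, Matrix.smul_apply, Matrix.vecMulVec_apply, smul_eq_mul]
    have hB : 0 < Bq t s (x i) (y i) := H22.Bv_pos t s (x i) (y i)
    have e1 : Bq t s (x i) (y i) ^ (-(1 / 2) : ℝ) * Bq t s (x i) (y i) ^ (-(1 / 2) : ℝ) = (Bq t s (x i) (y i))⁻¹ := by
      rw [← Real.rpow_add hB, ← Real.rpow_neg_one]; norm_num
    have e2 : Real.exp (t (x i) + t (y i)) = Real.exp ((t (x i) + t (y i)) / 2) * Real.exp ((t (x i) + t (y i)) / 2) := by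
      rw [← Real.exp_add]; congr 1; ring
    have e3 : ∀ a, H22.dl (x i) (y i) a = delta (x i) a - delta (y i) a := fun a => by
      simp only [H22.dl, delta]
    rw [e2, e3, e3, show H22.Bv t s (x i) (y i) = Bq t s (x i) (y i) from rfl, div_eq_mul_inv, ← e1]
    ring
  rw [h1, h2, Matrix.det_add_mul _ _ hpd.det_pos.ne'.isUnit, mul_comm]
  congr 2
  rw [Matrix.mul_smul, neg_smul, sub_eq_add_neg]

/-- **Multi-pair supersymmetric Ward identity.** For every `m ∈ ℝ` and `n` pairs of
distinct sites, `1 = ⟨∏ B_{x_i y_i}^m · det(Iₙ - m 𝒢)⟩` where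
`𝒢_{ij} = [g_i; D_{β,ε}(t)⁻¹ g_j]`. -/
theorem multi_susy_ward_identity (β ε : ℝ) (hβ : 0 < β) (hε : 0 < ε) (L : ℕ)
    (m : ℝ) (n : ℕ) (x y : Fin n → Torus (L + 2)) (hxy : ∀ i, x i ≠ y i) :
    tsExpect β ε (fun t s =>
        (∏ i, Bq t s (x i) (y i) ^ m) *
          ((1 : Matrix (Fin n) (Fin n) ℝ) - m • Matrix.of fun i j : Fin n =>
              qform (Dmat β ε t)⁻¹ (gvec t s (x i) (y i)) (gvec t s (x j) (y j))).det) =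
      1 := by
  unfold tsExpect
  refine Eq.trans ?_ (H22.ward_all (H22.WNN β) (H22.good_WNN β hβ) ε hε x y hxy m)
  refine integral_congr_ae (Filter.Eventually.of_forall fun p => ?_)
  dsimp only
  rw [← H22.dens_eq_final, ← H22.det_final β ε hβ hε]
  have : ∀ i, H22.Bv p.1 p.2 (x i) (y i) = Bq p.1 p.2 (x i) (y i) := fun _ => rfl
  simp only [this]
  ring

end
end
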